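/- If ε₂·ε_{p₁p₂}·ε_{2p₁p₂} is a square in K₃⁺, then Cl₂(K₃) is isomorphic to ℤ/2^{min(m, n+1)} ℤ × ℤ/2^{max(m+1, n+2)} ℤ. -/

import Mathlib

open NumberField IntermediateField

/-- `ε` is the fundamental unit of the real quadratic field `ℚ(√D)` (for `D > 1` squarefree):
elements of the ring of integers of `ℚ(√D)` are exactly the numbers `(x + y√D)/2` with
`x ≡ y·D (mod 2)`, and units are those with `x² - Dy² = ±4`.  The fundamental unit is the
least unit `> 1`; equivalently, every unit is of the form `±ε^k` with `k ∈ ℤ`. -/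
def IsFundUnit (D : ℕ) (ε : ℝ) : Prop :=
  1 < ε ∧
  (∃ x y : ℤ, ε = ((x : ℝ) + (y : ℝ) * Real.sqrt D) / 2 ∧
    (x ^ 2 - (D : ℤ) * y ^ 2 = 4 ∨ x ^ 2 - (D : ℤ) * y ^ 2 = -4)) ∧
  ∀ x y : ℤ, (x ^ 2 - (D : ℤ) * y ^ 2 = 4 ∨ x ^ 2 - (D : ℤ) * y ^ 2 = -4) →
    1 < ((x : ℝ) + (y : ℝ) * Real.sqrt D) / 2 →
    ε ≤ ((x : ℝ) + (y : ℝ) * Real.sqrt D) / 2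

set_option linter.unusedSectionVars false

section ClassMaps

variable {F L M : Type*} [Field F] [Field L] [Field M]

/-- The extension of an ideal of `𝓞 F` along a homomorphism of fields `f : F →+* L`. -/
noncomputable def extIdeal (f : F →+* L) (I : Ideal (𝓞 F)) : Ideal (𝓞 L) :=
  I.map (RingOfIntegers.mapRingHom f)

lemma mapRingHom_injective (f : F →+* L) :
    Function.Injective (RingOfIntegers.mapRingHom f) := by
  intro x y h
  have h2 := congrArg (algebraMap (𝓞 L) L) h
  exact RingOfIntegers.ext (f.injective h2)

lemma extIdeal_mul (f : F →+* L) (I J : Ideal (𝓞 F)) :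
    extIdeal f (I * J) = extIdeal f I * extIdeal f J := Ideal.map_mul _ _ _

lemma extIdeal_pow (f : F →+* L) (I : Ideal (𝓞 F)) (n : ℕ) :
    extIdeal f (I ^ n) = extIdeal f I ^ n := Ideal.map_pow _ _ _

lemma extIdeal_span (f : F →+* L) (x : 𝓞 F) :
    extIdeal f (Ideal.span {x}) = Ideal.span {RingOfIntegers.mapRingHom f x} := by
  rw [extIdeal, Ideal.map_span, Set.image_singleton]

lemma extIdeal_one (f : F →+* L) : extIdeal f 1 = 1 := by
  rw [extIdeal, Ideal.one_eq_top, Ideal.map_top, Ideal.one_eq_top]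

lemma extIdeal_eq_zero_iff (f : F →+* L) {I : Ideal (𝓞 F)} : extIdeal f I = 0 ↔ I = 0 :=
  Ideal.map_eq_bot_iff_of_injective (mapRingHom_injective f)

lemma extIdeal_ne_zero (f : F →+* L) {I : Ideal (𝓞 F)} (h : I ≠ 0) : extIdeal f I ≠ 0 :=
  (extIdeal_eq_zero_iff f).not.mpr h

lemma extIdeal_mono (f : F →+* L) {I J : Ideal (𝓞 F)} (h : I ≤ J) : extIdeal f I ≤ extIdeal f J :=
  Ideal.map_mono h

lemma extIdeal_comp (f : F →+* L) (g : L →+* M) (I : Ideal (𝓞 F)) :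
    extIdeal g (extIdeal f I) = extIdeal (g.comp f) I := by
  rw [extIdeal, extIdeal, extIdeal, Ideal.map_map]
  rfl

lemma extIdeal_id (I : Ideal (𝓞 F)) : extIdeal (RingHom.id F) I = I := Ideal.map_id I

lemma mem_extIdeal (f : F →+* L) {I : Ideal (𝓞 F)} {x : 𝓞 F} (h : x ∈ I) :
    RingOfIntegers.mapRingHom f x ∈ extIdeal f I := Ideal.mem_map_of_mem _ h

variable [NumberField F] [NumberField L] [NumberField M]

open Classical in
/-- The class of an ideal, with the convention that the zero ideal has trivial class. -/
noncomputable def idealClass (I : Ideal (𝓞 L)) : ClassGroup (𝓞 L) :=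
  if h : I ≠ 0 then ClassGroup.mk0 ⟨I, mem_nonZeroDivisors_iff_ne_zero.mpr h⟩ else 1

lemma idealClass_of_ne {I : Ideal (𝓞 L)} (h : I ≠ 0) :
    idealClass I = ClassGroup.mk0 ⟨I, mem_nonZeroDivisors_iff_ne_zero.mpr h⟩ := dif_pos h

lemma idealClass_mul {I J : Ideal (𝓞 L)} (hI : I ≠ 0) (hJ : J ≠ 0) :
    idealClass (I * J) = idealClass I * idealClass J := by
  rw [idealClass_of_ne hI, idealClass_of_ne hJ, idealClass_of_ne (mul_ne_zero hI hJ), ← map_mul]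
  rfl

lemma exists_idealClass (x : ClassGroup (𝓞 L)) : ∃ I : Ideal (𝓞 L), I ≠ 0 ∧ idealClass I = x := by
  obtain ⟨⟨I, hI⟩, rfl⟩ := ClassGroup.mk0_surjective x
  have h := mem_nonZeroDivisors_iff_ne_zero.mp hI
  exact ⟨I, h, idealClass_of_ne h⟩

lemma idealClass_eq_iff {I J : Ideal (𝓞 L)} (hI : I ≠ 0) (hJ : J ≠ 0) :
    idealClass I = idealClass J ↔
      ∃ x y : 𝓞 L, x ≠ 0 ∧ y ≠ 0 ∧ Ideal.span {x} * I = Ideal.span {y} * J := by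
  rw [idealClass_of_ne hI, idealClass_of_ne hJ, ClassGroup.mk0_eq_mk0_iff]
  simp only [exists_prop]

lemma idealClass_eq_one_iff {I : Ideal (𝓞 L)} (hI : I ≠ 0) :
    idealClass I = 1 ↔ ∃ x : 𝓞 L, x ≠ 0 ∧ I = Ideal.span {x} := by
  rw [idealClass_of_ne hI, ClassGroup.mk0_eq_one_iff]
  constructor
  · rintro ⟨x, hx⟩
    refine ⟨x, ?_, hx⟩
    rintro rfl
    exact hI (by simpa using hx)
  · rintro ⟨x, -, hx⟩
    exact ⟨x, hx⟩

lemma span_ne_zero {x : 𝓞 L} (hx : x ≠ 0) : Ideal.span {x} ≠ 0 := by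
  simpa using hx

lemma idealClass_span {x : 𝓞 L} (hx : x ≠ 0) : idealClass (Ideal.span {x}) = 1 :=
  (idealClass_eq_one_iff (span_ne_zero hx)).mpr ⟨x, hx, rfl⟩

lemma idealClass_one : idealClass (1 : Ideal (𝓞 L)) = 1 := by
  rw [Ideal.one_eq_top, ← Ideal.span_singleton_one, idealClass_span one_ne_zero]

lemma idealClass_pow {I : Ideal (𝓞 L)} (hI : I ≠ 0) (n : ℕ) :
    idealClass (I ^ n) = idealClass I ^ n := by
  induction n with
  | zero => rw [pow_zero, pow_zero, idealClass_one]
  | succ k ih => rw [pow_succ, idealClass_mul (pow_ne_zero _ hI) hI, ih, pow_succ]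

/-- The homomorphism of class groups induced by a homomorphism of number fields. -/
noncomputable def classMap (f : F →+* L) : ClassGroup (𝓞 F) →* ClassGroup (𝓞 L) :=
  letI : Algebra (𝓞 F) (𝓞 L) := (RingOfIntegers.mapRingHom f).toAlgebra
  haveI : FaithfulSMul (𝓞 F) (𝓞 L) :=
    (faithfulSMul_iff_algebraMap_injective _ _).mpr (mapRingHom_injective f)
  ClassGroup.extendedHom (𝓞 F) (𝓞 L)

lemma classMap_idealClass (f : F →+* L) {I : Ideal (𝓞 F)} (hI : I ≠ 0) :
    classMap f (idealClass I) = idealClass (extIdeal f I) := by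
  let : Algebra (𝓞 F) (𝓞 L) := (RingOfIntegers.mapRingHom f).toAlgebra
  have : FaithfulSMul (𝓞 F) (𝓞 L) :=
    (faithfulSMul_iff_algebraMap_injective _ _).mpr (mapRingHom_injective f)
  rw [idealClass_of_ne hI, idealClass_of_ne (extIdeal_ne_zero f hI)]
  exact ClassGroup.extendedHom_mk0 (𝓞 F) (𝓞 L) _

lemma classMap_comp (f : F →+* L) (g : L →+* M) (x : ClassGroup (𝓞 F)) :
    classMap g (classMap f x) = classMap (g.comp f) x := by
  obtain ⟨I, hI, rfl⟩ := exists_idealClass x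
  rw [classMap_idealClass f hI, classMap_idealClass g (extIdeal_ne_zero f hI),
    classMap_idealClass _ hI, extIdeal_comp]

lemma classMap_id (x : ClassGroup (𝓞 F)) : classMap (RingHom.id F) x = x := by
  obtain ⟨I, hI, rfl⟩ := exists_idealClass x
  rw [classMap_idealClass _ hI, extIdeal_id]

end ClassMaps

/-- `f : F →+* L` is a quadratic extension with nontrivial automorphism `g`. -/
structure QuadExt {F L : Type*} [Field F] [Field L] (f : F →+* L) (g : L →+* L) : Prop where
  invol : ∀ x, g (g x) = x
  fixed : ∀ x, g x = x → ∃ y, f y = x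
  map_base : ∀ y, g (f y) = f y
  nontriv : ∃ x, g x ≠ x

namespace QuadExt

variable {F L : Type*} [Field F] [Field L] [NumberField F] [NumberField L]
  {f : F →+* L} {g : L →+* L}

lemma hilbert90 (h : QuadExt f g) {x : L} (hx : x * g x = 1) : ∃ y, y ≠ 0 ∧ x * g y = y := by
  by_cases h1 : 1 + x = 0
  · obtain ⟨z, hz⟩ := h.nontriv
    refine ⟨z - g z, sub_ne_zero.mpr (Ne.symm hz), ?_⟩
    rw [map_sub, h.invol, eq_neg_of_add_eq_zero_right h1]
    ring
  · refine ⟨1 + x, h1, ?_⟩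
    rw [map_add, map_one, mul_add, hx]
    ring

local notation "G" => RingOfIntegers.mapRingHom g
local notation "Φ" => RingOfIntegers.mapRingHom f

lemma invol_int (h : QuadExt f g) (x : 𝓞 L) : G (G x) = x :=
  RingOfIntegers.ext (h.invol x)

lemma fixed_int (h : QuadExt f g) {x : 𝓞 L} (hx : G x = x) : ∃ y, Φ y = x := by
  obtain ⟨y, hy⟩ := h.fixed x (congrArg (algebraMap (𝓞 L) L) hx)
  have : IsIntegral ℤ y := by
    rw [← isIntegral_algHom_iff f.toIntAlgHom f.injective]
    simpa [hy] using x.isIntegral_coe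
  exact ⟨⟨y, this⟩, RingOfIntegers.ext hy⟩

lemma fixed_unit (h : QuadExt f g) {u : (𝓞 L)ˣ} (hu : G u = u) : ∃ w : (𝓞 F)ˣ, Φ w = u := by
  obtain ⟨y, hy⟩ := h.fixed_int hu
  have hu' : G (u⁻¹ : (𝓞 L)ˣ) = (u⁻¹ : (𝓞 L)ˣ) := by
    have h1 : G u * G (u⁻¹ : (𝓞 L)ˣ) = 1 := by rw [← map_mul, Units.mul_inv, map_one]
    rw [hu] at h1
    exact (Units.inv_eq_of_mul_eq_one_right h1).symm
  obtain ⟨z, hz⟩ := h.fixed_int hu'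
  have hyz : y * z = 1 := mapRingHom_injective f (by rw [map_mul, hy, hz, map_one, Units.mul_inv])
  exact ⟨⟨y, z, hyz, by rw [mul_comm, hyz]⟩, hy⟩

lemma ext_base (h : QuadExt f g) (I : Ideal (𝓞 F)) : extIdeal g (extIdeal f I) = extIdeal f I := by
  rw [extIdeal_comp]
  congr 1
  ext y
  exact h.map_base y

lemma ext_invol (h : QuadExt f g) (I : Ideal (𝓞 L)) : extIdeal g (extIdeal g I) = I := by
  rw [extIdeal_comp]
  conv_rhs => rw [← extIdeal_id I]
  congr 1
  ext y
  exact h.invol y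

lemma mem_ext_iff (h : QuadExt f g) {I : Ideal (𝓞 L)} {x : 𝓞 L} :
    x ∈ extIdeal g I ↔ G x ∈ I := by
  constructor
  · intro hx
    have := mem_extIdeal g hx
    rwa [h.ext_invol] at this
  · intro hx
    have := mem_extIdeal g hx
    rwa [h.invol_int] at this

lemma ext_le_iff (h : QuadExt f g) {I J : Ideal (𝓞 L)} :
    extIdeal g I ≤ J ↔ I ≤ extIdeal g J := by
  constructor
  · intro hx
    have := extIdeal_mono g hx
    rwa [h.ext_invol] at this
  · intro hx
    have := extIdeal_mono g hx
    rwa [h.ext_invol] at this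

lemma ext_isPrime (h : QuadExt f g) {P : Ideal (𝓞 L)} (hP : P.IsPrime) :
    (extIdeal g P).IsPrime := by
  have : extIdeal g P = P.comap G := by
    ext x
    rw [h.mem_ext_iff, Ideal.mem_comap]
  rw [this]
  exact hP.comap _

lemma mul_conj_eq (h : QuadExt f g) (x : 𝓞 L) : ∃ y, Φ y = x * G x :=
  h.fixed_int (by rw [map_mul, h.invol_int, mul_comm])

lemma add_conj_eq (h : QuadExt f g) (x : 𝓞 L) : ∃ y, Φ y = x + G x :=
  h.fixed_int (by rw [map_add, h.invol_int, add_comm])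

lemma comap_ne_zero (h : QuadExt f g) {P : Ideal (𝓞 L)} (hP : P ≠ 0) : P.comap Φ ≠ 0 := by
  obtain ⟨x, hxP, hx⟩ := Submodule.exists_mem_ne_zero_of_ne_bot hP
  obtain ⟨y, hy⟩ := h.mul_conj_eq x
  intro hb
  have hmem : y ∈ P.comap Φ := by
    rw [Ideal.mem_comap, hy]
    exact P.mul_mem_right _ hxP
  rw [hb] at hmem
  have hy0 : y = 0 := hmem
  rw [hy0, map_zero] at hy
  rcases mul_eq_zero.mp hy.symm with h1 | h1
  · exact hx h1
  · exact hx (mapRingHom_injective g (by rw [h1, map_zero]))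

lemma eq_or_eq_of_comap_le (h : QuadExt f g) {P Q : Ideal (𝓞 L)} (hP : P.IsPrime) (hP0 : P ≠ 0)
    (hQ : Q.IsPrime) (hQ0 : Q ≠ 0) (hPQ : extIdeal f (P.comap Φ) ≤ Q) :
    Q = P ∨ Q = extIdeal g P := by
  have hgP := h.ext_isPrime hP
  have hle : Q.comap Φ = P.comap Φ := by
    have h0 : P.comap Φ ≤ Q.comap Φ := Ideal.map_le_iff_le_comap.mp hPQ
    have : (P.comap Φ).IsPrime := hP.comap _
    have hPbot := h.comap_ne_zero hP0
    have hmax : (P.comap Φ).IsMaximal := this.isMaximal hPbot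
    exact (hmax.eq_of_le (hQ.comap _).ne_top h0).symm
  have hQmax : Q.IsMaximal := hQ.isMaximal hQ0
  have hsub : (Q : Set (𝓞 L)) ⊆ P ∪ extIdeal g P := by
    intro x hx
    obtain ⟨y, hy⟩ := h.mul_conj_eq x
    have hyQ : y ∈ Q.comap Φ := by
      rw [Ideal.mem_comap, hy]
      exact Q.mul_mem_right _ hx
    rw [hle, Ideal.mem_comap, hy] at hyQ
    rcases hP.mem_or_mem hyQ with h1 | h1
    · exact Or.inl h1
    · exact Or.inr (h.mem_ext_iff.mpr h1)
  rcases Ideal.subset_union.mp hsub with h1 | h1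
  · exact Or.inl (hQmax.eq_of_le hP.ne_top h1)
  · exact Or.inr (hQmax.eq_of_le hgP.ne_top h1)

lemma exists_mem_notMem_sq {P : Ideal (𝓞 L)} (hP : P.IsPrime) (hP0 : P ≠ 0) :
    ∃ x ∈ P, x ∉ P ^ 2 := by
  obtain ⟨x, h1, h2⟩ := Ideal.exists_mem_pow_notMem_pow_succ P hP0 hP.ne_top 1
  exact ⟨x, by simpa using h1, h2⟩

lemma prime_cases (h : QuadExt f g) {P : Ideal (𝓞 L)} (hP : P.IsPrime) (hP0 : P ≠ 0) :
    (extIdeal g P ≠ P ∧ extIdeal f (P.comap Φ) = P * extIdeal g P) ∨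
    (extIdeal g P = P ∧ extIdeal f (P.comap Φ) = P) ∨
    (extIdeal g P = P ∧ extIdeal f (P.comap Φ) = P ^ 2 ∧ ∀ x, x - G x ∈ P) := by
  have hle : extIdeal f (P.comap Φ) ≤ P := Ideal.map_comap_le
  have hgP := h.ext_isPrime hP
  have hgP0 := extIdeal_ne_zero g hP0
  have hPm : P.IsMaximal := hP.isMaximal hP0
  have hgPm : (extIdeal g P).IsMaximal := hgP.isMaximal hgP0
  have key : ∀ x ∈ P, x * G x ∈ extIdeal f (P.comap Φ) := by
    intro x hx
    obtain ⟨y, hy⟩ := h.mul_conj_eq x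
    rw [← hy]
    apply mem_extIdeal
    rw [Ideal.mem_comap, hy]
    exact P.mul_mem_right _ hx
  by_cases hg : extIdeal g P = P
  · right
    obtain ⟨B, hB⟩ := Ideal.dvd_iff_le.mpr hle
    by_cases hBt : B = ⊤
    · left
      exact ⟨hg, by rw [hB, hBt, Ideal.mul_top]⟩
    right
    obtain ⟨Q, hQm, hQ⟩ := Ideal.exists_le_maximal B hBt
    have hB0 : B ≠ 0 := by
      rintro rfl
      rw [mul_zero] at hB
      exact extIdeal_ne_zero f (h.comap_ne_zero hP0) hB
    have hQ0 : Q ≠ 0 := by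
      rintro rfl
      exact hB0 (le_bot_iff.mp hQ)
    have hQP : Q = P := by
      have := h.eq_or_eq_of_comap_le hP hP0 hQm.isPrime hQ0
        (hB.le.trans (Ideal.mul_le_right.trans hQ))
      rwa [hg, or_self] at this
    obtain ⟨C, hC⟩ := Ideal.dvd_iff_le.mpr (hQP ▸ hQ)
    obtain ⟨x, hx, hx2⟩ := exists_mem_notMem_sq hP hP0
    have hGx : G x ∈ P := by rw [← h.mem_ext_iff, hg]; exact hx
    have hGx2 : G x ∉ P ^ 2 := by rw [← h.mem_ext_iff, extIdeal_pow, hg]; exact hx2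
    have hC1 : C = ⊤ := by
      by_contra hCt
      obtain ⟨Q', hQm', hQ'⟩ := Ideal.exists_le_maximal C hCt
      have hC0 : C ≠ 0 := by
        rintro rfl
        rw [mul_zero] at hC
        exact hB0 hC
      have hQ0' : Q' ≠ 0 := by
        rintro rfl
        exact hC0 (le_bot_iff.mp hQ')
      have hQP' : Q' = P := by
        have := h.eq_or_eq_of_comap_le hP hP0 hQm'.isPrime hQ0'
          (hB.le.trans (Ideal.mul_le_right.trans (hC.le.trans (Ideal.mul_le_right.trans hQ'))))
        rwa [hg, or_self] at this
      have h3 : extIdeal f (P.comap Φ) ≤ P ^ 3 := by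
        rw [hB, hC, pow_succ' P 2, sq]
        exact Ideal.mul_mono_right (Ideal.mul_mono_right (hQP' ▸ hQ'))
      have h4 := h3 (key x hx)
      obtain ⟨A, hA⟩ := (Ideal.dvd_span_singleton (I := P)).mpr hx
      obtain ⟨A', hA'⟩ := (Ideal.dvd_span_singleton (I := P)).mpr hGx
      rw [← Ideal.dvd_span_singleton, ← Ideal.span_singleton_mul_span_singleton, hA, hA',
        show P * A * (P * A') = P ^ 2 * (A * A') by ring, pow_succ] at h4
      have h5 := (mul_dvd_mul_iff_left (pow_ne_zero 2 hP0)).mp h4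
      rcases (Ideal.prime_of_isPrime hP0 hP).dvd_or_dvd h5 with h6 | h6
      · exact hx2 (by rw [← Ideal.dvd_span_singleton, hA, sq]; exact mul_dvd_mul_left _ h6)
      · exact hGx2 (by rw [← Ideal.dvd_span_singleton, hA', sq]; exact mul_dvd_mul_left _ h6)
    have hsq : extIdeal f (P.comap Φ) = P ^ 2 := by rw [hB, hC, hC1, Ideal.mul_top, sq]
    refine ⟨hg, hsq, fun y => ?_⟩
    have tr : ∀ z ∈ P, z + G z ∈ P ^ 2 := by
      intro z hz
      obtain ⟨w, hw⟩ := h.add_conj_eq z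
      rw [← hw, ← hsq]
      apply mem_extIdeal
      rw [Ideal.mem_comap, hw]
      exact P.add_mem hz (by rw [← h.mem_ext_iff, hg]; exact hz)
    have h1 := tr (y * x) (P.mul_mem_left _ hx)
    have h2 : G y * (x + G x) ∈ P ^ 2 := Ideal.mul_mem_left _ _ (tr x hx)
    have h3 : (y - G y) * x ∈ P ^ 2 := by
      have := (P ^ 2).sub_mem h1 h2
      rw [map_mul] at this
      convert this using 1
      ring
    rcases Ideal.IsPrime.mul_mem_pow P h3 with h4 | h4
    · exact h4
    · exact absurd h4 hx2
  · left
    refine ⟨hg, ?_⟩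
    have hcop : IsCoprime P (extIdeal g P) := Ideal.isCoprime_of_isMaximal (Ne.symm hg)
    have hle2 : extIdeal f (P.comap Φ) ≤ extIdeal g P := by
      rw [← h.ext_base]
      exact extIdeal_mono g hle
    obtain ⟨B, hB⟩ := hcop.mul_dvd (Ideal.dvd_iff_le.mpr hle) (Ideal.dvd_iff_le.mpr hle2)
    have hB0 : B ≠ 0 := by
      rintro rfl
      rw [mul_zero] at hB
      exact extIdeal_ne_zero f (h.comap_ne_zero hP0) hB
    have hnot : ∀ x ∈ P, x ∉ extIdeal g P → x ∉ P ^ 2 → ¬ extIdeal f (P.comap Φ) ≤ P ^ 2 := by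
      intro x hx hxg hx2 hc
      rcases Ideal.IsPrime.mem_pow_mul P (hc (key x hx)) with h4 | h4
      · exact hx2 h4
      · exact hxg (h.mem_ext_iff.mpr (by simpa using h4))
    have hex : ∃ x ∈ P, x ∉ extIdeal g P ∧ x ∉ P ^ 2 := by
      by_contra! hc
      have hs : (P : Set (𝓞 L)) ⊆ extIdeal g P ∪ (P ^ 2 : Ideal (𝓞 L)) := by
        intro x hx
        by_cases hxg : x ∈ extIdeal g P
        · exact Or.inl hxg
        · exact Or.inr (hc x hx hxg)
      rcases Ideal.subset_union.mp hs with h1 | h1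
      · exact hg (hPm.eq_of_le hgP.ne_top h1).symm
      · obtain ⟨x, hx, hx2⟩ := exists_mem_notMem_sq hP hP0
        exact hx2 (h1 hx)
    obtain ⟨x, hx, hxg, hx2⟩ := hex
    have hBt : B = ⊤ := by
      by_contra hBt
      obtain ⟨Q, hQm, hQ⟩ := Ideal.exists_le_maximal B hBt
      have hQ0 : Q ≠ 0 := by
        rintro rfl
        exact hB0 (le_bot_iff.mp hQ)
      have hP2 : ¬ extIdeal f (P.comap Φ) ≤ P ^ 2 := hnot x hx hxg hx2
      rcases h.eq_or_eq_of_comap_le hP hP0 hQm.isPrime hQ0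
        (hB.le.trans (Ideal.mul_le_right.trans hQ)) with h1 | h1
      · apply hP2
        rw [hB, sq, mul_right_comm]
        exact Ideal.mul_le_left.trans (Ideal.mul_mono_right (h1 ▸ hQ))
      · apply hP2
        have h5 : extIdeal f (P.comap Φ) ≤ (extIdeal g P) ^ 2 := by
          rw [hB, sq, mul_assoc]
          exact Ideal.mul_le_right.trans (Ideal.mul_mono_right (h1 ▸ hQ))
        rwa [← h.ext_base, h.ext_le_iff, extIdeal_pow, h.ext_invol] at h5
    rw [hB, hBt, Ideal.mul_top]

end QuadExt

section
variable {F L : Type*} [Field F] [Field L] [NumberField F] [NumberField L]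

lemma span_dvd_of_map_dvd (f : F →+* L) {x y : 𝓞 F}
    (h : RingOfIntegers.mapRingHom f y ∣ RingOfIntegers.mapRingHom f x) : y ∣ x := by
  by_cases hy : y = 0
  · subst hy
    rw [map_zero, zero_dvd_iff] at h
    rw [mapRingHom_injective f (h.trans (map_zero _).symm)]
  obtain ⟨z, hz⟩ := h
  have hy' : (y : F) ≠ 0 := by simpa using hy
  have hz' : f x = f y * (z : L) := congrArg (algebraMap (𝓞 L) L) hz
  have hfz : f ((x : F) / y) = z := by
    rw [map_div₀, hz', mul_div_cancel_left₀]
    exact (map_ne_zero f).mpr hy'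
  have : IsIntegral ℤ ((x : F) / y) := by
    rw [← isIntegral_algHom_iff f.toIntAlgHom f.injective]
    have h2 : f.toIntAlgHom ((x : F) / y) = z := hfz
    rw [h2]
    exact z.isIntegral_coe
  refine ⟨⟨_, this⟩, RingOfIntegers.ext ?_⟩
  change (x : F) = y * (x / y)
  rw [mul_div_cancel₀ _ hy']

lemma extIdeal_le_iff (f : F →+* L) {I J : Ideal (𝓞 F)} :
    extIdeal f I ≤ extIdeal f J ↔ I ≤ J := by
  refine ⟨fun h => ?_, extIdeal_mono f⟩
  by_cases hJ : J = 0
  · subst hJ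
    have : extIdeal f (0 : Ideal (𝓞 F)) = 0 := (extIdeal_eq_zero_iff f).mpr rfl
    rw [this] at h
    exact ((extIdeal_eq_zero_iff f).mp (le_bot_iff.mp h)).le
  obtain ⟨n, hn, hn0⟩ := Submodule.exists_mem_ne_zero_of_ne_bot hJ
  obtain ⟨J', hJ'⟩ := (Ideal.dvd_span_singleton (I := J)).mpr hn
  have hJ'0 : J' ≠ 0 := by
    rintro rfl
    rw [mul_zero] at hJ'
    exact span_ne_zero hn0 hJ'
  have hsub : I * J' ≤ J * J' := by
    rw [← hJ', Ideal.mul_le]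
    intro x hx y hy
    rw [Ideal.mem_span_singleton]
    apply span_dvd_of_map_dvd f
    rw [← Ideal.mem_span_singleton, ← extIdeal_span, hJ', extIdeal_mul, map_mul]
    exact Ideal.mul_mem_mul (h (mem_extIdeal f hx)) (mem_extIdeal f hy)
  rw [← Ideal.dvd_iff_le] at hsub ⊢
  exact (mul_dvd_mul_iff_right hJ'0).mp hsub

lemma extIdeal_injective (f : F →+* L) : Function.Injective (extIdeal f) := fun _ _ h =>
  le_antisymm ((extIdeal_le_iff f).mp h.le) ((extIdeal_le_iff f).mp h.ge)

end

namespace QuadExt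

variable {F L : Type*} [Field F] [Field L] [NumberField F] [NumberField L]
  {f : F →+* L} {g : L →+* L}
local notation "G" => RingOfIntegers.mapRingHom g
local notation "Φ" => RingOfIntegers.mapRingHom f

lemma exists_extIdeal_eq_mul_conj (h : QuadExt f g) {I : Ideal (𝓞 L)} (hI : I ≠ 0) :
    ∃ J, J ≠ 0 ∧ extIdeal f J = I * extIdeal g I := by
  induction I using UniqueFactorizationMonoid.induction_on_prime with
  | h₁ => exact absurd rfl hI
  | h₂ I hu =>
    rw [Ideal.isUnit_iff, ← Ideal.one_eq_top] at hu
    exact ⟨1, one_ne_zero, by rw [hu, extIdeal_one, extIdeal_one, one_mul]⟩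
  | h₃ I P hI0 hP ih =>
    obtain ⟨J, hJ, hJI⟩ := ih hI0
    have hP' := Ideal.isPrime_of_prime hP
    have hp0 := h.comap_ne_zero hP.ne_zero
    have : ∃ J, J ≠ 0 ∧ extIdeal f J = P * extIdeal g P := by
      rcases h.prime_cases hP' hP.ne_zero with ⟨-, h1⟩ | ⟨h1, h2⟩ | ⟨h1, h2, -⟩
      · exact ⟨_, hp0, h1⟩
      · exact ⟨_, pow_ne_zero 2 hp0, by rw [extIdeal_pow, h2, h1, sq]⟩
      · exact ⟨_, hp0, by rw [h2, h1, sq]⟩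
    obtain ⟨J', hJ', hJP⟩ := this
    exact ⟨J' * J, mul_ne_zero hJ' hJ, by rw [extIdeal_mul, extIdeal_mul, hJI, hJP]; ring⟩

lemma mul_conj_mem_range (h : QuadExt f g) (x : ClassGroup (𝓞 L)) :
    ∃ y, classMap f y = x * classMap g x := by
  obtain ⟨I, hI, rfl⟩ := exists_idealClass x
  obtain ⟨J, hJ, e⟩ := h.exists_extIdeal_eq_mul_conj hI
  exact ⟨idealClass J, by rw [classMap_idealClass f hJ, classMap_idealClass g hI, e,
    idealClass_mul hI (extIdeal_ne_zero g hI)]⟩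

lemma classMap_conj_base (h : QuadExt f g) (y : ClassGroup (𝓞 F)) :
    classMap g (classMap f y) = classMap f y := by
  obtain ⟨I, hI, rfl⟩ := exists_idealClass y
  rw [classMap_idealClass f hI, classMap_idealClass g (extIdeal_ne_zero f hI), h.ext_base]

/-- Classes of invariant ideals are generated by extended ideals and ramified primes. -/
lemma idealClass_mem_of_invariant (h : QuadExt f g) (H : Subgroup (ClassGroup (𝓞 L)))
    (hbase : ∀ y, classMap f y ∈ H)
    (hram : ∀ P : Ideal (𝓞 L), P.IsPrime → P ≠ 0 → extIdeal g P = P → (∀ x, x - G x ∈ P) →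
      idealClass P ∈ H) {I : Ideal (𝓞 L)} (hI : I ≠ 0) (hgI : extIdeal g I = I) :
    idealClass I ∈ H := by
  induction hn : Ideal.absNorm I using Nat.strong_induction_on generalizing I with
  | _ n ih =>
  subst hn
  by_cases hIt : I = ⊤
  · rw [hIt, ← Ideal.one_eq_top, idealClass_one]
    exact H.one_mem
  obtain ⟨P, hPm, hIP⟩ := Ideal.exists_le_maximal I hIt
  have hP := hPm.isPrime
  have hP0 : P ≠ 0 := by
    rintro rfl
    exact hI (le_bot_iff.mp hIP)
  have step : ∀ A : Ideal (𝓞 L), A ∣ I → A ≤ P → A ≠ 0 → extIdeal g A = A → idealClass A ∈ H →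
      idealClass I ∈ H := by
    rintro A ⟨B, rfl⟩ hAP hA hgA hAH
    have hB : B ≠ 0 := right_ne_zero_of_mul hI
    rw [idealClass_mul hA hB]
    refine H.mul_mem hAH (ih _ ?_ hB ?_ rfl)
    · rw [map_mul]
      have hA1 : Ideal.absNorm A ≠ 1 := by
        rw [Ne, Ideal.absNorm_eq_one_iff]
        rintro rfl
        exact hP.ne_top (top_le_iff.mp hAP)
      have hA0 : Ideal.absNorm A ≠ 0 := by rwa [Ne, Ideal.absNorm_eq_zero_iff]
      have hB0 : Ideal.absNorm B ≠ 0 := by rwa [Ne, Ideal.absNorm_eq_zero_iff]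
      have : 2 ≤ Ideal.absNorm A := by lia
      nlinarith [Nat.pos_of_ne_zero hB0]
    · rw [extIdeal_mul, hgA] at hgI
      exact mul_left_cancel₀ hA hgI
  have hbase' : idealClass (extIdeal f (P.comap Φ)) ∈ H := by
    rw [← classMap_idealClass f (h.comap_ne_zero hP0)]
    exact hbase _
  rcases h.prime_cases hP hP0 with ⟨h1, h2⟩ | ⟨h1, h2⟩ | ⟨h1, h2, h3⟩
  · rw [h2] at hbase'
    have hgP := h.ext_isPrime hP
    have hgPm := hgP.isMaximal (extIdeal_ne_zero g hP0)
    refine step (P * extIdeal g P) ?_ Ideal.mul_le_left (mul_ne_zero hP0 (extIdeal_ne_zero g hP0)) ?_ hbase'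
    · refine (Ideal.isCoprime_of_isMaximal (Ne.symm h1)).mul_dvd (Ideal.dvd_iff_le.mpr hIP)
        (Ideal.dvd_iff_le.mpr ?_)
      rw [← hgI]
      exact extIdeal_mono g hIP
    · rw [extIdeal_mul, h.ext_invol, mul_comm]
  · rw [h2] at hbase'
    exact step P (Ideal.dvd_iff_le.mpr hIP) le_rfl hP0 h1 hbase'
  · exact step P (Ideal.dvd_iff_le.mpr hIP) le_rfl hP0 h1 (hram P hP hP0 h1 h3)

/-- If every unit of the base field that is a norm is the norm of a unit, then every invariant
class contains an invariant ideal. -/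
lemma exists_invariant_ideal (h : QuadExt f g)
    (hN : ∀ (u : (𝓞 F)ˣ) (x : L), f (u : 𝓞 F) = x * g x → ∃ v : (𝓞 L)ˣ, Φ u = v * G v)
    {x : ClassGroup (𝓞 L)} (hx : classMap g x = x) :
    ∃ I, I ≠ 0 ∧ extIdeal g I = I ∧ idealClass I = x := by
  obtain ⟨I, hI, rfl⟩ := exists_idealClass x
  rw [classMap_idealClass g hI, idealClass_eq_iff (extIdeal_ne_zero g hI) hI] at hx
  obtain ⟨x, y, hx0, hy0, hxy⟩ := hx
  have hGx0 : G x ≠ 0 := (map_ne_zero_iff _ (mapRingHom_injective g)).mpr hx0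
  have hGy0 : G y ≠ 0 := (map_ne_zero_iff _ (mapRingHom_injective g)).mpr hy0
  have h1 : Ideal.span {x * G x} * I = Ideal.span {y * G y} * I := by
    have h2 := congrArg (extIdeal g) hxy
    rw [extIdeal_mul, extIdeal_mul, h.ext_invol, extIdeal_span, extIdeal_span] at h2
    calc Ideal.span {x * G x} * I = Ideal.span {x} * (Ideal.span {G x} * I) := by
          rw [← Ideal.span_singleton_mul_span_singleton, mul_assoc]
      _ = Ideal.span {G y} * (Ideal.span {x} * extIdeal g I) := by rw [h2]; ring
      _ = _ := by rw [hxy, ← mul_assoc, Ideal.span_singleton_mul_span_singleton, mul_comm y]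
  have h2 := mul_right_cancel₀ hI h1
  rw [Ideal.span_singleton_eq_span_singleton] at h2
  obtain ⟨u, hu⟩ := h2
  have hGu : G u = u := by
    have h3 := congrArg G hu
    rw [map_mul, map_mul, map_mul, h.invol_int, h.invol_int, mul_comm (G x), mul_comm (G y),
      ← hu] at h3
    exact mul_left_cancel₀ (mul_ne_zero hx0 hGx0) h3
  obtain ⟨w, hw⟩ := h.fixed_unit hGu
  have hxL : (x : L) ≠ 0 := by simpa using hx0
  have hyL : (y : L) ≠ 0 := by simpa using hy0
  have hgxL : g (x : L) ≠ 0 := (map_ne_zero g).mpr hxL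
  have hgyL : g (y : L) ≠ 0 := (map_ne_zero g).mpr hyL
  have hwL : f (w : 𝓞 F) = ((y : L) / x) * g (y / x) := by
    have h3 : (x : L) * g x * (f (w : 𝓞 F)) = y * g y := by
      have := congrArg (algebraMap (𝓞 L) L) hu
      rw [← hw] at this
      exact this
    rw [map_div₀]
    field_simp
    linear_combination h3
  obtain ⟨v, hv⟩ := hN w _ hwL
  have hvL : f (w : 𝓞 F) = ((v : 𝓞 L) : L) * g (v : 𝓞 L) := congrArg (algebraMap (𝓞 L) L) hv
  have hvL0 : ((v : 𝓞 L) : L) ≠ 0 := by simp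
  have hgvL0 : g ((v : 𝓞 L) : L) ≠ 0 := (map_ne_zero g).mpr hvL0
  obtain ⟨z, hz0, hz⟩ := h.hilbert90 (x := (y : L) / (x * (v : 𝓞 L))) (by
    rw [hvL, map_div₀] at hwL
    rw [map_div₀, map_mul]
    field_simp at hwL ⊢
    exact hwL.symm)
  obtain ⟨n, hn, hnz⟩ := IsAlgebraic.exists_integral_multiple
    ((IsFractionRing.isAlgebraic_iff ℤ ℚ L).mpr (Algebra.IsAlgebraic.isAlgebraic z))
  let c : 𝓞 L := ⟨_, hnz⟩
  have hc : (c : L) = n * z := by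
    change n • z = n * z
    rw [zsmul_eq_mul]
  have hc0 : c ≠ 0 := by
    intro h0
    have : (c : L) = 0 := by rw [h0]; rfl
    rw [hc] at this
    rcases mul_eq_zero.mp this with h1 | h1
    · exact hn (by exact_mod_cast h1)
    · exact hz0 h1
  have hrel : y * G c = x * v * c := by
    apply RingOfIntegers.ext
    change (y : L) * g c = x * (v : 𝓞 L) * c
    rw [hc, map_mul, map_intCast]
    field_simp at hz
    linear_combination (n : L) * hz
  refine ⟨Ideal.span {c} * I, mul_ne_zero (span_ne_zero hc0) hI, ?_, ?_⟩
  · rw [extIdeal_mul, extIdeal_span]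
    apply mul_left_cancel₀ (span_ne_zero hx0)
    calc Ideal.span {x} * (Ideal.span {G c} * extIdeal g I)
        = Ideal.span {G c} * (Ideal.span {x} * extIdeal g I) := by ring
      _ = Ideal.span {y * G c} * I := by
          rw [hxy, ← mul_assoc, Ideal.span_singleton_mul_span_singleton, mul_comm y]
      _ = Ideal.span {x} * (Ideal.span {c} * I) := by
          rw [hrel, ← Ideal.span_singleton_mul_span_singleton,
            ← Ideal.span_singleton_mul_span_singleton, Ideal.span_singleton_eq_top.mpr v.isUnit,
            Ideal.mul_top, mul_assoc]
  · rw [idealClass_mul (span_ne_zero hc0) hI, idealClass_span hc0, one_mul]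

lemma mem_of_invariant_class (h : QuadExt f g)
    (hN : ∀ (u : (𝓞 F)ˣ) (x : L), f (u : 𝓞 F) = x * g x → ∃ v : (𝓞 L)ˣ, Φ u = v * G v)
    (H : Subgroup (ClassGroup (𝓞 L))) (hbase : ∀ y, classMap f y ∈ H)
    (hram : ∀ P : Ideal (𝓞 L), P.IsPrime → P ≠ 0 → extIdeal g P = P → (∀ x, x - G x ∈ P) →
      idealClass P ∈ H) {x : ClassGroup (𝓞 L)} (hx : classMap g x = x) : x ∈ H := by
  obtain ⟨I, hI, hgI, rfl⟩ := h.exists_invariant_ideal hN hx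
  exact h.idealClass_mem_of_invariant H hbase hram hI hgI

/-- The kernel of the extension map on classes, when units of relative norm one are, up to
coboundaries of units, powers of the coboundary of a single integer `ρ`. -/
lemma class_ker (h : QuadExt f g) {ρ : 𝓞 L} (hρ : ρ ≠ 0)
    (hU : ∀ u : (𝓞 L)ˣ, (u : 𝓞 L) * G u = 1 → ∃ v : (𝓞 L)ˣ,
      u * G v = v ∨ u * G (v * ρ) = v * ρ)
    {x : ClassGroup (𝓞 F)} (hx : classMap f x = 1) :
    x = 1 ∨ ∃ J, J ≠ 0 ∧ extIdeal f J = Ideal.span {ρ} ∧ x = (idealClass J)⁻¹ := by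
  obtain ⟨I, hI, rfl⟩ := exists_idealClass x
  rw [classMap_idealClass f hI, idealClass_eq_one_iff (extIdeal_ne_zero f hI)] at hx
  obtain ⟨α, hα, hIα⟩ := hx
  have hGα : Ideal.span {G α} = Ideal.span {α} := by
    rw [← extIdeal_span, ← hIα, h.ext_base]
  rw [Ideal.span_singleton_eq_span_singleton] at hGα
  obtain ⟨u, hu⟩ := hGα
  have huu : (u : 𝓞 L) * G u = 1 := by
    have h2 := congrArg G hu
    rw [map_mul, h.invol_int] at h2
    have hGα0 : G α ≠ 0 := (map_ne_zero_iff _ (mapRingHom_injective g)).mpr hα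
    apply mul_left_cancel₀ hGα0
    linear_combination h2 + G u * hu
  have huu' : ((u⁻¹ : (𝓞 L)ˣ) : 𝓞 L) = G u := (Units.eq_inv_of_mul_eq_one_right (by rw [mul_comm, huu])).symm
  obtain ⟨v, hv⟩ := hU u⁻¹ (by rw [huu', h.invol_int, mul_comm, huu])
  rw [huu'] at hv
  have main : ∀ r : 𝓞 L, r ≠ 0 → G u * G (v * r) = v * r → ∃ β : 𝓞 F, β ≠ 0 ∧
      Ideal.span {Φ β} = extIdeal f I * Ideal.span {r} := by
    intro r hr hvr
    obtain ⟨β, hβ⟩ := h.fixed_int (x := α * (v * r)) (by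
      rw [map_mul]
      linear_combination G α * u * hvr - G α * G (v * r) * huu + (v * r) * hu)
    refine ⟨β, ?_, ?_⟩
    · rintro rfl
      rw [map_zero] at hβ
      exact mul_ne_zero hα (mul_ne_zero v.ne_zero hr) hβ.symm
    · rw [hβ, ← Ideal.span_singleton_mul_span_singleton, ← Ideal.span_singleton_mul_span_singleton,
        hIα, Ideal.span_singleton_eq_top.mpr v.isUnit, Ideal.top_mul]
  rcases hv with hv | hv
  · left
    obtain ⟨β, hβ0, hβ⟩ := main 1 one_ne_zero (by rwa [mul_one])
    rw [Ideal.span_singleton_one, Ideal.mul_top, ← extIdeal_span] at hβ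
    rw [← extIdeal_injective f hβ, idealClass_span hβ0]
  · right
    obtain ⟨β, hβ0, hβ⟩ := main ρ hρ hv
    have hle : Ideal.span {β} ≤ I := by
      rw [← extIdeal_le_iff f, extIdeal_span, hβ]
      exact Ideal.mul_le_left
    obtain ⟨J, hJ⟩ := Ideal.dvd_iff_le.mpr hle
    have hJ0 : J ≠ 0 := by
      rintro rfl
      rw [mul_zero] at hJ
      exact span_ne_zero hβ0 hJ
    refine ⟨J, hJ0, ?_, ?_⟩
    · rw [← extIdeal_span, hJ, extIdeal_mul] at hβ
      exact mul_left_cancel₀ (extIdeal_ne_zero f hI) hβ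
    · rw [eq_inv_iff_mul_eq_one, ← idealClass_mul hI hJ0, ← hJ, idealClass_span hβ0]

end QuadExt

namespace QuadExt

variable {F L : Type*} [Field F] [Field L] [NumberField F] [NumberField L]
  {f : F →+* L} {g : L →+* L}
local notation "G" => RingOfIntegers.mapRingHom g
local notation "Φ" => RingOfIntegers.mapRingHom f

lemma exists_anti (h : QuadExt f g) : ∃ δ, δ ≠ 0 ∧ g δ = -δ := by
  obtain ⟨z, hz⟩ := h.nontriv
  exact ⟨z - g z, sub_ne_zero.mpr (Ne.symm hz), by rw [map_sub, h.invol, neg_sub]⟩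

lemma exists_eq_add (h : QuadExt f g) {δ : L} (hδ : δ ≠ 0) (hg : g δ = -δ) (x : L) :
    ∃ y z, x = f y + f z * δ := by
  obtain ⟨y, hy⟩ := h.fixed ((x + g x) / 2) (by
    rw [map_div₀, map_add, h.invol, map_ofNat, add_comm])
  obtain ⟨z, hz⟩ := h.fixed ((x - g x) / (2 * δ)) (by
    rw [map_div₀, map_sub, h.invol, map_mul, map_ofNat, hg]
    rw [mul_neg, div_neg, ← neg_div, neg_sub])
  refine ⟨y, z, ?_⟩
  rw [hy, hz]
  field_simp
  ring

lemma add_eq_zero (h : QuadExt f g) {δ : L} (hδ : δ ≠ 0) (hg : g δ = -δ) {y z : F}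
    (hyz : f y + f z * δ = 0) : y = 0 ∧ z = 0 := by
  have h2 := congrArg g hyz
  rw [map_add, map_mul, h.map_base, h.map_base, hg, map_zero] at h2
  constructor
  · have : f y = 0 := by linear_combination (hyz + h2) / 2
    exact (map_eq_zero f).mp this
  · have : f z * δ = 0 := by linear_combination (hyz - h2) / 2
    rcases mul_eq_zero.mp this with h3 | h3
    · exact (map_eq_zero f).mp h3
    · exact absurd h3 hδ

lemma finrank_alg [Algebra F L] (h : QuadExt (algebraMap F L) g) : Module.finrank F L = 2 := by
  obtain ⟨δ, hδ, hg⟩ := h.exists_anti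
  have e : (F × F) ≃ₗ[F] L := LinearEquiv.ofBijective
    ((Algebra.linearMap F L).coprod (LinearMap.toSpanSingleton F L δ)) (by
      constructor
      · rw [← LinearMap.ker_eq_bot, LinearMap.ker_eq_bot']
        rintro ⟨y, z⟩ hyz
        have := h.add_eq_zero hδ hg (y := y) (z := z)
          (by simpa [Algebra.smul_def] using hyz)
        exact Prod.ext this.1 this.2
      · intro x
        obtain ⟨y, z, hx⟩ := h.exists_eq_add hδ hg x
        exact ⟨(y, z), by simp [Algebra.smul_def, hx]⟩)
  rw [← e.finrank_eq, Module.finrank_prod, Module.finrank_self]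

lemma absNorm_extIdeal (h : QuadExt f g) (J : Ideal (𝓞 F)) :
    Ideal.absNorm (extIdeal f J) = Ideal.absNorm J ^ 2 := by
  let : Algebra F L := f.toAlgebra
  have h' : QuadExt (algebraMap F L) g := h
  rw [← h'.finrank_alg, IsFractionRing.finrank_eq (𝓞 F) F (𝓞 L) L]
  exact Ideal.absNorm_algebraMap (𝓞 F) (𝓞 L) J

lemma absNorm_conj (h : QuadExt f g) (I : Ideal (𝓞 L)) :
    Ideal.absNorm (extIdeal g I) = Ideal.absNorm I := by
  let e : 𝓞 L ≃+* 𝓞 L := RingEquiv.ofRingHom G G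
    (RingHom.ext h.invol_int) (RingHom.ext h.invol_int)
  rw [Ideal.absNorm_apply, Ideal.absNorm_apply, Submodule.cardQuot_apply, Submodule.cardQuot_apply]
  exact Nat.card_congr (Ideal.quotientEquiv I (extIdeal g I) e rfl).symm.toEquiv

lemma absNorm_span (h : QuadExt f g) {x : 𝓞 L} {y : 𝓞 F} (hy : Φ y = x * G x) :
    Ideal.absNorm (Ideal.span {x}) = Ideal.absNorm (Ideal.span {y}) := by
  have h1 := h.absNorm_extIdeal (Ideal.span {y})
  rw [extIdeal_span, hy, ← Ideal.span_singleton_mul_span_singleton, map_mul, ← extIdeal_span g,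
    h.absNorm_conj, ← sq] at h1
  exact Nat.pow_left_injective two_ne_zero h1

lemma classMap_conj_eq_inv (h : QuadExt f g) {x : ClassGroup (𝓞 L)}
    (hx : ∀ y, classMap f y = x * classMap g x → classMap f y = 1) :
    classMap g x = x⁻¹ := by
  obtain ⟨y, hy⟩ := h.mul_conj_mem_range x
  rw [eq_inv_iff_mul_eq_one, mul_comm, ← hy, hx y hy]

end QuadExt

section TwoPart

variable {G H : Type*} [CommGroup G] [CommGroup H]

/-- The subgroup of elements of 2-power order. -/
def twoPart (G : Type*) [CommGroup G] : Subgroup G where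
  carrier := {x | ∃ k : ℕ, x ^ 2 ^ k = 1}
  one_mem' := ⟨0, one_pow _⟩
  mul_mem' := by
    rintro x y ⟨k, hk⟩ ⟨l, hl⟩
    refine ⟨k + l, ?_⟩
    rw [mul_pow, pow_add, pow_mul, hk, one_pow, one_mul, mul_comm, pow_mul, hl, one_pow]
  inv_mem' := by
    rintro x ⟨k, hk⟩
    exact ⟨k, by rw [inv_pow, hk, inv_one]⟩

lemma mem_twoPart {x : G} : x ∈ twoPart G ↔ ∃ k : ℕ, x ^ 2 ^ k = 1 := Iff.rfl

lemma map_mem_twoPart (f : G →* H) {x : G} (hx : x ∈ twoPart G) : f x ∈ twoPart H := by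
  obtain ⟨k, hk⟩ := hx
  exact ⟨k, by rw [← map_pow, hk, map_one]⟩

lemma eq_one_of_odd_pow {x : G} (hx : x ∈ twoPart G) {r : ℕ} (hr : Odd r) (h : x ^ r = 1) :
    x = 1 := by
  obtain ⟨k, hk⟩ := hx
  have h1 := orderOf_dvd_of_pow_eq_one hk
  have h2 := orderOf_dvd_of_pow_eq_one h
  rw [← orderOf_eq_one_iff]
  exact Nat.eq_one_of_dvd_coprimes (Nat.Coprime.pow_left k hr.coprime_two_left) h1 h2

lemma mem_of_odd_pow_mem {S : Subgroup G} {x : G} (hx : x ∈ twoPart G) {r : ℕ} (hr : Odd r)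
    (h : x ^ r ∈ S) : x ∈ S := by
  obtain ⟨k, hk⟩ := hx
  have hc : IsCoprime (2 ^ k : ℤ) (r : ℤ) := by
    rw [← Nat.cast_ofNat, ← Nat.cast_pow, Nat.isCoprime_iff_coprime]
    exact Nat.Coprime.pow_left k hr.coprime_two_left
  obtain ⟨u, v, huv⟩ := hc
  have : x = (x ^ r) ^ v := by
    conv_lhs => rw [← zpow_one x, ← huv, zpow_add, mul_comm u, zpow_mul, mul_comm v, zpow_mul]
    rw [show (2 : ℤ) ^ k = ((2 ^ k : ℕ) : ℤ) by push_cast; rfl, zpow_natCast, hk, one_zpow, one_mul,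
      zpow_natCast]
  rw [this]
  exact S.zpow_mem h v

lemma exists_odd_pow_mem_twoPart (G : Type*) [CommGroup G] [Finite G] :
    ∃ r : ℕ, Odd r ∧ ∀ x : G, x ^ r ∈ twoPart G := by
  obtain ⟨k, r, hr, h⟩ := Nat.exists_eq_two_pow_mul_odd (Nat.card_pos (α := G)).ne'
  refine ⟨r, hr, fun x => ⟨k, ?_⟩⟩
  rw [← pow_mul, mul_comm, ← h, pow_card_eq_one']

lemma exists_sq_eq_one_of_ne {S : Subgroup G} (hS : S ≤ twoPart G) {x : G} (hx : x ∈ S)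
    (hx1 : x ≠ 1) : ∃ y ∈ S, y ^ 2 = 1 ∧ y ≠ 1 := by
  obtain ⟨k, hk⟩ := hS hx
  induction k with
  | zero => exact absurd (by simpa using hk) hx1
  | succ k ih =>
    by_cases h : x ^ 2 ^ k = 1
    · exact ih h
    · exact ⟨x ^ 2 ^ k, S.pow_mem hx _, by rw [← pow_mul, ← pow_succ, hk], h⟩

/-- A finite abelian 2-group with at most two elements of order dividing 2 is generated by any
nonsquare. -/
lemma mem_zpowers_of_nonsquare [Finite G] {S : Subgroup G} (hS : S ≤ twoPart G) {w : G}
    (h2 : ∀ x ∈ S, x ^ 2 = 1 → x = 1 ∨ x = w) {u : G} (hu : u ∈ S)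
    (hns : ∀ y ∈ S, y ^ 2 ≠ u) {x : G} (hx : x ∈ S) : x ∈ Subgroup.zpowers u := by
  let sq : S →* S := powMonoidHom 2
  have hker : Nat.card sq.ker ≤ 2 := by
    classical
    have hinj : Function.Injective (fun z : sq.ker => decide (((z : S) : G) = 1) ) := by
      intro z z' hzz
      have hz := h2 _ z.1.2 (by simpa [sq] using congrArg Subtype.val (MonoidHom.mem_ker.mp z.2))
      have hz' := h2 _ z'.1.2 (by simpa [sq] using congrArg Subtype.val (MonoidHom.mem_ker.mp z'.2))
      apply Subtype.ext
      apply Subtype.ext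
      simp only [decide_eq_decide] at hzz
      rcases hz with h | h <;> rcases hz' with h' | h'
      · rw [h, h']
      · rw [h, hzz.mp h]
      · rw [h', hzz.mpr h']
      · rw [h, h']
    have := Nat.card_le_card_of_injective _ hinj
    simpa using this
  have hidx : sq.range.index ≤ 2 := by
    have h1 := Subgroup.card_mul_index sq.range
    have h2 := Subgroup.card_mul_index sq.ker
    rw [Subgroup.index_ker] at h2
    have h3 : 0 < Nat.card sq.range := Nat.card_pos
    have h4 : sq.range.index = Nat.card sq.ker := by
      apply Nat.eq_of_mul_eq_mul_left h3
      rw [h1, ← h2, mul_comm]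
    rw [h4]
    exact hker
  have hidx2 : sq.range.index = 2 := by
    have h0 : sq.range.index ≠ 0 := Subgroup.index_ne_zero_of_finite
    have h1 : sq.range.index ≠ 1 := by
      rw [Ne, Subgroup.index_eq_one]
      intro ht
      obtain ⟨y, hy⟩ : (⟨u, hu⟩ : S) ∈ sq.range := by rw [ht]; trivial
      exact hns y y.2 (by simpa [sq] using congrArg Subtype.val hy)
    lia
  have hstep : ∀ z ∈ S, ∃ e : ℤ, ∃ y ∈ S, z = u ^ e * y ^ 2 := by
    intro z hz
    by_cases hzr : (⟨z, hz⟩ : S) ∈ sq.range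
    · obtain ⟨y, hy⟩ := hzr
      exact ⟨0, y, y.2, by simpa [sq] using (congrArg Subtype.val hy).symm⟩
    · have hur : (⟨u, hu⟩ : S) ∉ sq.range := by
        rintro ⟨y, hy⟩
        exact hns y y.2 (by simpa [sq] using congrArg Subtype.val hy)
      obtain ⟨y, hy⟩ := (Subgroup.mul_mem_iff_of_index_two hidx2 (a := ⟨u, hu⟩⁻¹)
        (b := ⟨z, hz⟩)).mpr (by rw [inv_mem_iff]; tauto)
      refine ⟨1, y, y.2, ?_⟩
      have := congrArg Subtype.val hy
      simp only [sq, powMonoidHom_apply, Subgroup.coe_pow, Subgroup.coe_mul, Subgroup.coe_inv] at this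
      rw [this]
      simp
  have hiter : ∀ k : ℕ, ∀ z ∈ S, ∃ e : ℤ, ∃ y ∈ S, z = u ^ e * y ^ 2 ^ k := by
    intro k
    induction k with
    | zero => exact fun z hz => ⟨0, z, hz, by simp⟩
    | succ k ih =>
      intro z hz
      obtain ⟨e, y, hy, rfl⟩ := ih z hz
      obtain ⟨e', y', hy', rfl⟩ := hstep y hy
      refine ⟨e + e' * 2 ^ k, y', hy', ?_⟩
      rw [mul_pow, ← pow_mul y', ← pow_succ', zpow_add, zpow_mul, mul_assoc]
      congr 2
      exact_mod_cast (zpow_natCast (u ^ e') (2 ^ k)).symm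
  obtain ⟨r, hr, -⟩ := exists_odd_pow_mem_twoPart G
  obtain ⟨k, s, hs, hcard⟩ := Nat.exists_eq_two_pow_mul_odd (Nat.card_pos (α := G)).ne'
  obtain ⟨e, y, hy, rfl⟩ := hiter k x hx
  have : y ^ 2 ^ k = 1 := by
    refine eq_one_of_odd_pow (hS (S.pow_mem hy _)) hs ?_
    rw [← pow_mul, ← hcard, pow_card_eq_one']
  rw [this, mul_one]
  exact ⟨e, rfl⟩

lemma sylow_two_eq_twoPart (P : Sylow 2 G) : (P : Subgroup G) = twoPart G := by
  refine (P.is_maximal' (Q := twoPart G) ?_ ?_).symm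
  · rintro ⟨x, k, hk⟩
    exact ⟨k, Subtype.ext (by simpa using hk)⟩
  · intro x hx
    obtain ⟨k, hk⟩ := P.isPGroup' ⟨x, hx⟩
    exact ⟨k, by simpa using congrArg Subtype.val hk⟩

lemma card_twoPart_eq [Finite G] {N : ℕ} (h : ∀ P : Sylow 2 G, Nat.card P = N) :
    Nat.card (twoPart G) = N := by
  obtain ⟨P⟩ : Nonempty (Sylow 2 G) := inferInstance
  rw [← h P, ← sylow_two_eq_twoPart P]

/-- The structure of an abelian group generated by two cyclic 2-groups sharing their element of
order two. -/
lemma nonempty_addEquiv_of_generators [Finite G] {S : Subgroup G} {s t : ℕ} (hs : 1 ≤ s)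
    (hst : s ≤ t) {x y : G} (hx : x ∈ S) (hy : y ∈ S)
    (hxy : x ^ 2 ^ (s - 1) = y ^ 2 ^ (t - 1)) (hy1 : y ^ 2 ^ t = 1)
    (hgen : ∀ z ∈ S, ∃ i j : ℤ, z = x ^ i * y ^ j) (hcard : Nat.card S = 2 ^ (s - 1) * 2 ^ t) :
    Nonempty (Additive S ≃+ ZMod (2 ^ (s - 1)) × ZMod (2 ^ t)) := by
  let X : S := ⟨x, hx⟩ * (⟨y, hy⟩ ^ 2 ^ (t - s))⁻¹
  let Y : S := ⟨y, hy⟩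
  have hX : X ^ 2 ^ (s - 1) = 1 := by
    apply Subtype.ext
    simp only [X, mul_pow, inv_pow, ← pow_mul, ← pow_add, Subgroup.coe_mul, Subgroup.coe_pow,
      Subgroup.coe_inv, hxy, Subgroup.coe_one]
    rw [show t - s + (s - 1) = t - 1 by lia, mul_inv_cancel]
  have hY : Y ^ 2 ^ t = 1 := Subtype.ext (by simpa [Y] using hy1)
  let f : ZMod (2 ^ (s - 1)) →+ Additive S := ZMod.lift _
    ⟨(zmultiplesHom (Additive S)) (Additive.ofMul X), by
      simp only [zmultiplesHom_apply, natCast_zsmul, ← ofMul_pow, hX, ofMul_one]⟩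
  let g : ZMod (2 ^ t) →+ Additive S := ZMod.lift _
    ⟨(zmultiplesHom (Additive S)) (Additive.ofMul Y), by
      simp only [zmultiplesHom_apply, natCast_zsmul, ← ofMul_pow, hY, ofMul_one]⟩
  have hf : ∀ k : ℤ, f k = Additive.ofMul (X ^ k) := fun k => by
    simp [f, ZMod.lift_coe]
  have hg : ∀ k : ℤ, g k = Additive.ofMul (Y ^ k) := fun k => by
    simp [g, ZMod.lift_coe]
  have hsurj : Function.Surjective (f.coprod g) := by
    intro z
    obtain ⟨i, j, hz⟩ := hgen _ z.toMul.2
    refine ⟨((i : ℤ), ((j + 2 ^ (t - s) * i : ℤ) : ZMod _)), ?_⟩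
    rw [AddMonoidHom.coprod_apply, hf, hg, ← ofMul_mul]
    apply Additive.toMul.injective
    apply Subtype.ext
    rw [hz]
    simp only [X, Y, toMul_ofMul, Subgroup.coe_mul, Subgroup.coe_zpow, Subgroup.coe_inv,
      Subgroup.coe_pow]
    rw [mul_zpow, mul_assoc, zpow_add, inv_zpow', ← zpow_natCast, ← zpow_mul]
    rw [mul_comm (y ^ j), ← mul_assoc (y ^ _), ← zpow_add]
    simp
  have : NeZero (2 ^ (s - 1)) := ⟨by positivity⟩
  have : NeZero (2 ^ t) := ⟨by positivity⟩
  have hc : Nat.card (ZMod (2 ^ (s - 1)) × ZMod (2 ^ t)) = Nat.card (Additive S) := by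
    rw [Nat.card_prod, Nat.card_zmod, Nat.card_zmod]
    exact hcard.symm
  exact ⟨(AddEquiv.ofBijective (f.coprod g) ((Nat.bijective_iff_surjective_and_card _).mpr
    ⟨hsurj, hc⟩)).symm⟩

/-- An involution of a cyclic 2-group which is not trivial but fixes an element of order four has
exactly half of the group as fixed points. -/
lemma card_eq_two_mul_card_fixed [Finite G] {V : Subgroup G} (hV : V ≤ twoPart G) {w : G}
    (h2 : ∀ x ∈ V, x ^ 2 = 1 → x = 1 ∨ x = w) {c : G →* G} (hcc : ∀ x, c (c x) = x)
    (hcV : ∀ x ∈ V, c x ∈ V) (hfix : ∃ x ∈ V, c x = x ∧ x ^ 2 ≠ 1) (hmov : ∃ x ∈ V, c x ≠ x)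
    {W : Subgroup G} (hW : ∀ x, x ∈ W ↔ x ∈ V ∧ c x = x) :
    Nat.card V = 2 * Nat.card W ∧ ∃ v ∈ V, ∀ x ∈ V, x ∈ Subgroup.zpowers v := by
  obtain ⟨z, hz, hcz, hz2⟩ := hfix
  have hnon : ∃ v ∈ V, ∀ y ∈ V, y ^ 2 ≠ v := by
    by_contra! hcon
    have hs : Function.Surjective (powMonoidHom 2 : V →* V) := fun v => by
      obtain ⟨y, hy, h⟩ := hcon v v.2
      exact ⟨⟨y, hy⟩, Subtype.ext h⟩
    have hi := Finite.injective_iff_surjective.mpr hs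
    obtain ⟨y, hy, hy2, hy1⟩ := exists_sq_eq_one_of_ne hV hz (by rintro rfl; simp at hz2)
    exact hy1 (congrArg Subtype.val (hi (a₁ := ⟨y, hy⟩) (a₂ := 1)
      (Subtype.ext (by simpa using hy2))))
  obtain ⟨v, hv, hns⟩ := hnon
  have hgen : ∀ x ∈ V, x ∈ Subgroup.zpowers v := fun x hx => mem_zpowers_of_nonsquare hV h2 hv hns hx
  refine ⟨?_, v, hv, hgen⟩
  obtain ⟨a, ha⟩ := hgen _ (hcV v hv)
  obtain ⟨k, hk⟩ := hgen _ hz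
  obtain ⟨N, hN⟩ := hV hv
  obtain ⟨e, -, he⟩ := (Nat.dvd_prime_pow Nat.prime_two).mp (orderOf_dvd_of_pow_eq_one hN)
  simp only at ha hk
  have hord : ∀ j : ℤ, v ^ j = 1 ↔ (2 : ℤ) ^ e ∣ j := fun j => by
    rw [← orderOf_dvd_iff_zpow_eq_one, he]
    push_cast
    rfl
  have h1 : (2 : ℤ) ^ e ∣ (a - 1) * (a + 1) := by
    rw [← hord, show (a - 1) * (a + 1) = a * a - 1 by ring, zpow_sub, zpow_mul, ha, ← map_zpow,
      ha, hcc, zpow_one, mul_inv_cancel]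
  have h3 : (2 : ℤ) ^ e ∣ k * (a - 1) := by
    rw [← hord, show k * (a - 1) = a * k - k by ring, zpow_sub, zpow_mul, ha, ← map_zpow, hk, hcz,
      mul_inv_cancel]
  have h4 : ¬ (2 : ℤ) ^ e ∣ 2 * k := by
    rw [← hord, mul_comm, zpow_mul, hk]
    exact_mod_cast hz2
  have hcop : ∀ r : ℤ, Odd r → IsCoprime ((2 : ℤ) ^ e) r := fun r hr =>
    IsCoprime.pow_left (Int.isCoprime_iff_gcd_eq_one.mpr (by
      obtain ⟨l, rfl⟩ := hr
      simp))
  have h5 : (2 : ℤ) ^ e ∣ 2 * (a - 1) := by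
    rcases Int.even_or_odd' (a - 1) with ⟨b, hb | hb⟩
    · rcases Int.even_or_odd' b with ⟨l, hl | hl⟩
      · refine (hcop (2 * l + 1) ⟨l, rfl⟩).dvd_of_dvd_mul_right ?_
        have : 2 * (a - 1) * (2 * l + 1) = (a - 1) * (a + 1) := by
          rw [show a = 2 * (2 * l) + 1 by lia]
          ring
        rwa [this]
      · refine absurd ?_ h4
        refine (hcop b ⟨l, hl⟩).dvd_of_dvd_mul_right ?_
        have : 2 * k * b = k * (a - 1) := by
          rw [hb]; ring
        rwa [this]
    · refine absurd (Dvd.dvd.mul_left ?_ 2) h4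
      exact (hcop (a - 1) ⟨b, hb⟩).dvd_of_dvd_mul_right h3
  let ψ : V →* V :=
    { toFun := fun x => ⟨c x * (x : G)⁻¹, V.mul_mem (hcV x x.2) (V.inv_mem x.2)⟩
      map_one' := Subtype.ext (by simp)
      map_mul' := fun x y => Subtype.ext (by simp [mul_mul_mul_comm, mul_comm]) }
  have hψv : (ψ ⟨v, hv⟩) ^ 2 = 1 := by
    apply Subtype.ext
    change (c v * v⁻¹) ^ 2 = 1
    rw [← ha, ← zpow_sub_one, ← zpow_natCast, ← zpow_mul, hord]
    push_cast
    rwa [mul_comm]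
  have hψ1 : ψ ⟨v, hv⟩ ≠ 1 := by
    intro h
    have h' : c v = v := by
      have := congrArg Subtype.val h
      exact mul_inv_eq_one.mp this
    obtain ⟨x, hx, hcx⟩ := hmov
    obtain ⟨j, rfl⟩ := hgen x hx
    simp [h'] at hcx
  have hrange : ψ.range = Subgroup.zpowers (ψ ⟨v, hv⟩) := by
    ext y
    constructor
    · rintro ⟨x, rfl⟩
      obtain ⟨j, hj⟩ := hgen x x.2
      refine ⟨j, ?_⟩
      simp only at hj ⊢
      rw [← map_zpow]
      congr 1
      exact Subtype.ext (by simpa using hj)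
    · rintro ⟨j, rfl⟩
      exact ⟨⟨v, hv⟩ ^ j, by rw [map_zpow]⟩
  have hcr : Nat.card ψ.range = 2 := by
    rw [hrange, Nat.card_zpowers]
    exact orderOf_eq_prime hψv hψ1
  have hck : Nat.card ψ.ker = Nat.card W := by
    refine Nat.card_congr ⟨fun x => ⟨x.1, (hW _).mpr ⟨x.1.2, ?_⟩⟩,
      fun x => ⟨⟨x, ((hW _).mp x.2).1⟩, ?_⟩, fun x => rfl, fun x => rfl⟩
    · have := congrArg Subtype.val (MonoidHom.mem_ker.mp x.2)
      exact mul_inv_eq_one.mp this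
    · exact Subtype.ext (mul_inv_eq_one.mpr ((hW _).mp x.2).2)
  have := Subgroup.card_mul_index ψ.ker
  rw [Subgroup.index_ker, hcr, hck] at this
  lia

end TwoPart

section Embedded

variable {K : Type*} [Field K] {F L : Type*} [Field F] [Field L]

/-- The embedding of the integers of `L` into an overfield `K` of `L`. -/
noncomputable def intHom (ι : L →+* K) : 𝓞 L →+* K := ι.comp (algebraMap (𝓞 L) L)

lemma intHom_apply (ι : L →+* K) (x : 𝓞 L) : intHom ι x = ι (x : L) := rfl

lemma intHom_injective (ι : L →+* K) : Function.Injective (intHom ι) :=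
  ι.injective.comp RingOfIntegers.coe_injective

lemma isIntegral_map (g : L →+* K) {x : L} (hx : IsIntegral ℤ x) : IsIntegral ℤ (g x) :=
  hx.map g.toIntAlgHom

lemma isIntegral_of_map (g : L →+* K) {x : L} (hx : IsIntegral ℤ (g x)) : IsIntegral ℤ x :=
  (isIntegral_algHom_iff g.toIntAlgHom g.injective).mp hx

lemma isIntegral_intHom (ι : L →+* K) (x : 𝓞 L) : IsIntegral ℤ (intHom ι x) :=
  isIntegral_map ι x.isIntegral_coe

lemma intHom_mem_range (ι : L →+* K) (x : 𝓞 L) : intHom ι x ∈ ι.range := ⟨x, rfl⟩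

lemma exists_intHom_eq (ι : L →+* K) {x : K} (hx : x ∈ ι.range) (hi : IsIntegral ℤ x) :
    ∃ y : 𝓞 L, intHom ι y = x := by
  obtain ⟨y, rfl⟩ := hx
  exact ⟨⟨y, isIntegral_of_map ι hi⟩, rfl⟩

/-- `x` is a unit of the ring of integers of `K`. -/
def IsIntUnit (x : K) : Prop := x ≠ 0 ∧ IsIntegral ℤ x ∧ IsIntegral ℤ x⁻¹

namespace IsIntUnit

lemma one : IsIntUnit (1 : K) := ⟨one_ne_zero, isIntegral_one, by simpa using isIntegral_one⟩

lemma mul {x y : K} (hx : IsIntUnit x) (hy : IsIntUnit y) : IsIntUnit (x * y) :=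
  ⟨mul_ne_zero hx.1 hy.1, hx.2.1.mul hy.2.1, by rw [mul_inv]; exact hx.2.2.mul hy.2.2⟩

lemma inv {x : K} (hx : IsIntUnit x) : IsIntUnit x⁻¹ :=
  ⟨inv_ne_zero hx.1, hx.2.2, by rw [inv_inv]; exact hx.2.1⟩

lemma pow {x : K} (hx : IsIntUnit x) (n : ℕ) : IsIntUnit (x ^ n) :=
  ⟨pow_ne_zero _ hx.1, hx.2.1.pow n, by rw [← inv_pow]; exact hx.2.2.pow n⟩

lemma zpow {x : K} (hx : IsIntUnit x) (n : ℤ) : IsIntUnit (x ^ n) := by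
  cases n with
  | ofNat n => simpa using hx.pow n
  | negSucc n => simpa using (hx.pow (n + 1)).inv

lemma div {x y : K} (hx : IsIntUnit x) (hy : IsIntUnit y) : IsIntUnit (x / y) := by
  rw [div_eq_mul_inv]
  exact hx.mul hy.inv

lemma map (g : L →+* K) {x : L} (hx : IsIntUnit x) : IsIntUnit (g x) :=
  ⟨(map_ne_zero g).mpr hx.1, isIntegral_map g hx.2.1, by
    rw [← map_inv₀]; exact isIntegral_map g hx.2.2⟩

lemma of_mul_eq_one {x y : K} (hx : IsIntegral ℤ x) (hy : IsIntegral ℤ y) (h : x * y = 1) :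
    IsIntUnit x :=
  ⟨left_ne_zero_of_mul_eq_one h, hx, by rwa [inv_eq_of_mul_eq_one_right h]⟩

lemma of_pow {x : K} {n : ℕ} (hn : 0 < n) (hx : IsIntUnit (x ^ n)) : IsIntUnit x :=
  ⟨fun h => hx.1 (by rw [h, zero_pow hn.ne']), hx.2.1.of_pow hn,
    IsIntegral.of_pow hn (by rw [inv_pow]; exact hx.2.2)⟩

lemma of_unit (ι : L →+* K) (u : (𝓞 L)ˣ) : IsIntUnit (intHom ι u) :=
  of_mul_eq_one (isIntegral_intHom ι _) (isIntegral_intHom ι ((u⁻¹ : (𝓞 L)ˣ) : 𝓞 L))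
    (by rw [← map_mul, u.mul_inv, map_one])

lemma exists_unit (ι : L →+* K) {x : K} (hx : IsIntUnit x) (hr : x ∈ ι.range) :
    ∃ u : (𝓞 L)ˣ, intHom ι u = x := by
  obtain ⟨y, hy⟩ := exists_intHom_eq ι hr hx.2.1
  obtain ⟨z, hz⟩ := exists_intHom_eq ι (x := x⁻¹) (by
    obtain ⟨w, rfl⟩ := hr
    exact ⟨w⁻¹, map_inv₀ _ _⟩) hx.2.2
  have h : y * z = 1 := intHom_injective ι (by rw [map_mul, hy, hz, map_one, mul_inv_cancel₀ hx.1])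
  exact ⟨⟨y, z, h, by rw [mul_comm, h]⟩, hy⟩

end IsIntUnit

/-- A quadratic extension `L / F` inside `K` whose conjugation is induced by `γ`. -/
structure QuadRel (ιF : F →+* K) (ιL : L →+* K) (γ : K →+* K) (f : F →+* L) (g : L →+* L) :
    Prop where
  quad : QuadExt f g
  base : ∀ x, ιL (f x) = ιF x
  conj : ∀ x, ιL (g x) = γ (ιL x)

lemma exists_comp_eq (ιF : F →+* K) (ιL : L →+* K) (h : ∀ x ∈ ιF.range, x ∈ ιL.range) :
    ∃ f : F →+* L, ∀ x, ιL (f x) = ιF x := by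
  choose f hf using fun x => h (ιF x) ⟨x, rfl⟩
  refine ⟨⟨⟨⟨f, ?_⟩, ?_⟩, ?_, ?_⟩, hf⟩
  · exact ιL.injective (by simp [hf])
  · exact fun x y => ιL.injective (by simp [hf])
  · exact ιL.injective (by simp [hf])
  · exact fun x y => ιL.injective (by simp [hf])

lemma exists_quadRel (ιF : F →+* K) (ιL : L →+* K) (γ : K →+* K)
    (hF : ∀ x, x ∈ ιF.range ↔ x ∈ ιL.range ∧ γ x = x) (hγ : ∀ x, γ (γ x) = x)
    (hL : ∀ x ∈ ιL.range, γ x ∈ ιL.range) (hne : ∃ x ∈ ιL.range, γ x ≠ x) :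
    ∃ f g, QuadRel ιF ιL γ f g := by
  obtain ⟨f, hf⟩ := exists_comp_eq ιF ιL fun x hx => ((hF x).mp hx).1
  obtain ⟨g, hg⟩ := exists_comp_eq (γ.comp ιL) ιL (by
    rintro _ ⟨y, rfl⟩
    exact hL _ ⟨y, rfl⟩)
  simp only [RingHom.comp_apply] at hg
  refine ⟨f, g, ⟨fun x => ιL.injective (by rw [hg, hg, hγ]), fun x hx => ?_,
    fun y => ιL.injective (by rw [hg, hf, ((hF _).mp ⟨y, rfl⟩).2]), ?_⟩, hf, hg⟩
  · obtain ⟨y, hy⟩ := (hF (ιL x)).mpr ⟨⟨x, rfl⟩, by rw [← hg, hx]⟩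
    exact ⟨y, ιL.injective (by rw [hf, hy])⟩
  · obtain ⟨_, ⟨x, rfl⟩, hx⟩ := hne
    exact ⟨x, fun h => hx (by rw [← hg, h])⟩

namespace QuadRel

variable {ιF : F →+* K} {ιL : L →+* K} {γ : K →+* K} {f : F →+* L} {g : L →+* L}

lemma int_base (h : QuadRel ιF ιL γ f g) (x : 𝓞 F) :
    intHom ιL (RingOfIntegers.mapRingHom f x) = intHom ιF x := h.base x

lemma int_conj (h : QuadRel ιF ιL γ f g) (x : 𝓞 L) :
    intHom ιL (RingOfIntegers.mapRingHom g x) = γ (intHom ιL x) := h.conj x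

/-- Every unit of `F` that is a norm from `L` is the norm of a unit. -/
lemma unit_norm (h : QuadRel ιF ιL γ f g)
    (hN : ∀ u ∈ ιF.range, IsIntUnit u → ∀ x ∈ ιL.range, u = x * γ x →
      ∃ v ∈ ιL.range, IsIntUnit v ∧ u = v * γ v) (u : (𝓞 F)ˣ) (x : L)
    (hx : f ((u : 𝓞 F) : F) = x * g x) :
    ∃ v : (𝓞 L)ˣ, RingOfIntegers.mapRingHom f u = v * RingOfIntegers.mapRingHom g v := by
  obtain ⟨v, hv, hv1, hv2⟩ := hN _ (intHom_mem_range ιF u) (.of_unit ιF u) (ιL x) ⟨x, rfl⟩ (by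
    rw [intHom_apply, ← h.base, hx, map_mul, h.conj])
  obtain ⟨w, rfl⟩ := hv1.exists_unit ιL hv
  exact ⟨w, intHom_injective ιL (by rw [h.int_base, map_mul, h.int_conj, hv2])⟩

lemma unit_hilbert90 (h : QuadRel ιF ιL γ f g) {ρ : 𝓞 L}
    (hU : ∀ u ∈ ιL.range, IsIntUnit u → u * γ u = 1 → ∃ v ∈ ιL.range, IsIntUnit v ∧
      (u * γ v = v ∨ u * γ (v * intHom ιL ρ) = v * intHom ιL ρ)) (u : (𝓞 L)ˣ)
    (hu : (u : 𝓞 L) * RingOfIntegers.mapRingHom g u = 1) :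
    ∃ v : (𝓞 L)ˣ, (u : 𝓞 L) * RingOfIntegers.mapRingHom g v = v ∨
      (u : 𝓞 L) * RingOfIntegers.mapRingHom g (v * ρ) = v * ρ := by
  obtain ⟨v, hv, hv1, hv2⟩ := hU _ (intHom_mem_range ιL u) (.of_unit ιL u) (by
    rw [← h.int_conj, ← map_mul, hu, map_one])
  obtain ⟨w, rfl⟩ := hv1.exists_unit ιL hv
  refine ⟨w, hv2.imp (fun h1 => intHom_injective ιL ?_) fun h1 => intHom_injective ιL ?_⟩
  · rw [map_mul, h.int_conj, h1]
  · rw [map_mul, h.int_conj, map_mul, h1]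

end QuadRel

end Embedded

section Descent

lemma dvd_of_dvd_sq_sub_two_mul_sq {p : ℕ} (hp : p.Prime) (h5 : p % 8 = 5) {x z e : ℤ}
    (he : e = 2 ∨ e = -2) (h : (p : ℤ) ∣ x ^ 2 - e * z ^ 2) : (p : ℤ) ∣ z := by
  have := Fact.mk hp
  have hp2 : p ≠ 2 := by rintro rfl; simp at h5
  by_contra hz
  have hz0 : (z : ZMod p) ≠ 0 := by rwa [Ne, ZMod.intCast_zmod_eq_zero_iff_dvd]
  have h0 : (x : ZMod p) ^ 2 - (e : ZMod p) * (z : ZMod p) ^ 2 = 0 := by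
    rw [← ZMod.intCast_zmod_eq_zero_iff_dvd] at h
    exact_mod_cast h
  have hsq : IsSquare ((e : ℤ) : ZMod p) := by
    refine ⟨x / z, ?_⟩
    field_simp
    linear_combination -h0
  rcases he with rfl | rfl
  · have := (ZMod.exists_sq_eq_two_iff hp2).mp (by simpa using hsq)
    lia
  · have := (ZMod.exists_sq_eq_neg_two_iff hp2).mp (by simpa using hsq)
    lia

/-- `x² - Dy²` is never `± 2z²` when a prime `p ≡ 5 mod 8` divides `D` exactly once. -/
lemma eq_zero_of_sq_sub_mul_sq {p : ℕ} (hp : p.Prime) (h5 : p % 8 = 5) {D e : ℤ}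
    (he : e = 2 ∨ e = -2) (hD : (p : ℤ) ∣ D) (hD2 : ¬ (p : ℤ) ^ 2 ∣ D) :
    ∀ (n : ℕ) (x y z : ℤ), z.natAbs ≤ n → x ^ 2 - D * y ^ 2 = e * z ^ 2 → z = 0 := by
  have hpZ : Prime (p : ℤ) := Nat.prime_iff_prime_int.mp hp
  intro n
  induction n with
  | zero => exact fun x y z hz _ => by lia
  | succ n ih =>
    intro x y z hz h
    obtain ⟨D', rfl⟩ := hD
    have hpz : (p : ℤ) ∣ z := dvd_of_dvd_sq_sub_two_mul_sq hp h5 he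
      (x := x) ⟨D' * y ^ 2, by linear_combination h⟩
    obtain ⟨z', rfl⟩ := hpz
    have hpx : (p : ℤ) ∣ x := hpZ.dvd_of_dvd_pow (n := 2)
      ⟨D' * y ^ 2 + e * p * z' ^ 2, by linear_combination h⟩
    obtain ⟨x', rfl⟩ := hpx
    have hpy : (p : ℤ) ∣ y := by
      have h1 : (p : ℤ) ∣ D' * y ^ 2 := by
        refine ⟨x' ^ 2 - e * z' ^ 2, ?_⟩
        apply mul_left_cancel₀ hpZ.ne_zero
        linear_combination -h
      rcases hpZ.dvd_or_dvd h1 with h2 | h2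
      · exact absurd (by rw [sq]; exact mul_dvd_mul_left _ h2) hD2
      · exact hpZ.dvd_of_dvd_pow h2
    obtain ⟨y', rfl⟩ := hpy
    by_cases hz0 : z' = 0
    · simp [hz0]
    have h' : x' ^ 2 - p * D' * y' ^ 2 = e * z' ^ 2 := by
      apply mul_left_cancel₀ (pow_ne_zero 2 hpZ.ne_zero)
      linear_combination h
    rw [ih x' y' z' ?_ h', mul_zero]
    rw [Int.natAbs_mul, Int.natAbs_natCast] at hz
    have h2 := hp.two_le
    have h3 : 0 < z'.natAbs := Int.natAbs_pos.mpr hz0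
    nlinarith

lemma exists_common_denom (x y z : ℚ) : ∃ (N a b c : ℤ), N ≠ 0 ∧ x = a / N ∧ y = b / N ∧
    z = c / N := by
  refine ⟨x.den * y.den * z.den, x.num * y.den * z.den, y.num * x.den * z.den,
    z.num * x.den * y.den, by simp, ?_, ?_, ?_⟩
  · conv_lhs => rw [← Rat.num_div_den x]
    push_cast
    field_simp
  · conv_lhs => rw [← Rat.num_div_den y]
    push_cast
    field_simp
  · conv_lhs => rw [← Rat.num_div_den z]
    push_cast
    field_simp

lemma rat_eq_zero_of_sq_sub_mul_sq {p : ℕ} (hp : p.Prime) (h5 : p % 8 = 5) {D e : ℤ}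
    (he : e = 2 ∨ e = -2) (hD : (p : ℤ) ∣ D) (hD2 : ¬ (p : ℤ) ^ 2 ∣ D) {x y z : ℚ}
    (h : x ^ 2 - D * y ^ 2 = e * z ^ 2) : z = 0 := by
  obtain ⟨N, a, b, c, hN, rfl, rfl, rfl⟩ := exists_common_denom x y z
  have hN' : (N : ℚ) ≠ 0 := by exact_mod_cast hN
  have h' : a ^ 2 - D * b ^ 2 = e * c ^ 2 := by
    field_simp at h
    exact_mod_cast h
  rw [eq_zero_of_sq_sub_mul_sq hp h5 he hD hD2 _ a b c le_rfl h']
  simp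

/-- `m` is a nonzero integer whose odd part is 1 or 3 modulo 8. -/
lemma exists_odd_part_of_sq_add {d : ℤ} (hd : d % 8 = 1) :
    ∀ (n : ℕ) (x y : ℤ), x.natAbs + y.natAbs ≤ n → (x ≠ 0 ∨ y ≠ 0) →
      ∃ (k : ℕ) (r : ℤ), x ^ 2 + 2 * d * y ^ 2 = 2 ^ k * r ∧ (r % 8 = 1 ∨ r % 8 = 3) := by
  have hodd : ∀ l : ℤ, (2 * l + 1) ^ 2 % 8 = 1 := by
    intro l
    rcases Int.even_or_odd' l with ⟨j, rfl | rfl⟩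
    · rw [show (2 * (2 * j) + 1) ^ 2 = 1 + 8 * (2 * j ^ 2 + j) by ring]; lia
    · rw [show (2 * (2 * j + 1) + 1) ^ 2 = 1 + 8 * (2 * j ^ 2 + 3 * j + 1) by ring]; lia
  have hsq : ∀ l : ℤ, (2 * l ^ 2) % 8 = 0 ∨ (2 * l ^ 2) % 8 = 2 := by
    intro l
    rcases Int.even_or_odd' l with ⟨j, rfl | rfl⟩
    · left; rw [show 2 * (2 * j) ^ 2 = 8 * (j ^ 2) by ring]; lia
    · right; have := hodd j; lia
  obtain ⟨d', rfl⟩ : ∃ d', d = 1 + 8 * d' := ⟨d / 8, by lia⟩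
  intro n
  induction n with
  | zero => intro x y h h0; lia
  | succ n ih =>
    intro x y h h0
    rcases Int.even_or_odd' x with ⟨x', hx | hx⟩
    · rcases Int.even_or_odd' y with ⟨y', hy | hy⟩
      · obtain ⟨k, r, hk, hr⟩ := ih x' y' (by lia) (by lia)
        refine ⟨k + 2, r, ?_, hr⟩
        rw [pow_add]
        subst hx hy
        linear_combination 4 * hk
      · refine ⟨1, (1 + 8 * d') * y ^ 2 + 2 * x' ^ 2, by subst hx; ring, ?_⟩
        have h1 := hodd y'
        have h2 := hsq x'
        rw [← hy] at h1
        rw [show (1 + 8 * d') * y ^ 2 + 2 * x' ^ 2 = y ^ 2 + 2 * x' ^ 2 + 8 * (d' * y ^ 2) by ring]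
        lia
    · refine ⟨0, x ^ 2 + 2 * (1 + 8 * d') * y ^ 2, by ring, ?_⟩
      have h1 := hodd x'
      have h2 := hsq y
      rw [← hx] at h1
      rw [show x ^ 2 + 2 * (1 + 8 * d') * y ^ 2 = x ^ 2 + 2 * y ^ 2 + 8 * (2 * d' * y ^ 2) by ring]
      lia

lemma odd_part_unique {k l : ℕ} {r s : ℤ} (hr : Odd r) (hs : Odd s) (h : 2 ^ k * r = 2 ^ l * s) :
    r = s := by
  wlog hkl : k ≤ l generalizing k l r s
  · exact (this hs hr h.symm (by lia)).symm
  obtain ⟨j, rfl⟩ := Nat.exists_eq_add_of_le hkl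
  have h1 : r = 2 ^ j * s := by
    apply mul_left_cancel₀ (pow_ne_zero k (two_ne_zero' ℤ))
    rw [h]; ring
  rcases j with _ | j
  · simpa using h1
  · rw [h1, pow_succ] at hr
    exact absurd hr (by rw [Int.not_odd_iff_even]; exact ⟨2 ^ j * s, by ring⟩)

lemma rat_false_of_sq_add_mul_sq {d : ℤ} (hd : d % 8 = 1) {q : ℤ} (hq : q % 8 = 7) {e : ℕ}
    {x y z : ℚ} (hz : z ≠ 0) (h : x ^ 2 + 2 * d * y ^ 2 = q * 2 ^ e * z ^ 2) : False := by
  obtain ⟨N, a, b, c, hN, rfl, rfl, rfl⟩ := exists_common_denom x y z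
  have hN' : (N : ℚ) ≠ 0 := by exact_mod_cast hN
  have h' : a ^ 2 + 2 * d * b ^ 2 = q * 2 ^ e * c ^ 2 := by
    field_simp at h
    exact_mod_cast h
  have hc : c ≠ 0 := by rintro rfl; simp at hz
  have hab : a ≠ 0 ∨ b ≠ 0 := by
    by_contra! hcon
    rw [hcon.1, hcon.2] at h'
    have : q ≠ 0 := by rintro rfl; simp at hq
    have : q * 2 ^ e * c ^ 2 ≠ 0 := by positivity
    simp at h'
    tauto
  obtain ⟨k, r, hk, hr⟩ := exists_odd_part_of_sq_add hd _ a b le_rfl hab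
  obtain ⟨l, s, hl, hs⟩ := exists_odd_part_of_sq_add hd _ c 0 le_rfl (Or.inl hc)
  have hs1 : Odd s := by rw [Int.odd_iff]; lia
  have h2 : 2 ^ k * r = 2 ^ (e + l) * (q * s) := by
    rw [← hk, h', pow_add]
    linear_combination (q * 2 ^ e) * hl
  have := odd_part_unique (by rw [Int.odd_iff]; lia)
    ((show Odd q by rw [Int.odd_iff]; lia).mul hs1) h2
  rcases hs with hs | hs
  · have : (q * s) % 8 = 7 := by rw [Int.mul_emod, hq, hs]; rfl
    lia
  · have : (q * s) % 8 = 5 := by rw [Int.mul_emod, hq, hs]; rfl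
    lia

end Descent

section NormForms

/-- Up to sign, the norms of nonzero integers of `L` are of the form `x² - Dy²`. -/
def HasNormForm (L : Type*) [Field L] [NumberField L] (D : ℤ) : Prop :=
  ∀ α : 𝓞 L, α ≠ 0 → ∃ x y : ℚ, (Ideal.absNorm (Ideal.span {α}) : ℚ) = x ^ 2 - D * y ^ 2 ∨
    (Ideal.absNorm (Ideal.span {α}) : ℚ) = -(x ^ 2 - D * y ^ 2)

variable {K : Type*} [Field K] {F L : Type*} [Field F] [Field L] [NumberField F] [NumberField L]
  {ιL : L →+* K} {γ : K →+* K} {g : L →+* L}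

lemma absNorm_span_rat (y : 𝓞 ℚ) : (Ideal.absNorm (Ideal.span {y}) : ℚ) = |(y : ℚ)| := by
  obtain ⟨n, hn⟩ := IsIntegrallyClosed.isIntegral_iff.mp y.isIntegral_coe
  have hy : y = algebraMap ℤ (𝓞 ℚ) n := RingOfIntegers.ext (hn.symm.trans (by simp))
  rw [Ideal.absNorm_span_singleton, hy, Algebra.norm_algebraMap_of_basis (RingOfIntegers.basis ℚ),
    ← Module.finrank_eq_card_basis (RingOfIntegers.basis ℚ), RingOfIntegers.rank,
    Module.finrank_self, pow_one]
  simp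

lemma hasNormForm_quadratic {f : ℚ →+* L} {ι : ℚ →+* K} (h : QuadRel ι ιL γ f g) {D : ℤ} {δ : K}
    (hδ : δ ^ 2 = D) (hδ0 : δ ≠ 0) (hr : δ ∈ ιL.range) (hγ : γ δ = -δ) : HasNormForm L D := by
  have := charZero_of_injective_ringHom ι.injective
  obtain ⟨δ', rfl⟩ := hr
  have hg : g δ' = -δ' := ιL.injective (by rw [h.conj, hγ, map_neg])
  have hδ' : δ' ≠ 0 := by rintro rfl; simp at hδ0
  have hD : δ' ^ 2 = D := ιL.injective (by simpa using hδ)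
  intro α hα
  obtain ⟨y, hy⟩ := h.quad.mul_conj_eq α
  obtain ⟨p, hp⟩ := h.quad.fixed ((α : L) + g α) (by rw [map_add, h.quad.invol, add_comm])
  obtain ⟨q, hq⟩ := h.quad.fixed (((α : L) - g α) / δ') (by
    rw [map_div₀, map_sub, h.quad.invol, hg]
    field_simp
    ring)
  have hf : ∀ r : ℚ, f r = r := fun r => map_ratCast f r
  have hyr : (y : ℚ) = (p / 2) ^ 2 - D * (q / 2) ^ 2 := by
    apply f.injective
    have h1 : f (y : ℚ) = (α : L) * g α := congrArg (algebraMap (𝓞 L) L) hy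
    have h2 : δ' * f q = (α : L) - g α := by rw [hq]; field_simp
    rw [h1, map_sub, map_mul, map_pow, map_pow, map_div₀, map_div₀, hp, map_intCast, ← hD,
      map_ofNat]
    field_simp
    linear_combination (δ' * f q + ((α : L) - g α)) * h2
  refine ⟨p / 2, q / 2, ?_⟩
  rw [h.quad.absNorm_span hy, absNorm_span_rat, ← hyr]
  exact abs_choice _

lemma HasNormForm.of_quadExt {f : F →+* L} (h : QuadExt f g) {D : ℤ} (hF : HasNormForm F D) :
    HasNormForm L D := by
  intro α hα
  obtain ⟨y, hy⟩ := h.mul_conj_eq α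
  have hy0 : y ≠ 0 := by
    rintro rfl
    rw [map_zero] at hy
    rcases mul_eq_zero.mp hy.symm with h1 | h1
    · exact hα h1
    · exact hα (mapRingHom_injective g (by rw [h1, map_zero]))
  rw [h.absNorm_span hy]
  exact hF y hy0

lemma absNorm_relation {I J : Ideal (𝓞 L)} (hI : I ≠ 0) (hJ : J ≠ 0)
    (h : idealClass I = idealClass J) : ∃ (α : 𝓞 L) (z : ℚ), α ≠ 0 ∧ z ≠ 0 ∧
      (Ideal.absNorm (Ideal.span {α}) : ℚ) * z ^ 2 = Ideal.absNorm I * Ideal.absNorm J := by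
  obtain ⟨x, y, hx, hy, hxy⟩ := (idealClass_eq_iff hI hJ).mp h
  have hn : ∀ {I : Ideal (𝓞 L)}, I ≠ 0 → (Ideal.absNorm I : ℚ) ≠ 0 := fun hI => by
    exact_mod_cast Ideal.absNorm_eq_zero_iff.not.mpr hI
  have hX := hn (span_ne_zero hx)
  have hI' := hn hI
  have hJ' := hn hJ
  refine ⟨x * y, Ideal.absNorm J / Ideal.absNorm (Ideal.span {x}), mul_ne_zero hx hy,
    div_ne_zero hJ' hX, ?_⟩
  have h1 := congrArg (fun I => (Ideal.absNorm I : ℚ)) hxy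
  simp only [map_mul, Nat.cast_mul] at h1
  rw [← Ideal.span_singleton_mul_span_singleton, map_mul, Nat.cast_mul]
  field_simp
  linear_combination -h1

lemma HasNormForm.absNorm_mul_ne {D : ℤ} (hL : HasNormForm L D) {p : ℕ} (hp : p.Prime)
    (h5 : p % 8 = 5) (hD : (p : ℤ) ∣ D) (hD2 : ¬ (p : ℤ) ^ 2 ∣ D) {I J : Ideal (𝓞 L)} (hI : I ≠ 0)
    (hJ : J ≠ 0) (h : idealClass I = idealClass J) {w : ℕ} :
    Ideal.absNorm I * Ideal.absNorm J ≠ 2 * w ^ 2 := by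
  intro hw
  obtain ⟨α, z, hα, hz, h1⟩ := absNorm_relation hI hJ h
  have hw' : (Ideal.absNorm I : ℚ) * Ideal.absNorm J = 2 * w ^ 2 := by exact_mod_cast hw
  have hw0 : (w : ℚ) / z ≠ 0 := by
    refine div_ne_zero ?_ hz
    rintro h0
    rw [h0] at hw'
    have h2 := Ideal.absNorm_eq_zero_iff.not.mpr hI
    have h3 := Ideal.absNorm_eq_zero_iff.not.mpr hJ
    have : (Ideal.absNorm I : ℚ) * Ideal.absNorm J ≠ 0 := by exact_mod_cast mul_ne_zero h2 h3
    simp at hw'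
    tauto
  have h2 : (Ideal.absNorm (Ideal.span {α}) : ℚ) = 2 * (w / z) ^ 2 := by
    field_simp
    rw [h1, hw']
  obtain ⟨x, y, h3 | h3⟩ := hL α hα
  · exact hw0 (rat_eq_zero_of_sq_sub_mul_sq hp h5 (e := 2) (Or.inl rfl) hD hD2 (x := x) (y := y)
      (by rw [← h3, h2]; norm_num))
  · exact hw0 (rat_eq_zero_of_sq_sub_mul_sq hp h5 (e := -2) (Or.inr rfl) hD hD2 (x := x) (y := y)
      (by rw [h3] at h2; push_cast; linear_combination -h2))

lemma HasNormForm.absNorm_mul_ne_of_mod_eight {d : ℤ} (hL : HasNormForm L (-(2 * d)))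
    (hd : d % 8 = 1) (hd0 : 0 < d) {q : ℕ} (hq : q % 8 = 7) {e w : ℕ} {I J : Ideal (𝓞 L)}
    (hI : I ≠ 0) (hJ : J ≠ 0) (h : idealClass I = idealClass J) :
    Ideal.absNorm I * Ideal.absNorm J ≠ q * 2 ^ e * w ^ 2 := by
  intro hw
  obtain ⟨α, z, hα, hz, h1⟩ := absNorm_relation hI hJ h
  have hw' : (Ideal.absNorm I : ℚ) * Ideal.absNorm J = q * 2 ^ e * w ^ 2 := by exact_mod_cast hw
  have hw0 : (w : ℚ) / z ≠ 0 := by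
    refine div_ne_zero ?_ hz
    rintro h0
    rw [h0] at hw'
    have h2 := Ideal.absNorm_eq_zero_iff.not.mpr hI
    have h3 := Ideal.absNorm_eq_zero_iff.not.mpr hJ
    have : (Ideal.absNorm I : ℚ) * Ideal.absNorm J ≠ 0 := by exact_mod_cast mul_ne_zero h2 h3
    simp at hw'
    tauto
  have h2 : (Ideal.absNorm (Ideal.span {α}) : ℚ) = q * 2 ^ e * (w / z) ^ 2 := by
    field_simp
    rw [h1, hw']
  have hpos : 0 < (Ideal.absNorm (Ideal.span {α}) : ℚ) := by
    exact_mod_cast Nat.pos_of_ne_zero (Ideal.absNorm_eq_zero_iff.not.mpr (span_ne_zero hα))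
  have hd0' : (0 : ℚ) < d := by exact_mod_cast hd0
  obtain ⟨x, y, h3 | h3⟩ := hL α hα
  · refine rat_false_of_sq_add_mul_sq hd (q := q) (by lia) (e := e) hw0 (x := x) (y := y) ?_
    rw [h3] at h2
    push_cast at h2 ⊢
    linear_combination h2
  · rw [h3] at hpos
    push_cast at hpos
    nlinarith [sq_nonneg x, mul_nonneg hd0'.le (sq_nonneg y)]

end NormForms

namespace QuadExt

variable {F L : Type*} [Field F] [Field L] [NumberField F] [NumberField L]
  {f : F →+* L} {g : L →+* L}

local notation "G" => RingOfIntegers.mapRingHom g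
local notation "Φ" => RingOfIntegers.mapRingHom f

/-- The version of `mem_of_invariant_class` for classes of 2-power order. -/
lemma mem_of_invariant_twoPart (h : QuadExt f g)
    (hN : ∀ (u : (𝓞 F)ˣ) (x : L), f (u : 𝓞 F) = x * g x → ∃ v : (𝓞 L)ˣ, Φ u = v * G v)
    {r : ℕ} (hr : Odd r) (hrF : ∀ y : ClassGroup (𝓞 F), y ^ r ∈ twoPart (ClassGroup (𝓞 F)))
    (T : Subgroup (ClassGroup (𝓞 L))) (hbase : ∀ y ∈ twoPart (ClassGroup (𝓞 F)), classMap f y ∈ T)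
    (hram : ∀ P : Ideal (𝓞 L), P.IsPrime → P ≠ 0 → extIdeal g P = P → (∀ x, x - G x ∈ P) →
      idealClass P ^ r ∈ T) {x : ClassGroup (𝓞 L)} (hx : x ∈ twoPart (ClassGroup (𝓞 L)))
    (hgx : classMap g x = x) : x ∈ T := by
  refine mem_of_odd_pow_mem hx hr ?_
  exact h.mem_of_invariant_class hN (T.comap (powMonoidHom r))
    (fun y => by
      change classMap f y ^ r ∈ T
      rw [← map_pow]
      exact hbase _ (hrF y)) hram hgx

lemma conj_eq_inv_of_twoPart (h : QuadExt f g) (hF : twoPart (ClassGroup (𝓞 F)) = ⊥)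
    {x : ClassGroup (𝓞 L)} (hx : x ∈ twoPart (ClassGroup (𝓞 L))) : classMap g x = x⁻¹ := by
  obtain ⟨r, hr, hrF⟩ := exists_odd_pow_mem_twoPart (ClassGroup (𝓞 F))
  refine h.classMap_conj_eq_inv fun y hy => eq_one_of_odd_pow ?_ hr ?_
  · rw [hy]
    exact mul_mem hx (map_mem_twoPart _ hx)
  · have := hrF y
    rw [hF, Subgroup.mem_bot] at this
    rw [← map_pow, this, map_one]

/-- The 2-class group stays trivial if all ramified primes are principal. -/
lemma twoPart_eq_bot (h : QuadExt f g)
    (hN : ∀ (u : (𝓞 F)ˣ) (x : L), f (u : 𝓞 F) = x * g x → ∃ v : (𝓞 L)ˣ, Φ u = v * G v)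
    (hF : twoPart (ClassGroup (𝓞 F)) = ⊥)
    (hram : ∀ P : Ideal (𝓞 L), P.IsPrime → P ≠ 0 → (∀ x, x - G x ∈ P) → idealClass P = 1) :
    twoPart (ClassGroup (𝓞 L)) = ⊥ := by
  rw [Subgroup.eq_bot_iff_forall]
  intro x hx
  by_contra hx1
  obtain ⟨y, hy, hy2, hy1⟩ := exists_sq_eq_one_of_ne le_rfl hx hx1
  obtain ⟨r, hr, hrF⟩ := exists_odd_pow_mem_twoPart (ClassGroup (𝓞 F))
  have := h.mem_of_invariant_twoPart hN hr hrF ⊥ (fun z hz => by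
    rw [hF, Subgroup.mem_bot] at hz
    rw [hz, map_one]
    exact one_mem _) (fun P hP hP0 _ hram' => by
    rw [hram P hP hP0 hram', one_pow]
    exact one_mem _) hy (by
    rw [h.conj_eq_inv_of_twoPart hF hy, inv_eq_iff_mul_eq_one, ← sq, hy2])
  exact hy1 (Subgroup.mem_bot.mp this)

end QuadExt

lemma pow_mem_twoPart_of_dvd {G : Type*} [CommGroup G] {r r' : ℕ} (h : r ∣ r')
    (hr : ∀ x : G, x ^ r ∈ twoPart G) (x : G) : x ^ r' ∈ twoPart G := by
  obtain ⟨k, rfl⟩ := h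
  rw [pow_mul]
  exact pow_mem (hr x) k

section RationalUnits

variable {L : Type*} [Field L] [CharZero L]

lemma exists_intCast_eq_of_isIntegral {q : ℚ} (h : IsIntegral ℤ (q : L)) : ∃ n : ℤ, (n : ℚ) = q :=
  IsIntegrallyClosed.isIntegral_iff.mp (isIntegral_of_map (Rat.castHom L) h)

lemma IsIntUnit.ratCast {q : ℚ} (h : IsIntUnit (q : L)) : q = 1 ∨ q = -1 := by
  obtain ⟨m, rfl⟩ := exists_intCast_eq_of_isIntegral h.2.1
  obtain ⟨n, hn⟩ := exists_intCast_eq_of_isIntegral (L := L) (q := (m : ℚ)⁻¹)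
    (by rw [Rat.cast_inv]; exact h.2.2)
  have hm0 : (m : ℚ) ≠ 0 := by
    intro h0
    exact h.1 (by rw [h0, Rat.cast_zero])
  have : m * n = 1 := by
    have : (m * n : ℚ) = 1 := by rw [hn, mul_inv_cancel₀ hm0]
    exact_mod_cast this
  rcases Int.eq_one_or_neg_one_of_mul_eq_one this with h | h <;> simp [h]

end RationalUnits

/-- The field `K = ℚ(√2, √(p₁p₂), i)` together with generators `a`, `b`, `c` of its Galois group
changing the signs of `t = √(p₁p₂)`, `i` and `s = √2` respectively, and with the fundamental units
of its real quadratic subfields, whose product is a square. -/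
structure Octic (p₁ p₂ : ℕ) (K : Type*) [Field K] where
  a : K →+* K
  b : K →+* K
  c : K →+* K
  s : K
  t : K
  i : K
  prime₁ : p₁.Prime
  prime₂ : p₂.Prime
  ne : p₁ ≠ p₂
  mod₁ : p₁ % 8 = 5
  mod₂ : p₂ % 8 = 5
  aa : ∀ x, a (a x) = x
  bb : ∀ x, b (b x) = x
  cc : ∀ x, c (c x) = x
  ab : ∀ x, a (b x) = b (a x)
  ac : ∀ x, a (c x) = c (a x)
  bc : ∀ x, b (c x) = c (b x)
  s2 : s ^ 2 = 2
  t2 : t ^ 2 = p₁ * p₂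
  i2 : i ^ 2 = -1
  as : a s = s
  at' : a t = -t
  ai : a i = i
  bs : b s = s
  bt : b t = t
  bi : b i = -i
  cs : c s = -s
  ct : c t = t
  ci : c i = i
  rat : ∀ x, a x = x → b x = x → c x = x → ∃ q : ℚ, (q : K) = x
  φ : K →+* ℂ
  φb : ∀ x, φ (b x) = (starRingEnd ℂ) (φ x)
  e₂ : K
  eₚ : K
  eₜ : K
  η : K
  unit₂ : IsIntUnit e₂
  unitₚ : IsIntUnit eₚ
  unitₜ : IsIntUnit eₜ
  a₂ : a e₂ = e₂
  b₂ : b e₂ = e₂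
  bₚ : b eₚ = eₚ
  cₚ : c eₚ = eₚ
  bₜ : b eₜ = eₜ
  cₜ : c eₜ = a eₜ
  pos₂ : 0 < (φ e₂).re
  posₚ : 0 < (φ eₚ).re
  posₜ : 0 < (φ eₜ).re
  gen₂ : ∀ x, IsIntUnit x → a x = x → b x = x → ∃ k : ℤ, x = e₂ ^ k ∨ x = -e₂ ^ k
  genₚ : ∀ x, IsIntUnit x → b x = x → c x = x → ∃ k : ℤ, x = eₚ ^ k ∨ x = -eₚ ^ k
  genₜ : ∀ x, IsIntUnit x → b x = x → c x = a x → ∃ k : ℤ, x = eₜ ^ k ∨ x = -eₜ ^ k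
  bη : b η = η
  η2 : η ^ 2 = e₂ * eₚ * eₜ

namespace Octic

variable {p₁ p₂ : ℕ} {K : Type*} [Field K] (C : Octic p₁ p₂ K)

include C in
lemma charZero : CharZero K := C.φ.charZero

lemma φ_real {x : K} (hx : C.b x = x) : C.φ x = ((C.φ x).re : ℂ) := by
  have := C.φb x
  rw [hx] at this
  exact (Complex.conj_eq_iff_re.mp this.symm).symm

lemma re_mul {x y : K} (hx : C.b x = x) : (C.φ (x * y)).re = (C.φ x).re * (C.φ y).re := by
  rw [map_mul, C.φ_real hx, Complex.re_ofReal_mul, Complex.ofReal_re]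

lemma re_ne_zero {x : K} (hx : C.b x = x) (h0 : x ≠ 0) : (C.φ x).re ≠ 0 := by
  intro h
  have := C.φ_real hx
  rw [h, Complex.ofReal_zero, map_eq_zero] at this
  exact h0 this

lemma re_pow {x : K} (hx : C.b x = x) (k : ℕ) : (C.φ (x ^ k)).re = (C.φ x).re ^ k := by
  rw [map_pow, C.φ_real hx, ← Complex.ofReal_pow, Complex.ofReal_re, Complex.ofReal_re]

lemma re_zpow {x : K} (hx : C.b x = x) (k : ℤ) : (C.φ (x ^ k)).re = (C.φ x).re ^ k := by
  rw [map_zpow₀, C.φ_real hx, ← Complex.ofReal_zpow, Complex.ofReal_re, Complex.ofReal_re]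

lemma re_neg (x : K) : (C.φ (-x)).re = -(C.φ x).re := by rw [map_neg, Complex.neg_re]

lemma re_norm_pos {x : K} (hx : x ≠ 0) : 0 < (C.φ (x * C.b x)).re := by
  rw [map_mul, C.φb, Complex.mul_conj, Complex.ofReal_re]
  exact Complex.normSq_pos.mpr ((map_ne_zero _).mpr hx)

lemma sq_ne_neg_sq {x y : K} (hx : C.b x = x) (hy : C.b y = y) (hy0 : y ≠ 0) : x ^ 2 ≠ -y ^ 2 := by
  intro h
  have h1 := congrArg (fun z => (C.φ z).re) h
  simp only [C.re_neg, C.re_pow hx, C.re_pow hy] at h1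
  have := C.re_ne_zero hy hy0
  have : 0 < (C.φ y).re ^ 2 := by positivity
  nlinarith [sq_nonneg (C.φ x).re]

lemma rat_unit {x : K} (hx : IsIntUnit x) (ha : C.a x = x) (hb : C.b x = x) (hc : C.c x = x) :
    x = 1 ∨ x = -1 := by
  have := C.charZero
  obtain ⟨q, rfl⟩ := C.rat x ha hb hc
  rcases hx.ratCast with rfl | rfl <;> simp

include C in
lemma neg_one_ne_one : (-1 : K) ≠ 1 := by
  have := C.charZero
  norm_num

lemma s_ne_zero : C.s ≠ 0 := by
  have := C.charZero
  intro h
  have := C.s2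
  rw [h] at this
  norm_num at this

lemma norm₂ : C.e₂ * C.c C.e₂ = -1 := by
  have hu : IsIntUnit (1 + C.s) := by
    have hs : IsIntegral ℤ C.s := by
      apply IsIntegral.of_pow two_pos
      rw [C.s2]
      simpa using isIntegral_algebraMap (R := ℤ) (A := K) (x := 2)
    refine IsIntUnit.of_mul_eq_one (y := C.s - 1) (isIntegral_one.add hs) (hs.sub isIntegral_one) ?_
    linear_combination C.s2
  obtain ⟨k, hk⟩ := C.gen₂ _ hu (by simp [C.as]) (by simp [C.bs])
  rcases C.rat_unit (C.unit₂.mul (C.unit₂.map C.c)) (by simp [C.a₂, C.ac]) (by simp [C.b₂, C.bc])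
    (by simp [C.cc, mul_comm]) with h | h
  · exfalso
    have h1 : (1 + C.s) * C.c (1 + C.s) = -1 := by
      rw [map_add, map_one, C.cs]
      linear_combination -C.s2
    have h2 : (1 + C.s) * C.c (1 + C.s) = 1 := by
      rcases hk with hk | hk
      · rw [hk, map_zpow₀, ← mul_zpow, h, one_zpow]
      · rw [hk, map_neg, map_zpow₀, neg_mul_neg, ← mul_zpow, h, one_zpow]
    exact C.neg_one_ne_one (h1.symm.trans h2)
  · exact h

lemma unitη : IsIntUnit C.η :=
  IsIntUnit.of_pow two_pos (by rw [C.η2]; exact (C.unit₂.mul C.unitₚ).mul C.unitₜ)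

lemma aₜ : C.a C.eₜ = C.c C.eₜ := C.cₜ.symm

lemma norm_cₜ : C.eₜ * C.c C.eₜ = -1 := by
  rcases C.rat_unit (C.unitₜ.mul (C.unitₜ.map C.c)) (by simp [C.aₜ, C.ac, C.cc, mul_comm])
    (by simp [C.bₜ, C.bc]) (by simp [C.cc, mul_comm]) with h | h
  · exfalso
    refine C.sq_ne_neg_sq (x := C.η * C.c C.η) (y := C.eₚ) (by simp [C.bη, C.bc]) C.bₚ C.unitₚ.1 ?_
    rw [mul_pow, ← map_pow, C.η2, map_mul, map_mul, C.cₚ]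
    linear_combination (C.eₚ ^ 2 * C.eₜ * C.c C.eₜ) * C.norm₂ - C.eₚ ^ 2 * h
  · exact h

lemma norm_aₜ : C.eₜ * C.a C.eₜ = -1 := by rw [C.aₜ, C.norm_cₜ]

lemma normₚ : C.eₚ * C.a C.eₚ = -1 := by
  rcases C.rat_unit (C.unitₚ.mul (C.unitₚ.map C.a)) (by simp [C.aa, mul_comm])
    (by simp [C.bₚ, ← C.ab]) (by simp [← C.ac, C.cₚ]) with h | h
  · exfalso
    refine C.sq_ne_neg_sq (x := C.η * C.a C.η) (y := C.e₂) (by simp [C.bη, ← C.ab]) C.b₂ C.unit₂.1 ?_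
    rw [mul_pow, ← map_pow, C.η2, map_mul, map_mul, C.a₂]
    linear_combination (C.e₂ ^ 2 * C.eₚ * C.a C.eₚ) * C.norm_aₜ - C.e₂ ^ 2 * h
  · exact h

lemma norm_cη : C.η * C.c C.η = C.eₚ ∨ C.η * C.c C.η = -C.eₚ := by
  rw [← sq_eq_sq_iff_eq_or_eq_neg, mul_pow, ← map_pow, C.η2, map_mul, map_mul, C.cₚ]
  linear_combination (C.eₚ ^ 2 * C.eₜ * C.c C.eₜ) * C.norm₂ - C.eₚ ^ 2 * C.norm_cₜ

lemma norm_aη : C.η * C.a C.η = C.e₂ ∨ C.η * C.a C.η = -C.e₂ := by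
  rw [← sq_eq_sq_iff_eq_or_eq_neg, mul_pow, ← map_pow, C.η2, map_mul, map_mul, C.a₂]
  linear_combination (C.e₂ ^ 2 * C.eₜ * C.a C.eₜ) * C.normₚ - C.e₂ ^ 2 * C.norm_aₜ

end Octic

lemma even_of_neg_one_zpow {K : Type*} [Field K] (h1 : (-1 : K) ≠ 1) {k : ℤ} (h : (-1 : K) ^ k = 1) :
    Even k := by
  rcases Int.even_or_odd k with hk | hk
  · exact hk
  · rw [hk.neg_one_zpow] at h
    exact absurd h h1

namespace Octic

variable {p₁ p₂ : ℕ} {K : Type*} [Field K] (C : Octic p₁ p₂ K)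

/-- Real units which are, up to sign, of the form `w / τ(w)` with `w` a real unit. -/
def Cob (τ : K →+* K) (x : K) : Prop :=
  ∃ w, C.b w = w ∧ IsIntUnit w ∧ (x * τ w = w ∨ x * τ w = -w)

variable {C} {τ σ : K →+* K}

lemma Cob.mul {x y : K} (hx : C.Cob τ x) (hy : C.Cob τ y) : C.Cob τ (x * y) := by
  obtain ⟨v, hv, hv1, hv2⟩ := hx
  obtain ⟨w, hw, hw1, hw2⟩ := hy
  refine ⟨v * w, by rw [map_mul, hv, hw], hv1.mul hw1, ?_⟩
  rw [map_mul, mul_mul_mul_comm]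
  rcases hv2 with h | h <;> rcases hw2 with h' | h' <;> rw [h, h'] <;> simp

lemma Cob.neg {x : K} (hx : C.Cob τ x) : C.Cob τ (-x) := by
  obtain ⟨v, hv, hv1, hv2⟩ := hx
  exact ⟨v, hv, hv1, hv2.symm.imp (fun h => by rw [neg_mul, h, neg_neg])
    fun h => by rw [neg_mul, h]⟩

lemma Cob.inv {x : K} (hx : C.Cob τ x) : C.Cob τ x⁻¹ := by
  obtain ⟨v, hv, hv1, hv2⟩ := hx
  refine ⟨v⁻¹, by rw [map_inv₀, hv], hv1.inv, ?_⟩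
  rw [map_inv₀, ← mul_inv]
  exact hv2.imp (fun h => by rw [h]) fun h => by rw [h, inv_neg]

lemma Cob.zpow {x : K} (hx : C.Cob τ x) (k : ℤ) : C.Cob τ (x ^ k) := by
  have hn : ∀ n : ℕ, C.Cob τ (x ^ n) := fun n => by
    induction n with
    | zero => exact ⟨1, map_one _, .one, Or.inl (by simp)⟩
    | succ n ih => rw [pow_succ]; exact ih.mul hx
  cases k with
  | ofNat n => simpa using hn n
  | negSucc n => simpa using (hn (n + 1)).inv

lemma cob_sq {x : K} (hb : C.b x = x) (hx : IsIntUnit x) (h : x * τ x = -1) : C.Cob τ (x ^ 2) :=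
  ⟨x, hb, hx, Or.inr (by linear_combination x * h)⟩

/-- Hilbert's Theorem 90 for the units of the real biquadratic field. -/
lemma cob_of_norm {e f g : K} (hττ : ∀ x, τ (τ x) = x) (hτσ : ∀ x, τ (σ x) = σ (τ x))
    (hσσ : ∀ x, σ (σ x) = x) (hτb : ∀ x, τ (C.b x) = C.b (τ x)) (hσb : ∀ x, σ (C.b x) = C.b (σ x))
    (he : IsIntUnit e) (hf : IsIntUnit f) (hbe : C.b e = e) (hbf : C.b f = f)
    (hNe : e * τ e = -1) (hNf : f * τ f = -1) (hg : g ≠ 0)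
    (hη : C.η ^ 2 = g * e * f) (hNη : C.η * τ C.η = g ∨ C.η * τ C.η = -g)
    (hE : ∀ x, IsIntUnit x → C.b x = x → σ x = x → ∃ k : ℤ, x = e ^ k ∨ x = -e ^ k)
    (hF : ∀ x, IsIntUnit x → C.b x = x → σ x = τ x → ∃ k : ℤ, x = f ^ k ∨ x = -f ^ k)
    {v : K} (hv : IsIntUnit v) (hbv : C.b v = v) (hNv : v * τ v = 1) : C.Cob τ v := by
  obtain ⟨k, hk⟩ := hE (v * σ v) (hv.mul (hv.map σ)) (by simp [← hσb, hbv]) (by simp [hσσ, mul_comm])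
  obtain ⟨m, hm⟩ := hF (v * σ (τ v)) (hv.mul ((hv.map τ).map σ)) (by simp [← hσb, ← hτb, hbv])
    (by simp [hσσ, hτσ, hττ, mul_comm])
  have hσv : σ v * σ (τ v) = 1 := by rw [← map_mul, hNv, map_one]
  have hk2 : Even k := by
    refine even_of_neg_one_zpow C.neg_one_ne_one ?_
    have h1 : (v * σ v) * τ (v * σ v) = 1 := by
      rw [map_mul, hτσ]
      linear_combination (σ v * σ (τ v)) * hNv + hσv
    rw [← hNe, mul_zpow, ← map_zpow₀, ← h1]
    rcases hk with h | h <;> rw [h] <;> simp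
  have hm2 : Even m := by
    refine even_of_neg_one_zpow C.neg_one_ne_one ?_
    have h1 : (v * σ (τ v)) * τ (v * σ (τ v)) = 1 := by
      rw [map_mul, hτσ, hττ]
      linear_combination (σ v * σ (τ v)) * hNv + hσv
    rw [← hNf, mul_zpow, ← map_zpow₀, ← h1]
    rcases hm with h | h <;> rw [h] <;> simp
  obtain ⟨k, rfl⟩ := hk2
  obtain ⟨m, rfl⟩ := hm2
  have he0 := he.1
  have hf0 := hf.1
  have hv2 : v ^ 2 = (v * σ v) * (v * σ (τ v)) := by linear_combination -(v ^ 2) * hσv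
  have hef0 : e ^ k * f ^ m ≠ 0 := mul_ne_zero (zpow_ne_zero _ he0) (zpow_ne_zero _ hf0)
  have hefb : C.b (e ^ k * f ^ m) = e ^ k * f ^ m := by
    rw [map_mul, map_zpow₀, map_zpow₀, hbe, hbf]
  have hsq : v ^ 2 = (e ^ k * f ^ m) ^ 2 := by
    have h1 : v ^ 2 = (e ^ k * f ^ m) ^ 2 ∨ v ^ 2 = -(e ^ k * f ^ m) ^ 2 := by
      rw [hv2]
      rw [zpow_add₀ he0] at hk
      rw [zpow_add₀ hf0] at hm
      rcases hk with h | h <;> rcases hm with h' | h' <;> rw [h, h']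
      · left; ring
      · right; ring
      · right; ring
      · left; ring
    exact h1.resolve_right (C.sq_ne_neg_sq hbv hefb hef0)
  have hcob : C.Cob τ (e ^ k * f ^ m) := by
    have hkm : Even (k + m) := by
      refine even_of_neg_one_zpow C.neg_one_ne_one ?_
      have h1 : (e ^ k * f ^ m) * τ (e ^ k * f ^ m) = 1 := by
        rw [← hNv]
        rcases sq_eq_sq_iff_eq_or_eq_neg.mp hsq with h | h <;> rw [h] <;> simp
      rw [map_mul, map_zpow₀, map_zpow₀, mul_mul_mul_comm, ← mul_zpow, ← mul_zpow, hNe, hNf,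
        ← zpow_add₀ (neg_ne_zero.mpr one_ne_zero)] at h1
      exact h1
    obtain ⟨j, hj⟩ := hkm
    have h1 : e ^ k * f ^ m = (e * f) ^ k * (f ^ 2) ^ (j - k) := by
      rw [mul_zpow, ← zpow_natCast, ← zpow_mul, mul_assoc, ← zpow_add₀ hf0]
      congr 2
      push_cast
      lia
    rw [h1]
    refine Cob.mul (Cob.zpow ⟨C.η, C.bη, C.unitη, ?_⟩ k) ((cob_sq hbf hf hNf).zpow _)
    have h2 : e * f * τ C.η * g = C.η * (C.η * τ C.η) := by
      linear_combination (-τ C.η) * hη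
    rcases hNη with h | h
    · left
      apply mul_right_cancel₀ hg
      rw [h2, h]
    · right
      apply mul_right_cancel₀ hg
      rw [h2, h]
      ring
  rcases sq_eq_sq_iff_eq_or_eq_neg.mp hsq with h | h
  · rwa [h]
  · rw [h]; exact hcob.neg

lemma cob_a {v : K} (hv : IsIntUnit v) (hbv : C.b v = v) (hNv : v * C.a v = 1) : C.Cob C.a v :=
  cob_of_norm (σ := C.c) C.aa C.ac C.cc C.ab (fun x => (C.bc x).symm) C.unitₚ C.unitₜ C.bₚ C.bₜ
    C.normₚ C.norm_aₜ C.unit₂.1 C.η2 C.norm_aη C.genₚ C.genₜ hv hbv hNv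

lemma cob_c {v : K} (hv : IsIntUnit v) (hbv : C.b v = v) (hNv : v * C.c v = 1) : C.Cob C.c v :=
  cob_of_norm (σ := C.a) C.cc (fun x => (C.ac x).symm) C.aa (fun x => (C.bc x).symm) C.ab C.unit₂
    C.unitₜ C.b₂ C.bₜ C.norm₂ C.norm_cₜ C.unitₚ.1 (by rw [C.η2]; ring) C.norm_cη
    (fun x hx hb ha => C.gen₂ x hx ha hb) (fun x hx hb h => C.genₜ x hx hb h.symm) hv hbv hNv

end Octic

namespace Octic

variable {p₁ p₂ : ℕ} {K : Type*} [Field K] (C : Octic p₁ p₂ K)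

lemma exists_zpow_sq {τ : K →+* K} {e x : K} (hb : C.b e = e)
    (he : IsIntUnit e) (hpos : 0 < (C.φ e).re) (hN : e * τ e = -1) (hx : 0 < (C.φ x).re)
    (hx' : 0 < (C.φ (τ x)).re) (h : ∃ k : ℤ, x = e ^ k ∨ x = -e ^ k) :
    ∃ k : ℤ, x = (e ^ k) ^ 2 := by
  obtain ⟨k, h⟩ := h
  have hk : 0 < (C.φ (e ^ k)).re := by
    rw [C.re_zpow hb]
    positivity
  have h : x = e ^ k := by
    refine h.resolve_right fun h => ?_
    rw [h, C.re_neg] at hx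
    linarith
  have h1 : 0 < (C.φ (x * τ x)).re := by
    rw [C.re_mul (by rw [h, map_zpow₀, hb])]
    positivity
  rw [h, map_zpow₀, ← mul_zpow, hN] at h1
  have hk : Even k := by
    rcases Int.even_or_odd k with hk | hk
    · exact hk
    · rw [hk.neg_one_zpow] at h1
      norm_num at h1
  obtain ⟨l, rfl⟩ := hk
  exact ⟨l, by rw [h, zpow_add₀ he.1, sq]⟩

lemma even_of_re_pos {k : ℤ} {x : K} (hx : C.b x = x) (h : 0 < (C.φ ((-1) ^ k * x ^ 2)).re) :
    Even k := by
  rcases Int.even_or_odd k with hk | hk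
  · exact hk
  · rw [hk.neg_one_zpow, neg_one_mul, C.re_neg, C.re_pow hx] at h
    nlinarith [sq_nonneg (C.φ x).re]

/-- A unit which is a norm from `K` to `K⁺` is the square of a real unit. -/
lemma exists_eq_sq {u x : K} (hu : IsIntUnit u) (hx : u = x * C.b x) :
    ∃ w, C.b w = w ∧ IsIntUnit w ∧ u = w ^ 2 := by
  have hx0 : x ≠ 0 := fun h => hu.1 (by rw [hx, h, zero_mul])
  have hb : C.b u = u := by rw [hx, map_mul, C.bb, mul_comm]
  have hpos : 0 < (C.φ u).re := by rw [hx]; exact C.re_norm_pos hx0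
  have hposa : 0 < (C.φ (C.a u)).re := by
    rw [hx, map_mul, C.ab]; exact C.re_norm_pos ((map_ne_zero C.a).mpr hx0)
  have hposc : 0 < (C.φ (C.c u)).re := by
    rw [hx, map_mul, ← C.bc]; exact C.re_norm_pos ((map_ne_zero C.c).mpr hx0)
  have hposac : 0 < (C.φ (C.a (C.c u))).re := by
    rw [hx, map_mul, map_mul, ← C.bc, C.ab]
    exact C.re_norm_pos ((map_ne_zero C.a).mpr ((map_ne_zero C.c).mpr hx0))
  have hab : C.b (C.a u) = C.a u := by rw [← C.ab, hb]
  have hcb : C.b (C.c u) = C.c u := by rw [C.bc, hb]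
  have hacb : C.b (C.a (C.c u)) = C.a (C.c u) := by rw [← C.ab, hcb]
  obtain ⟨k, hk⟩ := C.exists_zpow_sq (τ := C.a) (x := u * C.c u) C.bₚ C.unitₚ C.posₚ C.normₚ
    (by rw [C.re_mul hb]; positivity) (by rw [map_mul, C.re_mul hab]; positivity)
    (C.genₚ _ (hu.mul (hu.map _)) (by rw [map_mul, hb, hcb]) (by rw [map_mul, C.cc, mul_comm]))
  obtain ⟨l, hl⟩ := C.exists_zpow_sq (τ := C.c) (x := u * C.a u) C.b₂
    C.unit₂ C.pos₂ C.norm₂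
    (by rw [C.re_mul hb]; positivity)
    (by rw [map_mul, ← C.ac, C.re_mul hcb]; positivity)
    (C.gen₂ _ (hu.mul (hu.map _)) (by rw [map_mul, C.aa, mul_comm]) (by rw [map_mul, hb, hab]))
  obtain ⟨m, hm⟩ := C.exists_zpow_sq (τ := C.c) (x := u * C.a (C.c u)) C.bₜ
    C.unitₜ C.posₜ C.norm_cₜ
    (by rw [C.re_mul hb]; positivity)
    (by rw [map_mul, C.ac, C.cc, C.re_mul hcb]; positivity)
    (C.genₜ _ (hu.mul ((hu.map _).map _)) (by rw [map_mul, hb, hacb])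
      (by rw [map_mul, map_mul, C.aa, C.ac, C.cc, mul_comm]))
  have h2 := C.unit₂.1
  have hp := C.unitₚ.1
  have ht := C.unitₜ.1
  have hkb : C.b (C.eₚ ^ k) = C.eₚ ^ k := by rw [map_zpow₀, C.bₚ]
  have hlb : C.b (C.e₂ ^ l) = C.e₂ ^ l := by rw [map_zpow₀, C.b₂]
  have hmb : C.b (C.eₜ ^ m) = C.eₜ ^ m := by rw [map_zpow₀, C.bₜ]
  have hklb : C.b (C.eₚ ^ k * C.e₂ ^ l) = C.eₚ ^ k * C.e₂ ^ l := by rw [map_mul, hkb, hlb]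
  have hy : u = C.eₚ ^ k * C.e₂ ^ l * C.eₜ ^ m := by
    have hct : (C.c C.eₜ ^ m) ^ 2 * (C.eₜ ^ m) ^ 2 = 1 := by
      rw [← mul_pow, ← mul_zpow, mul_comm (C.c _), C.norm_cₜ, ← zpow_natCast, ← zpow_mul,
        mul_comm, zpow_mul]
      norm_num
    have h3 : C.c u * C.a u = (C.c C.eₜ ^ m) ^ 2 := by
      have := congrArg C.c hm
      rwa [map_mul, C.ac, C.cc, map_pow, map_zpow₀] at this
    have h4 : u ^ 2 = (C.eₚ ^ k * C.e₂ ^ l * C.eₜ ^ m) ^ 2 := by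
      have hne : C.c u * C.a u ≠ 0 := mul_ne_zero (hu.map C.c).1 (hu.map C.a).1
      apply mul_right_cancel₀ hne
      calc u ^ 2 * (C.c u * C.a u) = (u * C.c u) * (u * C.a u) := by ring
        _ = (C.eₚ ^ k) ^ 2 * (C.e₂ ^ l) ^ 2 := by rw [hk, hl]
        _ = _ := by
          rw [h3]
          linear_combination (-(C.eₚ ^ k) ^ 2 * (C.e₂ ^ l) ^ 2) * hct
    refine (sq_eq_sq_iff_eq_or_eq_neg.mp h4).resolve_right fun h => ?_
    rw [h, C.re_neg, C.re_mul hklb, C.re_mul hkb, C.re_zpow C.bₚ, C.re_zpow C.b₂,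
      C.re_zpow C.bₜ] at hpos
    have := C.pos₂
    have := C.posₚ
    have := C.posₜ
    have : 0 < (C.φ C.eₚ).re ^ k * (C.φ C.e₂).re ^ l * (C.φ C.eₜ).re ^ m := by positivity
    linarith
  have hlm : Even (l + m) := by
    refine C.even_of_re_pos (x := C.eₚ ^ k) hkb ?_
    have : (-1) ^ (l + m) * (C.eₚ ^ k) ^ 2 = u * C.c u := by
      rw [zpow_add₀ (neg_ne_zero.mpr one_ne_zero)]
      nth_rewrite 1 [← C.norm₂]
      rw [← C.norm_cₜ, hy, map_mul, map_mul, map_zpow₀, map_zpow₀, map_zpow₀, C.cₚ, mul_zpow,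
        mul_zpow]
      ring
    rw [this, C.re_mul hb]
    positivity
  have hkm : Even (k + m) := by
    refine C.even_of_re_pos (x := C.e₂ ^ l) hlb ?_
    have : (-1) ^ (k + m) * (C.e₂ ^ l) ^ 2 = u * C.a u := by
      rw [zpow_add₀ (neg_ne_zero.mpr one_ne_zero)]
      nth_rewrite 1 [← C.normₚ]
      rw [← C.norm_aₜ, hy, map_mul, map_mul, map_zpow₀, map_zpow₀, map_zpow₀, C.a₂, mul_zpow,
        mul_zpow]
      ring
    rw [this, C.re_mul hb]
    positivity
  obtain ⟨α, hα⟩ := hlm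
  obtain ⟨β, hβ⟩ := hkm
  refine ⟨C.η ^ m * C.eₚ ^ (β - m) * C.e₂ ^ (α - m), ?_, ?_, ?_⟩
  · simp only [map_mul, map_zpow₀, C.bη, C.bₚ, C.b₂]
  · exact ((C.unitη.zpow _).mul (C.unitₚ.zpow _)).mul (C.unit₂.zpow _)
  · have h1 : (C.η ^ m) ^ 2 = C.e₂ ^ m * C.eₚ ^ m * C.eₜ ^ m := by
      rw [← zpow_natCast, ← zpow_mul, mul_comm, zpow_mul, zpow_natCast, C.η2, mul_zpow, mul_zpow]
    have h2' : C.eₚ ^ k = C.eₚ ^ m * (C.eₚ ^ (β - m)) ^ 2 := by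
      rw [← zpow_natCast, ← zpow_mul, ← zpow_add₀ hp]; congr 1; push_cast; lia
    have h3' : C.e₂ ^ l = C.e₂ ^ m * (C.e₂ ^ (α - m)) ^ 2 := by
      rw [← zpow_natCast, ← zpow_mul, ← zpow_add₀ h2]; congr 1; push_cast; lia
    rw [mul_pow, mul_pow, h1, hy, h2', h3']
    ring

/-- The primitive eighth root of unity `(1 + i)/√2`. -/
noncomputable def ζ : K := (1 + C.i) / C.s

lemma ζ_sq : C.ζ ^ 2 = C.i := by
  have := C.charZero
  rw [ζ, div_pow, C.s2, div_eq_iff two_ne_zero]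
  linear_combination C.i2

lemma ζ_ne_zero : C.ζ ≠ 0 := by
  intro h
  have h1 := C.ζ_sq
  have h2 := C.i2
  rw [← h1, h] at h2
  norm_num at h2

lemma ζ4 : C.ζ ^ 4 = -1 := by
  rw [show 4 = 2 * 2 from rfl, pow_mul, C.ζ_sq, C.i2]

lemma aζ : C.a C.ζ = C.ζ := by simp [ζ, C.ai, C.as]

lemma cζ : C.c C.ζ = -C.ζ := by simp [ζ, C.ci, C.cs, div_neg]

lemma ζ_mul : C.ζ * C.b C.ζ = 1 := by
  have := C.charZero
  rw [ζ, map_div₀, map_add, map_one, C.bi, C.bs, div_mul_div_comm, ← sq, C.s2,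
    div_eq_iff two_ne_zero]
  linear_combination -C.i2

lemma bζ : C.b C.ζ = C.ζ⁻¹ := eq_inv_of_mul_eq_one_right C.ζ_mul

lemma ζ_add : C.ζ + C.b C.ζ = C.s := by
  have := C.s_ne_zero
  rw [ζ, map_div₀, map_add, map_one, C.bi, C.bs]
  field_simp
  linear_combination -C.s2

lemma isPrimitiveRoot_ζ : IsPrimitiveRoot C.ζ 8 := by
  rw [IsPrimitiveRoot.iff_orderOf]
  refine orderOf_eq_prime_pow (p := 2) (n := 2) ?_ ?_
  · show ¬C.ζ ^ 4 = 1
    rw [C.ζ4]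
    exact C.neg_one_ne_one
  · show C.ζ ^ (4 * 2) = 1
    rw [pow_mul, C.ζ4]
    norm_num

lemma unitζ : IsIntUnit C.ζ := .of_pow (n := 8) (by norm_num) (by
  rw [C.isPrimitiveRoot_ζ.pow_eq_one]; exact .one)

include C in
lemma d_mod : p₁ * p₂ % 8 = 1 := by rw [Nat.mul_mod, C.mod₁, C.mod₂]

/-- Integers of absolute value one in an imaginary quadratic field other than `ℚ(√-3)`. -/
lemma pow_four_eq_one {δ x : K} {D : ℕ} (hδ : δ ^ 2 = -D) (hδ0 : δ ≠ 0) (hD : ¬IsSquare (3 * D))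
    (hbδ : C.b δ = -δ) (hx : IsIntegral ℤ x) (hN : x * C.b x = 1)
    (hra : ∀ y, C.b y = y → (y = x + C.b x ∨ y = (x - C.b x) / δ) → C.a y = y ∧ C.c y = y) :
    x ^ 4 = 1 := by
  have := C.charZero
  have hb1 : C.b (x + C.b x) = x + C.b x := by rw [map_add, C.bb, add_comm]
  have hb2 : C.b ((x - C.b x) / δ) = (x - C.b x) / δ := by
    rw [map_div₀, map_sub, C.bb, hbδ, div_neg, ← neg_div, neg_sub]
  obtain ⟨q, hq⟩ := C.rat _ (hra _ hb1 (Or.inl rfl)).1 hb1 (hra _ hb1 (Or.inl rfl)).2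
  obtain ⟨q', hq'⟩ := C.rat _ (hra _ hb2 (Or.inr rfl)).1 hb2 (hra _ hb2 (Or.inr rfl)).2
  have hq'' : x - C.b x = q' * δ := by rw [hq', div_mul_cancel₀ _ hδ0]
  have hrel : q ^ 2 - 4 = -(D * q' ^ 2) := by
    have : ((q ^ 2 - 4 : ℚ) : K) = ((-(D * q' ^ 2) : ℚ) : K) := by
      push_cast
      rw [hq]
      linear_combination 4 * hN + (x - C.b x + q' * δ) * hq'' + q' ^ 2 * hδ
    exact_mod_cast this
  obtain ⟨n, rfl⟩ : ∃ n : ℤ, (n : ℚ) = q := by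
    have hi : IsIntegral ℤ ((q : ℚ) : K) := by
      rw [hq]; exact hx.add (isIntegral_map C.b hx)
    have : IsIntegral ℤ q := isIntegral_of_map (Rat.castHom K) hi
    obtain ⟨n, hn⟩ := IsIntegrallyClosed.isIntegral_iff.mp this
    exact ⟨n, by simpa using hn⟩
  have hn4 : n ^ 2 ≤ 4 := by
    have : (n : ℚ) ^ 2 ≤ 4 := by
      have : 0 ≤ (D : ℚ) * q' ^ 2 := by positivity
      linarith
    exact_mod_cast this
  have hx2 : x ^ 2 = n * x - 1 := by
    have : (n : K) = x + C.b x := by exact_mod_cast hq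
    rw [this]; linear_combination -hN
  have hn1 : n ^ 2 ≠ 1 := by
    intro h
    have h1 : (n : ℚ) ^ 2 = 1 := by exact_mod_cast h
    rw [h1] at hrel
    apply hD
    rw [← Rat.isSquare_natCast_iff]
    exact ⟨D * q', by push_cast; linear_combination (-D : ℚ) * hrel⟩
  have hn : n = 0 ∨ n = 2 ∨ n = -2 := by
    have : n ≤ 2 := by nlinarith
    have : -2 ≤ n := by nlinarith
    have h1 : n ≠ 1 := by rintro rfl; exact hn1 (by norm_num)
    have h2 : n ≠ -1 := by rintro rfl; exact hn1 (by norm_num)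
    lia
  rcases hn with rfl | rfl | rfl
  · push_cast at hx2
    linear_combination (x ^ 2 - 1) * hx2
  · push_cast at hx2
    have : (x - 1) ^ 2 = 0 := by linear_combination hx2
    have : x = 1 := sub_eq_zero.mp (pow_eq_zero_iff two_ne_zero |>.mp this)
    rw [this, one_pow]
  · push_cast at hx2
    have : (x + 1) ^ 2 = 0 := by linear_combination hx2
    have : x = -1 := eq_neg_of_add_eq_zero_left (pow_eq_zero_iff two_ne_zero |>.mp this)
    rw [this]; norm_num

lemma b_norm {x y : K} (hx : x * C.b x = 1) (hy : y * C.b y = 1) :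
    (x * y) * C.b (x * y) = 1 := by
  rw [map_mul, mul_mul_mul_comm, hx, hy, one_mul]

lemma i_ne_zero : C.i ≠ 0 := by
  intro h
  have := C.i2
  rw [h] at this
  norm_num at this

lemma t_ne_zero : C.t ≠ 0 := by
  have := C.charZero
  intro h
  have := C.t2
  rw [h] at this
  have h1 := C.prime₁.ne_zero
  have h2 := C.prime₂.ne_zero
  simp_all

lemma pow_eq_one_of_norm {u : K} (hu : IsIntUnit u) (hN : u * C.b u = 1) : u ^ 16 = 1 := by
  have := C.charZero
  have hmod := C.d_mod
  have h3 : ¬IsSquare (3 * 1) := by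
    rintro ⟨r, hr⟩
    have : r < 2 := by nlinarith
    interval_cases r <;> omega
  have h6 : ¬IsSquare (3 * 2) := by
    rintro ⟨r, hr⟩
    have : r < 3 := by nlinarith
    interval_cases r <;> omega
  have h3d : ¬IsSquare (3 * (p₁ * p₂)) := by
    rintro ⟨r, hr⟩
    have h1 : r * r % 8 = 3 := by rw [← hr]; omega
    have h2 : r % 8 < 8 := Nat.mod_lt _ (by norm_num)
    rw [Nat.mul_mod] at h1
    interval_cases r % 8 <;> omega
  have h6d : ¬IsSquare (3 * (2 * (p₁ * p₂))) := by
    rintro ⟨r, hr⟩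
    have h1 : r * r % 16 = 6 := by rw [← hr]; omega
    have h2 : r % 16 < 16 := Nat.mod_lt _ (by norm_num)
    rw [Nat.mul_mod] at h1
    interval_cases r % 16 <;> omega
  have hs := C.s_ne_zero
  have ht := C.t_ne_zero
  have hi := C.i_ne_zero
  have hcb : ∀ x, C.c (C.b x) = C.b (C.c x) := fun x => (C.bc x).symm
  have hca : ∀ x, C.c (C.a x) = C.a (C.c x) := fun x => (C.ac x).symm
  have hc : C.c u * C.b (C.c u) = 1 := by rw [C.bc, ← map_mul, hN, map_one]
  have hai : C.a u * C.b (C.a u) = 1 := by rw [← C.ab, ← map_mul, hN, map_one]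
  have hiu := hu.2.1
  have mk : ∀ x, IsIntegral ℤ x → x * C.b x = 1 →
      (C.a x = x → C.c x = x → x ^ 4 = 1) ∧
      (C.a x = x → C.c x = C.b x → x ^ 4 = 1) ∧
      (C.c x = x → C.a x = C.b x → x ^ 4 = 1) ∧
      (C.a x = C.b x → C.c x = C.b x → x ^ 4 = 1) := by
    intro x hx hN
    refine ⟨fun ha hc => ?_, fun ha hc => ?_, fun hc ha => ?_, fun ha hc => ?_⟩
    · refine C.pow_four_eq_one (δ := C.i) (D := 1) (by rw [C.i2]; simp) hi h3 C.bi hx hN ?_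
      rintro y hy (rfl | rfl) <;> simp [C.ab, ha, hcb, hc, C.ai, C.ci]
    · refine C.pow_four_eq_one (δ := C.s * C.i) (D := 2)
        (by rw [mul_pow, C.s2, C.i2]; push_cast; ring) (mul_ne_zero hs hi) h6
        (by simp [C.bs, C.bi]) hx hN ?_
      rintro y hy (rfl | rfl) <;>
        simp [C.ab, ha, hcb, hc, C.ai, C.ci, C.as, C.cs, C.bb, add_comm, div_neg, ← neg_div]
    · refine C.pow_four_eq_one (δ := C.t * C.i) (D := p₁ * p₂)
        (by rw [mul_pow, C.t2, C.i2]; push_cast; ring) (mul_ne_zero ht hi) h3d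
        (by simp [C.bt, C.bi]) hx hN ?_
      rintro y hy (rfl | rfl) <;>
        simp [C.ab, ha, hcb, hc, C.ai, C.ci, C.at', C.ct, C.bb, add_comm, div_neg, ← neg_div]
    · refine C.pow_four_eq_one (δ := C.t * (C.s * C.i)) (D := 2 * (p₁ * p₂))
        (by rw [mul_pow, mul_pow, C.t2, C.s2, C.i2]; push_cast; ring)
        (mul_ne_zero ht (mul_ne_zero hs hi)) h6d
        (by simp [C.bt, C.bs, C.bi]) hx hN ?_
      rintro y hy (rfl | rfl) <;>
        simp [C.ab, ha, hcb, hc, C.ai, C.ci, C.at', C.ct, C.as, C.cs, C.bb, add_comm, div_neg,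
          ← neg_div]
  have e8 : ∀ (τ : K →+* K) (x : K), x * C.b x = 1 → (x * τ x) ^ 4 = 1 →
      (x * τ (C.b x)) ^ 4 = 1 → x ^ 8 = 1 := by
    intro τ x hN h1 h2
    have h3 : τ x * τ (C.b x) = 1 := by rw [← map_mul, hN, map_one]
    calc x ^ 8 = x ^ 8 * (τ x * τ (C.b x)) ^ 4 := by rw [h3, one_pow, mul_one]
      _ = (x * τ x) ^ 4 * (x * τ (C.b x)) ^ 4 := by ring
      _ = 1 := by rw [h1, h2, one_mul]
  have I : ∀ {x}, IsIntegral ℤ x → ∀ (τ : K →+* K), IsIntegral ℤ (x * τ x) := fun hx τ =>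
    hx.mul (isIntegral_map τ hx)
  have I' : ∀ {x}, IsIntegral ℤ x → ∀ (τ : K →+* K), IsIntegral ℤ (x * τ (C.b x)) := fun hx τ =>
    hx.mul (isIntegral_map τ (isIntegral_map C.b hx))
  have hNτ : ∀ x, x * C.b x = 1 → ∀ τ : K →+* K, (∀ y, τ (C.b y) = C.b (τ y)) →
      (x * τ x) * C.b (x * τ x) = 1 ∧ (x * τ (C.b x)) * C.b (x * τ (C.b x)) = 1 := by
    intro x hx τ hτ
    refine ⟨C.b_norm hx (by rw [← hτ, ← map_mul, hx, map_one]), C.b_norm hx ?_⟩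
    rw [← hτ, ← map_mul, C.bb, mul_comm, hx, map_one]
  have ha8 : (u * C.a u) ^ 8 = 1 := by
    have hx := (hNτ u hN C.a C.ab).1
    have hi := I hiu C.a
    refine e8 C.c _ hx ((mk _ (I hi C.c) (hNτ _ hx C.c hcb).1).1 ?_ ?_)
      ((mk _ (I' hi C.c) (hNτ _ hx C.c hcb).2).2.1 ?_ ?_) <;>
      simp [C.aa, C.bb, C.cc, C.ab, C.bc, C.ac, mul_comm, mul_left_comm]
  have hc8 : (u * C.c u) ^ 8 = 1 := by
    have hx := (hNτ u hN C.c hcb).1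
    have hi := I hiu C.c
    refine e8 C.a _ hx ((mk _ (I hi C.a) (hNτ _ hx C.a C.ab).1).1 ?_ ?_)
      ((mk _ (I' hi C.a) (hNτ _ hx C.a C.ab).2).2.2.1 ?_ ?_) <;>
      simp [C.aa, C.bb, C.cc, C.ab, C.bc, C.ac, mul_comm, mul_left_comm]
  have hac8 : (u * C.a (C.c u)) ^ 8 = 1 := by
    have hx := (hNτ u hN (C.a.comp C.c) (by simp [C.ab, hcb])).1
    have hi := I hiu (C.a.comp C.c)
    refine e8 C.a _ hx ((mk _ (I hi C.a) (hNτ _ hx C.a C.ab).1).1 ?_ ?_)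
      ((mk _ (I' hi C.a) (hNτ _ hx C.a C.ab).2).2.2.2 ?_ ?_) <;>
      simp [C.aa, C.bb, C.cc, C.ab, C.bc, C.ac, mul_comm, mul_left_comm]
  have hac8' : (C.a u * C.c u) ^ 8 = 1 := by
    have := congrArg C.a hac8
    rwa [map_pow, map_mul, C.aa, map_one] at this
  calc u ^ 16 = u ^ 16 * (C.a u * C.c u) ^ 8 := by rw [hac8', mul_one]
    _ = (u * C.a u) ^ 8 * (u * C.c u) ^ 8 := by ring
    _ = 1 := by rw [ha8, hc8, one_mul]

lemma exists_eq_ζ_pow {u : K} (hu : IsIntUnit u) (hN : u * C.b u = 1) : ∃ j : ℕ, u = C.ζ ^ j := by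
  have h16 := C.pow_eq_one_of_norm hu hN
  have key : ∀ v : K, v ^ 2 = u ^ 4 → C.c v = -v → False := by
    intro v hv hc
    have h1 : C.c (u ^ 2) = -u ^ 2 := by
      have : (u ^ 2) ^ 2 = v ^ 2 := by rw [hv]; ring
      rcases sq_eq_sq_iff_eq_or_eq_neg.mp this with h | h <;> rw [h] <;> simp [hc]
    have h2 : (C.c u) ^ 2 = (C.i * u) ^ 2 := by
      rw [← map_pow, h1, mul_pow, C.i2]; ring
    have h3 : C.c (C.c u) = -u := by
      rcases sq_eq_sq_iff_eq_or_eq_neg.mp h2 with h | h <;> rw [h] <;> simp [C.ci, h] <;>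
        linear_combination u * C.i2
    rw [C.cc] at h3
    have := C.charZero
    exact hu.1 (self_eq_neg.mp h3)
  have h8 : u ^ 8 = 1 := by
    have h1 : (u ^ 8) ^ 2 = 1 ^ 2 := by rw [← pow_mul, one_pow]; exact h16
    refine (sq_eq_sq_iff_eq_or_eq_neg.mp h1).resolve_right fun h => ?_
    have h2 : (u ^ 4) ^ 2 = C.i ^ 2 := by rw [C.i2, ← h]; ring
    rcases sq_eq_sq_iff_eq_or_eq_neg.mp h2 with h | h
    · exact key C.ζ (by rw [C.ζ_sq, h]) C.cζ
    · refine key (C.i * C.ζ) ?_ ?_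
      · rw [mul_pow, C.ζ_sq, h, C.i2]; ring
      · simp [C.ci, C.cζ]
  obtain ⟨j, -, hj⟩ := C.isPrimitiveRoot_ζ.eq_pow_of_pow_eq_one h8
  exact ⟨j, hj.symm⟩

end Octic

namespace Octic

variable {p₁ p₂ : ℕ} {K : Type*} [Field K] (C : Octic p₁ p₂ K)

lemma one_sub_mul : (1 - C.ζ) * C.b (1 - C.ζ) = 2 - C.s := by
  rw [map_sub, map_one, ← C.ζ_add]
  linear_combination C.ζ_mul

lemma norm_one_add : (1 + C.ζ) * C.b (1 + C.ζ) = 2 + C.s := by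
  rw [map_add, map_one, ← C.ζ_add]
  linear_combination C.ζ_mul

/-- The Hasse unit index of `K` is one. -/
lemma exists_eq_ζ_pow_mul {u : K} (hu : IsIntUnit u) :
    ∃ (j : ℕ) (w : K), C.b w = w ∧ IsIntUnit w ∧ u = C.ζ ^ j * w := by
  have := C.charZero
  have hz := C.ζ_ne_zero
  have hz' := C.ζ_mul
  have hbu := (hu.map C.b).1
  obtain ⟨j, hj⟩ := C.exists_eq_ζ_pow (u := u / C.b u) (hu.div (hu.map _)) (by
    rw [map_div₀, C.bb]; field_simp [hu.1])
  rw [div_eq_iff hbu] at hj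
  obtain ⟨l, rfl | rfl⟩ := Nat.even_or_odd' j
  · refine ⟨l, u / C.ζ ^ l, ?_, hu.div (C.unitζ.pow _), by field_simp⟩
    rw [map_div₀, map_pow, C.bζ, inv_pow, div_inv_eq_mul, eq_div_iff (pow_ne_zero _ hz)]
    nth_rewrite 2 [hj]
    ring
  · exfalso
    set v := u / C.ζ ^ l with hv
    have hvu : IsIntUnit v := hu.div (C.unitζ.pow _)
    have hbv : v = C.ζ * C.b v := by
      rw [hv, map_div₀, map_pow, C.bζ, inv_pow, div_inv_eq_mul, div_eq_iff (pow_ne_zero _ hz)]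
      nth_rewrite 1 [hj]
      ring
    obtain ⟨w, hw, hwu, hvw⟩ := C.exists_eq_sq (hvu.mul (hvu.map C.b)) rfl
    have h1 : (1 + C.ζ) ≠ 0 := by
      intro h
      have h2 := C.ζ4
      rw [show C.ζ = -1 by linear_combination h] at h2
      norm_num at h2
    have h1b : 1 + C.b C.ζ ≠ 0 := by
      have := (map_ne_zero C.b).mpr h1
      rwa [map_add, map_one] at this
    set r := v / (1 + C.ζ) with hr
    have hbr : C.b r = r := by
      rw [hr, map_div₀, map_add, map_one, div_eq_div_iff h1b h1]
      linear_combination (-1 - C.b C.ζ) * hbv - C.b v * hz'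
    have hvr : v = r * (1 + C.ζ) := by rw [hr, div_mul_cancel₀ _ h1]
    have hr0 : r ≠ 0 := div_ne_zero hvu.1 h1
    have h2 : r ^ 2 * (2 + C.s) = w ^ 2 := by
      rw [← hvw, ← C.norm_one_add, hvr, map_mul, hbr]
      ring
    have h3 : r ^ 2 * (2 + C.s) * C.c (r ^ 2 * (2 + C.s)) = w ^ 2 * C.c (w ^ 2) := by rw [h2]
    have h4 : (C.s * (r * C.c r)) ^ 2 = (w * C.c w) ^ 2 := by
      rw [mul_pow, C.s2]
      simp only [map_mul, map_pow, map_add, C.cs, map_ofNat] at h3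
      linear_combination h3 + (r * C.c r) ^ 2 * C.s2
    have hcr : C.c r ≠ 0 := (map_ne_zero _).mpr hr0
    have h5 : C.c (C.s * (r * C.c r)) = C.s * (r * C.c r) := by
      rcases sq_eq_sq_iff_eq_or_eq_neg.mp h4 with h | h <;> rw [h] <;> simp [C.cc, mul_comm]
    rw [map_mul, map_mul, C.cc, C.cs, mul_comm (C.c r), neg_mul] at h5
    exact mul_ne_zero C.s_ne_zero (mul_ne_zero hr0 hcr) (self_eq_neg.mp h5.symm)

/-- The units of `ℚ(√2, √(-p₁p₂))`. -/
lemma exists_eq_e₂_zpow {u : K} (hu : IsIntUnit u) (hab : C.a (C.b u) = u) :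
    ∃ k : ℤ, u = C.e₂ ^ k ∨ u = -C.e₂ ^ k := by
  have := C.charZero
  have hz := C.ζ_ne_zero
  obtain ⟨j, w, hbw, hw, rfl⟩ := C.exists_eq_ζ_pow_mul hu
  have haw : C.a w = C.ζ ^ (2 * j) * w := by
    rw [map_mul, map_mul, map_pow, map_pow, hbw, C.bζ, map_inv₀, C.aζ, inv_pow,
      inv_mul_eq_iff_eq_mul₀ (pow_ne_zero _ hz)] at hab
    rw [hab]; ring
  have hj : C.ζ ^ (4 * j) = 1 := by
    have h1 : C.b (C.a w) = C.a w := by rw [← C.ab, hbw]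
    rw [haw, map_mul, hbw, map_pow, C.bζ, inv_pow, mul_left_inj' hw.1,
      inv_eq_iff_eq_inv] at h1
    rw [show 4 * j = 2 * j + 2 * j by ring, pow_add]
    nth_rewrite 1 [h1]
    exact inv_mul_cancel₀ (pow_ne_zero _ hz)
  have hj4 : C.ζ ^ (2 * j) = 1 ∨ C.ζ ^ (2 * j) = -1 := by
    have h1 : (C.ζ ^ (2 * j)) ^ 2 = 1 ^ 2 := by
      rw [← pow_mul, one_pow, ← hj]; ring_nf
    exact sq_eq_sq_iff_eq_or_eq_neg.mp h1
  rcases hj4 with h | h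
  · rw [h, one_mul] at haw
    have h1 : C.ζ ^ j = 1 ∨ C.ζ ^ j = -1 := by
      have h1 : (C.ζ ^ j) ^ 2 = 1 ^ 2 := by
        rw [← pow_mul, one_pow, ← h]; ring_nf
      exact sq_eq_sq_iff_eq_or_eq_neg.mp h1
    obtain ⟨k, hk⟩ := C.gen₂ w hw haw hbw
    refine ⟨k, ?_⟩
    rcases h1 with h1 | h1 <;> rcases hk with hk | hk <;> rw [h1, hk] <;> simp
  · exfalso
    rw [h, neg_one_mul] at haw
    obtain ⟨k, hk⟩ := C.gen₂ (w ^ 2) (hw.pow 2) (by rw [map_pow, haw]; ring) (by rw [map_pow, hbw])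
    have hpos : 0 < (C.φ (w ^ 2)).re := by
      have := C.re_ne_zero hbw hw.1
      rw [C.re_pow hbw]
      positivity
    have hkpos : 0 < (C.φ (C.e₂ ^ k)).re := by
      have := C.pos₂
      rw [C.re_zpow C.b₂]
      positivity
    have hk : w ^ 2 = C.e₂ ^ k := hk.resolve_right fun hk => by
      rw [hk, C.re_neg] at hpos
      linarith
    have hbcw : C.b (C.c w) = C.c w := by rw [C.bc, hbw]
    obtain ⟨l, rfl | rfl⟩ := Int.even_or_odd' k
    · have h1 : w ^ 2 = (C.e₂ ^ l) ^ 2 := by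
        rw [hk, ← zpow_natCast, ← zpow_mul, mul_comm]; norm_num
      have h2 : C.a w = w := by
        rcases sq_eq_sq_iff_eq_or_eq_neg.mp h1 with h | h <;> rw [h] <;> simp [C.a₂]
      rw [h2] at haw
      exact hw.1 (self_eq_neg.mp haw)
    · refine C.sq_ne_neg_sq (x := w * C.c w) (y := 1) (by rw [map_mul, hbw, hbcw]) (map_one _)
        one_ne_zero ?_
      rw [mul_pow, ← map_pow, hk, map_zpow₀, ← mul_zpow, C.norm₂, zpow_add₀ (by norm_num), zpow_mul]
      norm_num

lemma norm_pow_zpow {e : K} {τ : K →+* K} (h : e * τ e = -1) {k : ℤ} (hk : e ^ k * τ (e ^ k) = 1)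
    (h1 : (-1 : K) ≠ 1) : ∃ l : ℤ, e ^ k = (e ^ l) ^ 2 := by
  rw [map_zpow₀, ← mul_zpow, h] at hk
  obtain ⟨l, rfl⟩ := even_of_neg_one_zpow h1 hk
  have he : e ≠ 0 := by
    rintro rfl
    simp at h
  exact ⟨l, by rw [zpow_add₀ he, sq]⟩

section Norms

/-- `±e ^ k` is a norm when `-1` and `e` are, up to sign. -/
lemma exists_norm_of_zpow {R : Subfield K} {τ : K →+* K} {e f g : K} (hf : f ∈ R) (hg : g ∈ R)
    (hfu : IsIntUnit f) (hgu : IsIntUnit g) (hf1 : f * τ f = -1) (hg1 : g * τ g = e ∨ g * τ g = -e)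
    {u : K} {k : ℤ} (hu : u = e ^ k ∨ u = -e ^ k) :
    ∃ v ∈ R, IsIntUnit v ∧ u = v * τ v := by
  have hneg : ∀ u, (∃ v ∈ R, IsIntUnit v ∧ u = v * τ v) → ∃ v ∈ R, IsIntUnit v ∧ -u = v * τ v := by
    rintro _ ⟨v, hv, hvu, rfl⟩
    exact ⟨v * f, mul_mem hv hf, hvu.mul hfu, by
      rw [map_mul]; linear_combination (-v * τ v) * hf1⟩
  have h0 : ∃ v ∈ R, IsIntUnit v ∧ e = v * τ v := by
    rcases hg1 with h | h
    · exact ⟨g, hg, hgu, h.symm⟩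
    · rw [← neg_neg e]
      exact hneg _ ⟨g, hg, hgu, h.symm⟩
  have h1 : ∃ v ∈ R, IsIntUnit v ∧ e ^ k = v * τ v := by
    obtain ⟨v, hv, hvu, hve⟩ := h0
    exact ⟨v ^ k, zpow_mem hv k, hvu.zpow k, by rw [hve, map_zpow₀, mul_zpow]⟩
  rcases hu with rfl | rfl
  · exact h1
  · exact hneg _ h1

end Norms

lemma one_sub_ζ_ne_zero : 1 - C.ζ ≠ 0 := by
  have := C.charZero
  intro h
  have h2 := C.ζ4
  rw [show C.ζ = 1 by linear_combination -h] at h2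
  norm_num at h2

lemma one_sub_ζ_conj : C.ζ ^ 5 * C.b (1 - C.ζ) = 1 - C.ζ := by
  rw [map_sub, map_one]
  linear_combination (C.ζ - 1) * C.ζ4 - C.ζ ^ 4 * C.ζ_mul

/-- Hilbert 90 for the units of `K` over `ℚ(√2, √(-p₁p₂))`, up to the prime above two. -/
lemma unit_hilbert90_ab {u : K} (hu : IsIntUnit u) (hN : u * C.a (C.b u) = 1) :
    ∃ v, IsIntUnit v ∧ (u * C.a (C.b v) = v ∨
      u * C.a (C.b (v * (1 - C.ζ))) = v * (1 - C.ζ)) := by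
  have hz := C.ζ_ne_zero
  have hz8 : C.ζ ^ 8 = 1 := C.isPrimitiveRoot_ζ.pow_eq_one
  obtain ⟨j, w, hbw, hw, rfl⟩ := C.exists_eq_ζ_pow_mul hu
  have hNw : w * C.a w = 1 := by
    rw [← hN, map_mul, map_mul, map_pow, map_pow, hbw, C.bζ, map_inv₀, C.aζ, inv_pow]
    field_simp
  obtain ⟨y, hby, hy, hyw⟩ := cob_a hw hbw hNw
  obtain ⟨k, hk⟩ : ∃ k : ℕ, C.ζ ^ j * (w * C.a y) = C.ζ ^ k * y := by
    rcases hyw with h | h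
    · exact ⟨j, by rw [h]⟩
    · exact ⟨j + 4, by rw [h, pow_add, C.ζ4]; ring⟩
  have hve : ∀ e : ℕ, C.a (C.b (y * C.ζ ^ e)) = C.a y * (C.ζ ^ e)⁻¹ := by
    intro e
    rw [map_mul, map_mul, hby, map_pow, map_pow, C.bζ, map_inv₀, C.aζ, inv_pow]
  obtain ⟨e, he | he⟩ := Nat.even_or_odd' k
  · refine ⟨y * C.ζ ^ e, hy.mul (C.unitζ.pow _), Or.inl ?_⟩
    rw [hve, ← mul_assoc, mul_assoc _ w, hk, he, two_mul, pow_add]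
    field_simp
  · refine ⟨y * C.ζ ^ (e + 2), hy.mul (C.unitζ.pow _), Or.inr ?_⟩
    rw [map_mul, map_mul, hve]
    have h1 : C.a (C.b (1 - C.ζ)) = C.b (1 - C.ζ) := by
      rw [C.ab, map_sub, map_one, C.aζ]
    have h3 := C.one_sub_ζ_conj
    rw [h1]
    generalize C.b (1 - C.ζ) = B at *
    have h4 : C.ζ ^ (2 * e + 1) = C.ζ ^ (e + 2) * C.ζ ^ (e + 2) * C.ζ ^ 5 := by
      rw [← one_mul (C.ζ ^ (2 * e + 1)), ← hz8]
      ring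
    rw [← h3, ← mul_assoc, ← mul_assoc, mul_assoc _ w, hk, he, h4]
    field_simp

end Octic

lemma eq_span_of_mem_of_prime_absNorm {L : Type*} [Field L] [NumberField L] {P : Ideal (𝓞 L)}
    (hP : P.IsPrime) {x : 𝓞 L} (hx : x ∈ P) (h : (Ideal.absNorm (Ideal.span {x})).Prime) :
    P = Ideal.span {x} := by
  have h1 := Ideal.isPrime_of_irreducible_absNorm h
  have hx0 : x ≠ 0 := by
    rintro rfl
    rw [Ideal.span_singleton_zero, Ideal.absNorm_bot] at h
    exact Nat.not_prime_zero h
  have h2 := h1.isMaximal (span_ne_zero hx0)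
  exact (h2.eq_of_le hP.ne_top ((Ideal.span_singleton_le_iff_mem _).mpr hx)).symm

lemma twoPart_classGroup_rat : twoPart (ClassGroup (𝓞 ℚ)) = ⊥ := by
  have := Rat.classNumber_eq
  rw [classNumber, Fintype.card_eq_one_iff] at this
  obtain ⟨x, hx⟩ := this
  rw [Subgroup.eq_bot_iff_forall]
  intro y _
  rw [hx y, hx 1]

lemma coe_two_rat : ((2 : 𝓞 ℚ) : ℚ) = 2 := map_ofNat (algebraMap (𝓞 ℚ) ℚ) 2

lemma coe_neg_two_rat : ((-2 : 𝓞 ℚ) : ℚ) = -2 := by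
  rw [← coe_two_rat]
  exact map_neg (algebraMap (𝓞 ℚ) ℚ) 2

lemma absNorm_span_two_rat {y : 𝓞 ℚ} (h : y = 2 ∨ y = -2) : Ideal.absNorm (Ideal.span {y}) = 2 := by
  have : (Ideal.absNorm (Ideal.span {y}) : ℚ) = 2 := by
    rw [absNorm_span_rat]
    rcases h with rfl | rfl
    · rw [coe_two_rat, abs_two]
    · rw [coe_neg_two_rat, abs_neg, abs_two]
  exact_mod_cast this

lemma isIntegral_two {K : Type*} [Field K] : IsIntegral ℤ (2 : K) := by
  simpa using isIntegral_algebraMap (R := ℤ) (A := K) (x := 2)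

namespace Octic

variable {p₁ p₂ : ℕ} {K : Type*} [Field K] (C : Octic p₁ p₂ K)

lemma integral_s : IsIntegral ℤ C.s := by
  apply IsIntegral.of_pow two_pos
  rw [C.s2]
  simpa using isIntegral_algebraMap (R := ℤ) (A := K) (x := 2)

lemma integral_i : IsIntegral ℤ C.i := by
  apply IsIntegral.of_pow two_pos
  rw [C.i2]
  simpa using isIntegral_algebraMap (R := ℤ) (A := K) (x := -1)

lemma integral_t : IsIntegral ℤ C.t := by
  apply IsIntegral.of_pow two_pos
  rw [C.t2]
  simpa using isIntegral_algebraMap (R := ℤ) (A := K) (x := p₁ * p₂)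

lemma integral_ζ : IsIntegral ℤ C.ζ := C.unitζ.2.1

section Embeddings

variable [NumberField K]

lemma rat_range {x : K} : x ∈ (Rat.castHom K).range ↔ C.a x = x ∧ C.b x = x ∧ C.c x = x := by
  constructor
  · rintro ⟨q, rfl⟩
    simp
  · rintro ⟨ha, hb, hc⟩
    exact C.rat x ha hb hc

variable {Q2 : Type*} [Field Q2] [NumberField Q2] {ι₂ : Q2 →+* K}
  (h₂ : ∀ x, x ∈ ι₂.range ↔ C.a x = x ∧ C.b x = x)

include h₂ in
lemma exists_rel_rat_Q2 : ∃ f g, QuadRel (Rat.castHom K) ι₂ C.c f g := by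
  refine exists_quadRel _ _ _ (fun x => ?_) C.cc (fun x => ?_) ⟨C.s, ?_, fun h => ?_⟩
  · rw [C.rat_range, h₂, and_assoc]
  · simp only [h₂]
    rintro ⟨h1, h2⟩
    exact ⟨by rw [C.ac, h1], by rw [C.bc, h2]⟩
  · exact (h₂ _).mpr ⟨C.as, C.bs⟩
  · rw [C.cs] at h
    exact C.s_ne_zero (self_eq_neg.mp h.symm)

include h₂ in
lemma absNorm_Q2 {x : 𝓞 Q2} {y : 𝓞 ℚ} (h : intHom ι₂ x * C.c (intHom ι₂ x) = Rat.castHom K y) :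
    Ideal.absNorm (Ideal.span {x}) = Ideal.absNorm (Ideal.span {y}) := by
  obtain ⟨f, g, hfg⟩ := C.exists_rel_rat_Q2 h₂
  exact hfg.quad.absNorm_span (intHom_injective ι₂ (by
    rw [map_mul, hfg.int_base, hfg.int_conj, h]
    rfl))

include h₂ in
lemma twoPart_Q2 : twoPart (ClassGroup (𝓞 Q2)) = ⊥ := by
  obtain ⟨f, g, hfg⟩ := C.exists_rel_rat_Q2 h₂
  refine hfg.quad.twoPart_eq_bot (hfg.unit_norm fun u hu huu x hx hxu => ?_)
    twoPart_classGroup_rat fun P hP hP0 hram => ?_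
  · obtain ⟨ha, hb, hc⟩ := C.rat_range.mp hu
    rcases C.rat_unit huu ha hb hc with rfl | rfl
    · exact ⟨1, one_mem _, .one, by simp⟩
    · exact ⟨C.e₂, (h₂ _).mpr ⟨C.a₂, C.b₂⟩, C.unit₂, C.norm₂.symm⟩
  · obtain ⟨s, hs⟩ := exists_intHom_eq ι₂ ((h₂ _).mpr ⟨C.as, C.bs⟩) C.integral_s
    have hs0 : s ≠ 0 := by
      rintro rfl
      exact C.s_ne_zero (by rw [← hs, map_zero])
    have h1 : s - RingOfIntegers.mapRingHom g s = s ^ 3 := intHom_injective ι₂ (by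
      rw [map_sub, hfg.int_conj, map_pow, hs, C.cs]
      linear_combination (-C.s) * C.s2)
    have h2 : s ∈ P := hP.mem_of_pow_mem 3 (h1 ▸ hram s)
    rw [eq_span_of_mem_of_prime_absNorm hP h2 ?_, idealClass_span hs0]
    rw [C.absNorm_Q2 h₂ (y := -2) ?_,
      absNorm_span_two_rat (Or.inr rfl)]
    · exact Nat.prime_two
    · rw [hs, C.cs, coe_neg_two_rat, map_neg, map_ofNat]
      linear_combination -C.s2

variable {k : Type*} [Field k] [NumberField k] {ιk : k →+* K} (hk : ∀ x, x ∈ ιk.range ↔ C.a x = x)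

include h₂ hk in
lemma exists_rel_Q2_k : ∃ f g, QuadRel ι₂ ιk C.b f g := by
  refine exists_quadRel _ _ _ (fun x => ?_) C.bb (fun x => ?_) ⟨C.i, ?_, fun h => ?_⟩
  · rw [hk, h₂]
  · simp only [hk]
    intro h1
    rw [C.ab, h1]
  · exact (hk _).mpr C.ai
  · rw [C.bi] at h
    have := C.charZero
    exact C.i_ne_zero (self_eq_neg.mp h.symm)

include h₂ hk in
lemma absNorm_one_sub_ζ_k {z : 𝓞 k} (hz : intHom ιk z = C.ζ) :
    Ideal.absNorm (Ideal.span {1 - z}) = 2 := by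
  obtain ⟨f, g, hfg⟩ := C.exists_rel_Q2_k h₂ hk
  obtain ⟨y, hy⟩ := exists_intHom_eq ι₂ (x := 2 - C.s) ((h₂ _).mpr
    ⟨by rw [map_sub, C.as, map_ofNat], by rw [map_sub, C.bs, map_ofNat]⟩)
    (isIntegral_two.sub C.integral_s)
  rw [hfg.quad.absNorm_span (y := y), C.absNorm_Q2 h₂ (y := 2), absNorm_span_two_rat (Or.inl rfl)]
  · rw [hy, map_sub, C.cs, map_ofNat, coe_two_rat, map_ofNat]
    linear_combination -C.s2
  · apply intHom_injective ιk
    rw [hfg.int_base, map_mul, hfg.int_conj, hy, map_sub, map_one, hz, C.one_sub_mul]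

lemma one_sub_ζ_sq : (1 - C.ζ) ^ 2 = (C.ζ - C.b C.ζ) *
    (-C.ζ * (1 - C.ζ + C.ζ ^ 2 - C.ζ ^ 3 + C.ζ ^ 4)) := by
  linear_combination (1 - C.ζ + C.ζ ^ 2 - C.ζ ^ 3 + C.ζ ^ 4) * -C.ζ_mul +
    (C.ζ ^ 2 - C.ζ) * C.ζ4

include h₂ hk in
lemma twoPart_k : twoPart (ClassGroup (𝓞 k)) = ⊥ := by
  obtain ⟨f, g, hfg⟩ := C.exists_rel_Q2_k h₂ hk
  refine hfg.quad.twoPart_eq_bot (hfg.unit_norm fun u hu huu x hx hxu => ?_)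
    (C.twoPart_Q2 h₂) fun P hP hP0 hram => ?_
  · obtain ⟨ha, hb⟩ := (h₂ _).mp hu
    have hx0 : x ≠ 0 := fun h => huu.1 (by rw [hxu, h, zero_mul])
    have hpos : 0 < (C.φ u).re := by rw [hxu]; exact C.re_norm_pos hx0
    have hpos' : 0 < (C.φ (C.c u)).re := by
      rw [hxu, map_mul, ← C.bc]; exact C.re_norm_pos ((map_ne_zero C.c).mpr hx0)
    obtain ⟨l, hl⟩ := C.exists_zpow_sq C.b₂ C.unit₂ C.pos₂ C.norm₂ hpos hpos' (C.gen₂ u huu ha hb)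
    refine ⟨C.e₂ ^ l, (hk _).mpr (by rw [map_zpow₀, C.a₂]), C.unit₂.zpow _, ?_⟩
    rw [hl, map_zpow₀, C.b₂, sq]
  · obtain ⟨z, hz⟩ := exists_intHom_eq ιk ((hk _).mpr C.aζ) C.integral_ζ
    have hz0 : 1 - z ≠ 0 := by
      intro h
      apply C.one_sub_ζ_ne_zero
      rw [← hz, ← map_one (intHom ιk), ← map_sub, h, map_zero]
    have h1 : (1 - z) ^ 2 =
        (z - RingOfIntegers.mapRingHom g z) * (-z * (1 - z + z ^ 2 - z ^ 3 + z ^ 4)) :=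
      intHom_injective ιk (by
        simp only [map_sub, map_mul, map_add, map_neg, map_pow, hfg.int_conj, hz, map_one]
        exact C.one_sub_ζ_sq)
    have h2 : 1 - z ∈ P := hP.mem_of_pow_mem 2 (h1 ▸ P.mul_mem_right _ (hram z))
    rw [eq_span_of_mem_of_prime_absNorm hP h2 ?_, idealClass_span hz0]
    rw [C.absNorm_one_sub_ζ_k h₂ hk hz]
    exact Nat.prime_two

end Embeddings

end Octic

namespace QuadExt

variable {F L : Type*} [Field F] [Field L] [NumberField F] [NumberField L]
  {f : F →+* L} {g : L →+* L}

local notation "G" => RingOfIntegers.mapRingHom g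
local notation "Φ" => RingOfIntegers.mapRingHom f

section Split

variable {I : Ideal (𝓞 F)} {e : 𝓞 L}

lemma extIdeal_sup_span : extIdeal g (extIdeal f I ⊔ Ideal.span {e}) =
    extIdeal g (extIdeal f I) ⊔ Ideal.span {G e} := by
  rw [extIdeal, Ideal.map_sup, ← extIdeal, ← extIdeal, extIdeal_span]

lemma split_mul (h : QuadExt f g) (he : e * G e ∈ extIdeal f I)
    (hc : ∃ y ∈ extIdeal f I, ∃ z, y + z * (e + G e) = 1) :
    (extIdeal f I ⊔ Ideal.span {e}) * extIdeal g (extIdeal f I ⊔ Ideal.span {e}) =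
      extIdeal f I := by
  rw [extIdeal_sup_span, h.ext_base]
  apply le_antisymm
  · rw [Ideal.sup_mul, Ideal.mul_sup]
    exact sup_le (sup_le Ideal.mul_le_left Ideal.mul_le_left) <|
      (Ideal.mul_sup _ _ _).le.trans <| sup_le Ideal.mul_le_right <| by
        rwa [Ideal.span_singleton_mul_span_singleton, Ideal.span_singleton_le_iff_mem]
  · rw [Ideal.mul_eq_inf_of_coprime]
    · exact le_inf le_sup_left le_sup_left
    · obtain ⟨y, hy, z, hz⟩ := hc
      rw [Ideal.eq_top_iff_one, ← hz, mul_add]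
      refine add_mem (Ideal.mem_sup_left (Ideal.mem_sup_left hy)) (add_mem ?_ ?_)
      · exact Ideal.mem_sup_left (Ideal.mem_sup_right
          (Ideal.mul_mem_left _ _ (Ideal.mem_span_singleton_self e)))
      · exact Ideal.mem_sup_right (Ideal.mem_sup_right
          (Ideal.mul_mem_left _ _ (Ideal.mem_span_singleton_self (G e))))

lemma absNorm_split (h : QuadExt f g) (he : e * G e ∈ extIdeal f I)
    (hc : ∃ y ∈ extIdeal f I, ∃ z, y + z * (e + G e) = 1) :
    Ideal.absNorm (extIdeal f I ⊔ Ideal.span {e}) = Ideal.absNorm I := by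
  have h1 := congrArg Ideal.absNorm (h.split_mul he hc)
  rw [map_mul, h.absNorm_conj, h.absNorm_extIdeal, ← sq] at h1
  exact (pow_left_inj₀ (zero_le) (zero_le) two_ne_zero).mp h1

end Split

/-- An element of norm 4 which is fixed by an automorphism swapping the two primes above 2 does
not generate the extension of an ideal of the base. -/
lemma extIdeal_ne_span (h : QuadExt f g) {ρ : 𝓞 L} (hρ : Ideal.absNorm (Ideal.span {ρ}) = 4)
    {w w' : 𝓞 F} (hw : w * (w - 1) = 2 * w') {τ : L →+* L}
    (hτ : RingOfIntegers.mapRingHom τ ρ = ρ)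
    (hτw : RingOfIntegers.mapRingHom τ (Φ w) = 1 - Φ w) (J : Ideal (𝓞 F)) :
    extIdeal f J ≠ Ideal.span {ρ} := by
  intro hJ
  have hN : Ideal.absNorm J = 2 := by
    have := h.absNorm_extIdeal J
    rw [hJ, hρ] at this
    exact (pow_left_inj₀ (zero_le) (zero_le) two_ne_zero).mp this.symm
  have hP : J.IsPrime := Ideal.isPrime_of_irreducible_absNorm (hN ▸ Nat.prime_two)
  have h2 : (2 : 𝓞 F) ∈ J := by
    have := Ideal.absNorm_mem J
    rwa [hN, Nat.cast_ofNat] at this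
  have key : ∀ x, x = Φ w ∨ x = Φ w - 1 → x ∉ Ideal.span {ρ} := by
    intro x hx hmem
    obtain ⟨y, rfl⟩ := Ideal.mem_span_singleton.mp hmem
    have h1 : RingOfIntegers.mapRingHom τ (ρ * y) = ρ * RingOfIntegers.mapRingHom τ y := by
      rw [map_mul, hτ]
    have : ρ ∣ 1 := by
      rcases hx with hx | hx
      · rw [hx, hτw, ← hx] at h1
        exact ⟨RingOfIntegers.mapRingHom τ y + y, by linear_combination h1⟩
      · rw [hx, map_sub, hτw, map_one] at h1
        exact ⟨-(RingOfIntegers.mapRingHom τ y + y), by linear_combination -h1 + hx⟩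
    rw [Ideal.span_singleton_eq_top.mpr (isUnit_of_dvd_one this), Ideal.absNorm_top] at hρ
    omega
  rcases hP.mem_or_mem (hw ▸ J.mul_mem_right w' h2) with h3 | h3
  · exact key _ (Or.inl rfl) (hJ ▸ mem_extIdeal f h3)
  · exact key _ (Or.inr rfl) (hJ ▸ by simpa using mem_extIdeal f h3)

end QuadExt

section Groups

variable {H : Type*} [CommGroup H] [Finite H]

/-- A subgroup of index two in a cyclic 2-group. -/
lemma orderOf_of_sq_mem {u : H} (hu : u ∈ twoPart H) {T : Subgroup H}
    (hT : T ≤ Subgroup.zpowers u) (huT : u ∉ T) (hu2 : u ^ 2 ∈ T) {n : ℕ}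
    (hcard : Nat.card T = 2 ^ n) : T = Subgroup.zpowers (u ^ 2) ∧ orderOf u = 2 ^ (n + 1) := by
  have hTu : T = Subgroup.zpowers (u ^ 2) := by
    refine le_antisymm (fun x hx => ?_) (Subgroup.zpowers_le.mpr hu2)
    obtain ⟨k, rfl⟩ := Subgroup.mem_zpowers_iff.mp (hT hx)
    rcases Int.even_or_odd' k with ⟨l, rfl | rfl⟩
    · exact ⟨l, by simp only; rw [← zpow_natCast, ← zpow_mul]; rfl⟩
    · refine absurd ?_ huT
      have h1 : (u ^ 2) ^ l ∈ T := zpow_mem hu2 l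
      have : u = ((u ^ 2) ^ l)⁻¹ * u ^ (2 * l + 1) := by
        rw [← zpow_natCast, ← zpow_mul, zpow_add, zpow_one]
        simp
      rw [this]
      exact mul_mem (inv_mem h1) hx
  refine ⟨hTu, ?_⟩
  rw [hTu, Nat.card_zpowers, orderOf_pow] at hcard
  obtain ⟨k, hk⟩ := (mem_twoPart).mp hu
  obtain ⟨j, -, hj⟩ := (Nat.dvd_prime_pow Nat.prime_two).mp (orderOf_dvd_of_pow_eq_one hk)
  rw [hj] at hcard ⊢
  rcases j with _ | j
  · rw [pow_zero, orderOf_eq_one_iff] at hj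
    exact absurd (hj ▸ one_mem T) huT
  · rw [pow_succ, Nat.gcd_mul_left_left, Nat.mul_div_cancel _ two_pos] at hcard
    rw [pow_succ, hcard, pow_succ]

end Groups

section PrimeIdeals

variable {F L : Type*} [Field F] [Field L] [NumberField F] [NumberField L]

lemma absNorm_span_natCast_rat (p : ℕ) : Ideal.absNorm (Ideal.span {(p : 𝓞 ℚ)}) = p := by
  have h : (Ideal.absNorm (Ideal.span {(p : 𝓞 ℚ)}) : ℚ) = p := by
    rw [absNorm_span_rat, show ((p : 𝓞 ℚ) : ℚ) = p from map_natCast (algebraMap (𝓞 ℚ) ℚ) p,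
      Nat.abs_cast]
  exact_mod_cast h

lemma QuadExt.absNorm_span_natCast {f : F →+* L} {g : L →+* L} (h : QuadExt f g) {p k : ℕ}
    (hF : Ideal.absNorm (Ideal.span {(p : 𝓞 F)}) = p ^ k) :
    Ideal.absNorm (Ideal.span {(p : 𝓞 L)}) = p ^ (2 * k) := by
  have := h.absNorm_extIdeal (Ideal.span {(p : 𝓞 F)})
  rw [extIdeal_span, map_natCast, hF, ← pow_mul, mul_comm k] at this
  exact this

/-- A prime modulo which 2 is not a square is not the norm of a prime ideal of a field
containing a square root of 2. -/
lemma absNorm_ne_of_sqrt_two {s : 𝓞 L} (hs : s ^ 2 = 2) {p : ℕ} (hp : p.Prime) (hp5 : p % 8 = 5)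
    {P : Ideal (𝓞 L)} (hP : P.IsPrime) (hpP : (p : 𝓞 L) ∈ P) : Ideal.absNorm P ≠ p := by
  intro hN
  have := Fact.mk hp
  have hP0 : P ≠ 0 := by
    rintro rfl
    rw [Submodule.zero_eq_bot, Ideal.absNorm_bot] at hN
    exact hp.ne_zero hN.symm
  have hM := hP.isMaximal hP0
  letI := Ideal.Quotient.field P
  have hcard : Nat.card (𝓞 L ⧸ P) = p := hN
  have hfin : Finite (𝓞 L ⧸ P) := Nat.finite_of_card_ne_zero (by rw [hcard]; exact hp.ne_zero)
  letI := Fintype.ofFinite (𝓞 L ⧸ P)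
  have hp0 : (p : 𝓞 L ⧸ P) = 0 := by
    rw [← map_natCast (Ideal.Quotient.mk P)]
    exact Ideal.Quotient.eq_zero_iff_mem.mpr hpP
  have h1 : (Ideal.Quotient.mk P s) ^ p = Ideal.Quotient.mk P s := by
    have := FiniteField.pow_card (Ideal.Quotient.mk P s)
    rwa [← Nat.card_eq_fintype_card, hcard] at this
  have h2 : ((2 : 𝓞 L ⧸ P) ^ (p / 2)) = -1 := by
    have h20 : (2 : ZMod p) ≠ 0 := by
      intro h
      have := Nat.le_of_dvd two_pos ((ZMod.natCast_eq_zero_iff 2 p).mp (by exact_mod_cast h))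
      omega
    have h3 : (2 : ZMod p) ^ (p / 2) = -1 := by
      refine (ZMod.pow_div_two_eq_neg_one_or_one p h20).resolve_left fun h => ?_
      have := (ZMod.exists_sq_eq_two_iff (by omega)).mp ((ZMod.euler_criterion p h20).mpr h)
      omega
    have h4 : ((2 ^ (p / 2) + 1 : ℕ) : ZMod p) = 0 := by
      push_cast
      rw [h3, neg_add_cancel]
    obtain ⟨k, hk⟩ := (ZMod.natCast_eq_zero_iff _ p).mp h4
    have h5 : (2 : 𝓞 L ⧸ P) ^ (p / 2) + 1 = p * k := by exact_mod_cast congrArg Nat.cast hk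
    rw [hp0, zero_mul] at h5
    exact eq_neg_of_add_eq_zero_left h5
  have h3 : (Ideal.Quotient.mk P s) ^ 2 = 2 := by rw [← map_pow, hs, map_ofNat]
  have hp2 : p = 2 * (p / 2) + 1 := by omega
  rw [hp2, pow_succ, pow_mul, h3, h2] at h1
  have h4 : (2 : 𝓞 L ⧸ P) ^ 2 = 0 := by linear_combination -2 * h3 - (Ideal.Quotient.mk P s) * h1
  have h5 : (2 : 𝓞 L ⧸ P) = 0 := pow_eq_zero_iff (two_ne_zero) |>.mp h4
  have h6 : (p : 𝓞 L ⧸ P) = 1 := by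
    rw [hp2]
    push_cast
    rw [h5, zero_mul, zero_add]
  exact one_ne_zero (h6.symm.trans hp0)

lemma eq_of_dvd_of_absNorm {P Q : Ideal (𝓞 L)} (h : P ∣ Q)
    (hN : Ideal.absNorm P = Ideal.absNorm Q) (hP : Ideal.absNorm P ≠ 0) : P = Q := by
  obtain ⟨J, rfl⟩ := h
  rw [map_mul, eq_comm, Nat.mul_eq_left hP, Ideal.absNorm_eq_one_iff] at hN
  rw [hN, Ideal.mul_top]

lemma span_sup_span_ne_zero {x y : 𝓞 L} (hx : x ≠ 0) : Ideal.span {x} ⊔ Ideal.span {y} ≠ 0 :=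
  fun h => span_ne_zero hx (le_bot_iff.mp (le_sup_left.trans h.le))

lemma ideal_eq_of_sq_eq {I J : Ideal (𝓞 L)} (h : I ^ 2 = J ^ 2) : I = J :=
  dvd_antisymm ((UniqueFactorizationMonoid.pow_dvd_pow_iff_dvd two_ne_zero).mp h.dvd)
    ((UniqueFactorizationMonoid.pow_dvd_pow_iff_dvd two_ne_zero).mp h.symm.dvd)

/-- Comparing norms with a prime of norm two. -/
lemma HasNormForm.idealClass_pow_ne {D : ℤ} (hL : HasNormForm L D) {p : ℕ} (hp : p.Prime)
    (h5 : p % 8 = 5) (hD : (p : ℤ) ∣ D) (hD2 : ¬ (p : ℤ) ^ 2 ∣ D) {Q I : Ideal (𝓞 L)}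
    (hQ : Ideal.absNorm Q = 2) (hI : I ≠ 0) {w : ℕ} (hw : Ideal.absNorm I = w ^ 2) {r : ℕ}
    (hr : Odd r) : idealClass Q ^ r ≠ idealClass I := by
  have hQ0 : Q ≠ 0 := by
    rintro rfl
    rw [Submodule.zero_eq_bot, Ideal.absNorm_bot] at hQ
    omega
  rw [← idealClass_pow hQ0]
  intro h
  obtain ⟨k, rfl⟩ := hr
  refine hL.absNorm_mul_ne hp h5 hD hD2 (pow_ne_zero _ hQ0) hI h (w := 2 ^ k * w) ?_
  rw [map_pow, hQ, hw]
  ring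

end PrimeIdeals

namespace Octic

variable {p₁ p₂ : ℕ} {K : Type*} [Field K] (C : Octic p₁ p₂ K)

/-- The integral generator of `ℚ(√(p₁p₂))`. -/
def ω : K := (1 + C.t) / 2

include C in
lemma two_ne : (2 : K) ≠ 0 := by
  have := C.charZero
  exact two_ne_zero

lemma two_mul_ω : 2 * C.ω = 1 + C.t := mul_div_cancel₀ _ C.two_ne

include C in
lemma exists_eight_mul : ∃ κ : ℕ, p₁ * p₂ = 8 * κ + 1 :=
  ⟨p₁ * p₂ / 8, by have := C.d_mod; omega⟩

lemma ω_mul : ∃ κ : ℕ, C.ω * (C.ω - 1) = 2 * κ := by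
  obtain ⟨κ, hκ⟩ := C.exists_eight_mul
  refine ⟨κ, mul_left_cancel₀ C.two_ne (mul_left_cancel₀ C.two_ne ?_)⟩
  have h1 : (p₁ : K) * p₂ = 8 * κ + 1 := by exact_mod_cast congrArg (Nat.cast : ℕ → K) hκ
  linear_combination (2 * C.ω - 1 + C.t) * C.two_mul_ω + C.t2 + h1

lemma integral_ω : IsIntegral ℤ C.ω := by
  obtain ⟨κ, hκ⟩ := C.ω_mul
  refine ⟨Polynomial.X ^ 2 - Polynomial.X - Polynomial.C (2 * κ : ℤ), ?_, ?_⟩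
  · rw [sub_sub]
    refine Polynomial.monic_X_pow_sub ?_
    compute_degree!
  · simp
    linear_combination hκ

lemma aω : C.a C.ω = 1 - C.ω := by
  rw [eq_sub_iff_add_eq, ← mul_right_inj' C.two_ne, ω, map_div₀, map_add, map_one, C.at',
    map_ofNat]
  have := C.two_ne
  field_simp
  ring

lemma bω : C.b C.ω = C.ω := by rw [ω, map_div₀, map_add, map_one, C.bt, map_ofNat]

lemma cω : C.c C.ω = C.ω := by rw [ω, map_div₀, map_add, map_one, C.ct, map_ofNat]

include C in
lemma not_sq_dvd_d : ¬ (p₁ : ℤ) ^ 2 ∣ p₁ * p₂ := by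
  rw [sq]
  intro h
  have h1 := (mul_dvd_mul_iff_left (by exact_mod_cast C.prime₁.ne_zero)).mp h
  exact C.ne ((Nat.prime_dvd_prime_iff_eq C.prime₁ C.prime₂).mp (by exact_mod_cast h1))

end Octic

namespace Octic

variable {p₁ p₂ : ℕ} {K : Type*} [Field K] [NumberField K] (C : Octic p₁ p₂ K)
  {Q2 : Type*} [Field Q2] [NumberField Q2] {ι₂ : Q2 →+* K}
  (h₂ : ∀ x, x ∈ ι₂.range ↔ C.a x = x ∧ C.b x = x)
  {Kp : Type*} [Field Kp] [NumberField Kp] {ιp : Kp →+* K} (hp : ∀ x, x ∈ ιp.range ↔ C.b x = x)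
  {Fp : Type*} [Field Fp] [NumberField Fp] {ιF : Fp →+* K}
  (hF : ∀ x, x ∈ ιF.range ↔ C.b x = x ∧ C.c x = x)

include h₂ hp in
lemma exists_rel_Q2_Kp : ∃ f g, QuadRel ι₂ ιp C.a f g := by
  refine exists_quadRel _ _ _ (fun x => ?_) C.aa (fun x => ?_) ⟨C.t, ?_, fun h => ?_⟩
  · rw [hp, h₂, and_comm]
  · simp only [hp]
    intro h1
    rw [← C.ab, h1]
  · exact (hp _).mpr C.bt
  · rw [C.at'] at h
    have := C.charZero
    exact C.t_ne_zero (self_eq_neg.mp h.symm)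

include hp hF in
lemma exists_rel_Fp_Kp : ∃ f g, QuadRel ιF ιp C.c f g := by
  refine exists_quadRel _ _ _ (fun x => ?_) C.cc (fun x => ?_) ⟨C.s, ?_, fun h => ?_⟩
  · rw [hp, hF]
  · simp only [hp]
    intro h1
    rw [C.bc, h1]
  · exact (hp _).mpr C.bs
  · rw [C.cs] at h
    have := C.charZero
    exact C.s_ne_zero (self_eq_neg.mp h.symm)

include hF in
lemma exists_rel_rat_Fp : ∃ f g, QuadRel (Rat.castHom K) ιF C.a f g := by
  refine exists_quadRel _ _ _ (fun x => ?_) C.aa (fun x => ?_) ⟨C.t, ?_, fun h => ?_⟩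
  · rw [C.rat_range, hF]
    tauto
  · simp only [hF]
    rintro ⟨h1, h2⟩
    exact ⟨by rw [← C.ab, h1], by rw [← C.ac, h2]⟩
  · exact (hF _).mpr ⟨C.bt, C.ct⟩
  · rw [C.at'] at h
    have := C.charZero
    exact C.t_ne_zero (self_eq_neg.mp h.symm)

include hF in
lemma hasNormForm_Fp : HasNormForm Fp (p₁ * p₂) := by
  obtain ⟨f, g, hfg⟩ := C.exists_rel_rat_Fp hF
  refine hasNormForm_quadratic hfg (δ := C.t) ?_ C.t_ne_zero ((hF _).mpr ⟨C.bt, C.ct⟩) C.at'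
  rw [C.t2]
  push_cast
  rfl

include hp hF in
lemma hasNormForm_Kp : HasNormForm Kp (p₁ * p₂) := by
  obtain ⟨f, g, hfg⟩ := C.exists_rel_Fp_Kp hp hF
  exact .of_quadExt hfg.quad (C.hasNormForm_Fp hF)

include h₂ in
lemma absNorm_s_Q2 {s : 𝓞 Q2} (hs : intHom ι₂ s = C.s) : Ideal.absNorm (Ideal.span {s}) = 2 := by
  rw [C.absNorm_Q2 h₂ (y := -2), absNorm_span_two_rat (Or.inr rfl)]
  rw [hs, C.cs, coe_neg_two_rat, map_neg, map_ofNat]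
  linear_combination -C.s2

include h₂ hp in
lemma absNorm_s_Kp {s : 𝓞 Kp} (hs : intHom ιp s = C.s) : Ideal.absNorm (Ideal.span {s}) = 4 := by
  obtain ⟨f, g, hfg⟩ := C.exists_rel_Q2_Kp h₂ hp
  obtain ⟨s', hs'⟩ := exists_intHom_eq ι₂ ((h₂ _).mpr ⟨C.as, C.bs⟩) C.integral_s
  have h1 : RingOfIntegers.mapRingHom f s' = s :=
    intHom_injective ιp (by rw [hfg.int_base, hs', hs])
  have := hfg.quad.absNorm_extIdeal (Ideal.span {s'})
  rw [extIdeal_span, h1, C.absNorm_s_Q2 h₂ hs'] at this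
  exact this

include h₂ hp in
lemma absNorm_prime_Kp (p : ℕ) : Ideal.absNorm (Ideal.span {(p : 𝓞 Kp)}) = p ^ 4 := by
  obtain ⟨f, g, hfg⟩ := C.exists_rel_Q2_Kp h₂ hp
  obtain ⟨f', g', hfg'⟩ := C.exists_rel_rat_Q2 h₂
  exact hfg.quad.absNorm_span_natCast (k := 2) (hfg'.quad.absNorm_span_natCast (k := 1)
    (by rw [absNorm_span_natCast_rat, pow_one]))

section

variable {s w t : 𝓞 Kp} (hs : intHom ιp s = C.s) (hw : intHom ιp w = C.ω) (ht : intHom ιp t = C.t)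

include h₂ hp hs hw in
/-- A prime of `ℚ(√2, √(p₁p₂))` above 2. -/
lemma prime_Kp {f : Q2 →+* Kp} {g : Kp →+* Kp} (hfg : QuadRel ι₂ ιp C.a f g) :
    (Ideal.span {s} ⊔ Ideal.span {w}) * extIdeal g (Ideal.span {s} ⊔ Ideal.span {w}) =
      Ideal.span {s} ∧ Ideal.absNorm (Ideal.span {s} ⊔ Ideal.span {w}) = 2 := by
  obtain ⟨s', hs'⟩ := exists_intHom_eq ι₂ ((h₂ _).mpr ⟨C.as, C.bs⟩) C.integral_s
  have h1 : RingOfIntegers.mapRingHom f s' = s :=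
    intHom_injective ιp (by rw [hfg.int_base, hs', hs])
  have h2 : RingOfIntegers.mapRingHom g w = 1 - w := intHom_injective ιp (by
    rw [hfg.int_conj, map_sub, map_one, hw, C.aω])
  rw [← h1, ← extIdeal_span]
  have he : w * RingOfIntegers.mapRingHom g w ∈ extIdeal f (Ideal.span {s'}) := by
    obtain ⟨κ, hκ⟩ := C.ω_mul
    rw [extIdeal_span, h1, h2, Ideal.mem_span_singleton]
    refine ⟨-s * κ, intHom_injective ιp ?_⟩
    simp only [map_mul, map_sub, map_one, map_neg, hs, hw, map_natCast]
    linear_combination -hκ + κ * C.s2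
  have hc : ∃ y ∈ extIdeal f (Ideal.span {s'}), ∃ z,
      y + z * (w + RingOfIntegers.mapRingHom g w) = 1 :=
    ⟨0, zero_mem _, 1, by rw [h2]; ring⟩
  exact ⟨hfg.quad.split_mul he hc, by rw [hfg.quad.absNorm_split he hc, C.absNorm_s_Q2 h₂ hs']⟩

include h₂ hp hs ht in
/-- The primes of `ℚ(√2, √(p₁p₂))` above `p₁`. -/
lemma eq_of_mem_Kp {p q : ℕ} (hpp : p.Prime) (hp5 : p % 8 = 5) (hq : q.Prime) (hpq : p ≠ q)
    (hpqt : t ^ 2 = p * q) :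
    (Ideal.span {(p : 𝓞 Kp)} ⊔ Ideal.span {t}) ^ 2 = Ideal.span {(p : 𝓞 Kp)} ∧
    ∀ P : Ideal (𝓞 Kp), P.IsPrime → (p : 𝓞 Kp) ∈ P → t ∈ P →
      P = Ideal.span {(p : 𝓞 Kp)} ⊔ Ideal.span {t} := by
  have hsq : (Ideal.span {(p : 𝓞 Kp)} ⊔ Ideal.span {t}) ^ 2 = Ideal.span {(p : 𝓞 Kp)} := by
    obtain ⟨x, y, hxy⟩ : IsCoprime (p : ℤ) q := by
      exact_mod_cast (Nat.coprime_primes hpp hq).mpr hpq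
    have h1 : (x : 𝓞 Kp) * p + y * q = 1 := by exact_mod_cast congrArg (Int.cast : ℤ → 𝓞 Kp) hxy
    rw [sq, Ideal.sup_mul, Ideal.mul_sup, Ideal.mul_sup]
    simp only [Ideal.span_singleton_mul_span_singleton]
    apply le_antisymm
    · simp only [sup_le_iff, Ideal.span_singleton_le_span_singleton]
      refine ⟨⟨dvd_mul_right _ _, dvd_mul_right _ _⟩, dvd_mul_left _ _, ?_⟩
      rw [← sq, hpqt]
      exact dvd_mul_right _ _
    · rw [Ideal.span_singleton_le_iff_mem]
      have : (p : 𝓞 Kp) = x * (p * p) + y * (t * t) := by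
        rw [← sq t, hpqt]
        linear_combination (-p : 𝓞 Kp) * h1
      have h2 : (x * (p * p) + y * (t * t) : 𝓞 Kp) ∈ Ideal.span {(p : 𝓞 Kp) * p} ⊔
          Ideal.span {(p : 𝓞 Kp) * t} ⊔ (Ideal.span {t * (p : 𝓞 Kp)} ⊔ Ideal.span {t * t}) := by
        refine add_mem (Ideal.mem_sup_left (Ideal.mem_sup_left ?_))
          (Ideal.mem_sup_right (Ideal.mem_sup_right ?_))
        · exact Ideal.mul_mem_left _ _ (Ideal.mem_span_singleton_self _)
        · exact Ideal.mul_mem_left _ _ (Ideal.mem_span_singleton_self _)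
      rwa [← this] at h2
  refine ⟨hsq, fun P hP hpP htP => ?_⟩
  have hN : Ideal.absNorm (Ideal.span {(p : 𝓞 Kp)} ⊔ Ideal.span {t}) = p ^ 2 := by
    have := congrArg Ideal.absNorm hsq
    rw [map_pow, C.absNorm_prime_Kp h₂ hp, show 4 = 2 * 2 from rfl, pow_mul] at this
    exact (pow_left_inj₀ zero_le zero_le two_ne_zero).mp this
  have hdvd : P ∣ Ideal.span {(p : 𝓞 Kp)} ⊔ Ideal.span {t} := by
    rw [Ideal.dvd_iff_le, sup_le_iff, Ideal.span_singleton_le_iff_mem,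
      Ideal.span_singleton_le_iff_mem]
    exact ⟨hpP, htP⟩
  have hs2 : s ^ 2 = 2 := intHom_injective ιp (by rw [map_pow, hs, C.s2, map_ofNat])
  have h1 := absNorm_ne_of_sqrt_two hs2 hpp hp5 hP hpP
  obtain ⟨j, hj, hPj⟩ := (Nat.dvd_prime_pow hpp).mp (hN ▸ Ideal.absNorm_dvd_absNorm_of_le
    (Ideal.dvd_iff_le.mp hdvd))
  have hPN : Ideal.absNorm P = p ^ 2 := by
    interval_cases j
    · exact absurd (Ideal.absNorm_eq_one_iff.mp hPj) hP.ne_top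
    · exact absurd (hPj.trans (pow_one p)) h1
    · exact hPj
  exact eq_of_dvd_of_absNorm hdvd (hPN.trans hN.symm)
    (by rw [hPN]; exact pow_ne_zero _ hpp.ne_zero)

include h₂ hp hF hs hw ht in
/-- The 2-class group of `ℚ(√2, √(p₁p₂))` is cyclic. -/
lemma twoPart_Kp_le {r : ℕ} (hr : Odd r)
    (hr₂ : ∀ y : ClassGroup (𝓞 Q2), y ^ r ∈ twoPart (ClassGroup (𝓞 Q2)))
    (hrp : ∀ y : ClassGroup (𝓞 Kp), y ^ r ∈ twoPart (ClassGroup (𝓞 Kp))) :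
    twoPart (ClassGroup (𝓞 Kp)) ≤
      Subgroup.zpowers (idealClass (Ideal.span {s} ⊔ Ideal.span {w}) ^ r) := by
  obtain ⟨f, g, hfg⟩ := C.exists_rel_Q2_Kp h₂ hp
  have hpt : t ^ 2 = p₁ * p₂ := intHom_injective ιp (by
    rw [map_pow, ht, C.t2, map_mul, map_natCast, map_natCast])
  have hN := (C.prime_Kp h₂ hp hs hw hfg).2
  have hp0 : (p₁ : 𝓞 Kp) ≠ 0 := Nat.cast_ne_zero.mpr C.prime₁.ne_zero
  have ht0 : t ≠ 0 := by
    rintro rfl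
    exact C.t_ne_zero (by rw [← ht, map_zero])
  obtain ⟨hsq₁, hP₁⟩ := C.eq_of_mem_Kp h₂ hp hs ht C.prime₁ C.mod₁ C.prime₂ C.ne hpt
  obtain ⟨hsq₂, hP₂⟩ := C.eq_of_mem_Kp h₂ hp hs ht C.prime₂ C.mod₂ C.prime₁ C.ne.symm
    (by rw [hpt, mul_comm])
  set P₁ := Ideal.span {(p₁ : 𝓞 Kp)} ⊔ Ideal.span {t}
  set P₂ := Ideal.span {(p₂ : 𝓞 Kp)} ⊔ Ideal.span {t}
  have hP₁0 : P₁ ≠ 0 := span_sup_span_ne_zero hp0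
  have hP₂0 : P₂ ≠ 0 := span_sup_span_ne_zero (Nat.cast_ne_zero.mpr C.prime₂.ne_zero)
  have hPP : P₁ * P₂ = Ideal.span {t} := by
    apply ideal_eq_of_sq_eq
    rw [mul_pow, hsq₁, hsq₂, Ideal.span_singleton_pow, Ideal.span_singleton_mul_span_singleton, hpt]
  have hc1 : idealClass P₁ ^ 2 = 1 := by
    rw [← idealClass_pow hP₁0, hsq₁, idealClass_span hp0]
  have hc2 : idealClass P₂ = (idealClass P₁)⁻¹ := by
    rw [eq_inv_iff_mul_eq_one, mul_comm, ← idealClass_mul hP₁0 hP₂0, hPP, idealClass_span ht0]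
  have htwo : ∀ x ∈ twoPart (ClassGroup (𝓞 Kp)), x ^ 2 = 1 → x = 1 ∨ x = idealClass P₁ ^ r := by
    intro x hx hx2
    have hx3 : x ∈ Subgroup.zpowers (idealClass P₁ ^ r) := by
      refine hfg.quad.mem_of_invariant_twoPart (hfg.unit_norm fun u hu huu _ _ _ => ?_) hr
        hr₂ _ (fun y hy => ?_) (fun P hP hP0 _ hram => ?_) hx ?_
      · obtain ⟨ha, hb⟩ := (h₂ _).mp hu
        obtain ⟨k, hk⟩ := C.gen₂ u huu ha hb
        exact exists_norm_of_zpow (R := ιp.fieldRange) ((hp _).mpr C.bₚ) ((hp _).mpr C.bη) C.unitₚ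
          C.unitη C.normₚ C.norm_aη hk
      · rw [C.twoPart_Q2 h₂, Subgroup.mem_bot] at hy
        rw [hy, map_one]
        exact one_mem _
      · have htP : t ∈ P := by
          have : w - RingOfIntegers.mapRingHom g w = t := intHom_injective ιp (by
            rw [map_sub, hfg.int_conj, hw, C.aω, ht]
            linear_combination C.two_mul_ω)
          exact this ▸ hram w
        have : (p₁ : 𝓞 Kp) * p₂ ∈ P := by
          rw [← hpt]
          exact P.pow_mem_of_mem htP 2 two_pos
        rcases hP.mem_or_mem this with h | h
        · rw [hP₁ P hP h htP]
          exact Subgroup.mem_zpowers _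
        · rw [hP₂ P hP h htP, hc2, inv_pow]
          exact inv_mem (Subgroup.mem_zpowers _)
      · rw [hfg.quad.conj_eq_inv_of_twoPart (C.twoPart_Q2 h₂) hx, inv_eq_iff_mul_eq_one, ← sq, hx2]
    obtain ⟨k, rfl⟩ := Subgroup.mem_zpowers_iff.mp hx3
    have h1 : (idealClass P₁ ^ r) ^ 2 = 1 := by rw [← pow_mul, mul_comm, pow_mul, hc1, one_pow]
    rcases Int.even_or_odd' k with ⟨l, rfl | rfl⟩
    · left
      rw [zpow_mul, zpow_ofNat, h1, one_zpow]
    · right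
      rw [zpow_add, zpow_mul, zpow_ofNat, h1, one_zpow, one_mul, zpow_one]
  refine fun x hx => mem_zpowers_of_nonsquare le_rfl htwo (hrp _) (fun y hy => ?_) hx
  obtain ⟨I, hI, rfl⟩ := exists_idealClass y
  rw [← idealClass_pow hI]
  exact ((C.hasNormForm_Kp hp hF).idealClass_pow_ne C.prime₁ C.mod₁ (dvd_mul_right _ _)
    C.not_sq_dvd_d hN (pow_ne_zero 2 hI) (map_pow _ _ _) hr).symm

end

end Octic

lemma Subgroup.card_map_eq {G H : Type*} [Group G] [Group H] {f : G →* H}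
    (hf : Function.Injective f) (S : Subgroup G) : Nat.card (S.map f) = Nat.card S :=
  (Nat.card_congr (S.equivMapOfInjective f hf).toEquiv).symm

lemma injective_of_ker_eq {G H : Type*} [Group G] [Group H] {f : G →* H}
    (h : ∀ x, f x = 1 → x = 1) : Function.Injective f :=
  (injective_iff_map_eq_one f).mpr h

namespace Octic

variable {p₁ p₂ : ℕ} {K : Type*} [Field K] [NumberField K] (C : Octic p₁ p₂ K)
  {Q2 : Type*} [Field Q2] [NumberField Q2] {ι₂ : Q2 →+* K}
  (h₂ : ∀ x, x ∈ ι₂.range ↔ C.a x = x ∧ C.b x = x)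
  {Kp : Type*} [Field Kp] [NumberField Kp] {ιp : Kp →+* K} (hp : ∀ x, x ∈ ιp.range ↔ C.b x = x)
  {Fp : Type*} [Field Fp] [NumberField Fp] {ιF : Fp →+* K}
  (hF : ∀ x, x ∈ ιF.range ↔ C.b x = x ∧ C.c x = x)
  {s w t : 𝓞 Kp} (hs : intHom ιp s = C.s) (hw : intHom ιp w = C.ω) (ht : intHom ιp t = C.t)

include h₂ hp hF hs hw in
lemma classMap_Fp_Kp_injective {f : Fp →+* Kp} {g : Kp →+* Kp} (hfg : QuadRel ιF ιp C.c f g) :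
    Function.Injective (classMap f) := by
  have hs0 : s ≠ 0 := by
    rintro rfl
    exact C.s_ne_zero (by rw [← hs, map_zero])
  refine injective_of_ker_eq fun x hx => ?_
  refine (hfg.quad.class_ker hs0 (hfg.unit_hilbert90 fun u hu huu hN => ?_) hx).resolve_right ?_
  · obtain ⟨v, hv, hvu, h | h⟩ := C.cob_c huu ((hp _).mp hu) hN
    · exact ⟨v, (hp _).mpr hv, hvu, Or.inl h⟩
    · refine ⟨v, (hp _).mpr hv, hvu, Or.inr ?_⟩
      rw [hs, map_mul, C.cs]
      linear_combination -C.s * h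
  · rintro ⟨J, -, hJ, -⟩
    obtain ⟨f', g', hfg'⟩ := C.exists_rel_Q2_Kp h₂ hp
    obtain ⟨w₀, hw₀⟩ := exists_intHom_eq ιF ((hF _).mpr ⟨C.bω, C.cω⟩) C.integral_ω
    obtain ⟨κ, hκ⟩ := C.ω_mul
    refine hfg.quad.extIdeal_ne_span (C.absNorm_s_Kp h₂ hp hs) (w := w₀) (w' := κ)
      (intHom_injective ιF ?_) (τ := g') (intHom_injective ιp ?_) (intHom_injective ιp ?_) J hJ
    · rw [map_mul, map_sub, map_one, map_mul, hw₀, map_natCast, map_ofNat, hκ]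
    · rw [hfg'.int_conj, hs, C.as]
    · rw [hfg'.int_conj, hfg.int_base, hw₀, map_sub, map_one, hfg.int_base, hw₀, C.aω]

include h₂ hp hF hs hw ht in
theorem twoPart_Kp {n : ℕ} (hn : Nat.card (twoPart (ClassGroup (𝓞 Fp))) = 2 ^ n) {r : ℕ}
    (hr : Odd r) (hr₂ : ∀ y : ClassGroup (𝓞 Q2), y ^ r ∈ twoPart (ClassGroup (𝓞 Q2)))
    (hrF : ∀ y : ClassGroup (𝓞 Fp), y ^ r ∈ twoPart (ClassGroup (𝓞 Fp)))
    (hrp : ∀ y : ClassGroup (𝓞 Kp), y ^ r ∈ twoPart (ClassGroup (𝓞 Kp))) :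
    twoPart (ClassGroup (𝓞 Kp)) =
      Subgroup.zpowers (idealClass (Ideal.span {s} ⊔ Ideal.span {w}) ^ r) ∧
    orderOf (idealClass (Ideal.span {s} ⊔ Ideal.span {w}) ^ r) = 2 ^ (n + 1) := by
  obtain ⟨f, g, hfg⟩ := C.exists_rel_Fp_Kp hp hF
  obtain ⟨f', g', hfg'⟩ := C.exists_rel_Q2_Kp h₂ hp
  have hN := (C.prime_Kp h₂ hp hs hw hfg').2
  have hle := C.twoPart_Kp_le h₂ hp hF hs hw ht hr hr₂ hrp
  have hinj := C.classMap_Fp_Kp_injective h₂ hp hF hs hw hfg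
  have hs0 : s ≠ 0 := by
    rintro rfl
    exact C.s_ne_zero (by rw [← hs, map_zero])
  set Q := Ideal.span {s} ⊔ Ideal.span {w}
  have hQ0 : Q ≠ 0 := span_sup_span_ne_zero hs0
  have hgQ : extIdeal g Q = Q := by
    change (Ideal.span {s} ⊔ Ideal.span {w}).map (RingOfIntegers.mapRingHom g) = _
    rw [Ideal.map_sup, Ideal.map_span, Ideal.map_span, Set.image_singleton, Set.image_singleton]
    have h1 : RingOfIntegers.mapRingHom g s = -s := intHom_injective ιp (by
      rw [hfg.int_conj, map_neg, hs, C.cs])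
    have h2 : RingOfIntegers.mapRingHom g w = w := intHom_injective ιp (by
      rw [hfg.int_conj, hw, C.cω])
    rw [h1, h2, Ideal.span_singleton_neg]
  have hu2 : (idealClass Q ^ r) ^ 2 ∈ (twoPart (ClassGroup (𝓞 Fp))).map (classMap f) := by
    obtain ⟨y, hy⟩ := hfg.quad.mul_conj_mem_range (idealClass Q)
    rw [classMap_idealClass _ hQ0, hgQ, ← sq] at hy
    exact ⟨y ^ r, hrF y, by rw [map_pow, hy, ← pow_mul, ← pow_mul, mul_comm]⟩
  have huT : idealClass Q ^ r ∉ (twoPart (ClassGroup (𝓞 Fp))).map (classMap f) := by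
    rintro ⟨y, -, hy⟩
    obtain ⟨I, hI, rfl⟩ := exists_idealClass y
    rw [classMap_idealClass _ hI] at hy
    exact (C.hasNormForm_Kp hp hF).idealClass_pow_ne C.prime₁ C.mod₁ (dvd_mul_right _ _)
      C.not_sq_dvd_d hN (extIdeal_ne_zero f hI) (hfg.quad.absNorm_extIdeal I) hr hy.symm
  have hT : (twoPart (ClassGroup (𝓞 Fp))).map (classMap f) ≤ twoPart (ClassGroup (𝓞 Kp)) := by
    rintro _ ⟨y, hy, rfl⟩
    exact map_mem_twoPart _ hy
  refine ⟨le_antisymm hle ?_, (orderOf_of_sq_mem (hrp _) (hT.trans hle) huT hu2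
    ((Subgroup.card_map_eq hinj _).trans hn)).2⟩
  rw [Subgroup.zpowers_le]
  exact hrp _

end Octic

lemma orderOf_eq_of_sq {G : Type*} [Group G] {x : G} {n : ℕ} (h : orderOf (x ^ 2) = 2 ^ (n + 1)) :
    orderOf x = 2 ^ (n + 2) := by
  apply orderOf_eq_prime_pow
  · rw [pow_succ', pow_mul, ← orderOf_dvd_iff_pow_eq_one, h]
    exact fun h => absurd (Nat.le_of_dvd (by positivity) h)
      (not_le.mpr (Nat.pow_lt_pow_right one_lt_two (Nat.lt_succ_self n)))
  · rw [pow_succ' 2 (n + 1), pow_mul, ← orderOf_dvd_iff_pow_eq_one, h]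

lemma extIdeal_span_sup_span {F L : Type*} [Field F] [NumberField F] [Field L] [NumberField L]
    (f : F →+* L) (x y : 𝓞 F) : extIdeal f (Ideal.span {x} ⊔ Ideal.span {y}) =
      Ideal.span {RingOfIntegers.mapRingHom f x} ⊔ Ideal.span {RingOfIntegers.mapRingHom f y} := by
  change (Ideal.span {x} ⊔ Ideal.span {y}).map (RingOfIntegers.mapRingHom f) = _
  rw [Ideal.map_sup, Ideal.map_span, Ideal.map_span, Set.image_singleton, Set.image_singleton]

lemma span_sup_span_sq {R : Type*} [CommRing R] {x e : R} (h : e * (1 - e) ∈ Ideal.span {x ^ 2}) :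
    (Ideal.span {x} ⊔ Ideal.span {e}) ^ 2 = Ideal.span {x ^ 2} ⊔ Ideal.span {e} := by
  rw [sq (Ideal.span {x} ⊔ Ideal.span {e}), Ideal.sup_mul, Ideal.mul_sup, Ideal.mul_sup]
  simp only [Ideal.span_singleton_mul_span_singleton]
  rw [← sq x, ← sq e]
  apply le_antisymm
  · simp only [sup_le_iff, Ideal.span_singleton_le_iff_mem]
    refine ⟨⟨Ideal.mem_sup_left (Ideal.mem_span_singleton_self _), ?_⟩, ?_, ?_⟩ <;>
      refine Ideal.mem_sup_right (Ideal.mem_span_singleton.mpr ?_)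
    exacts [dvd_mul_left _ _, dvd_mul_right _ _, dvd_pow_self _ two_ne_zero]
  · refine sup_le (le_sup_left.trans le_sup_left) ?_
    have h1 : e * (1 - e) + e ^ 2 ∈ Ideal.span {x ^ 2} ⊔ Ideal.span {x * e} ⊔
        (Ideal.span {e * x} ⊔ Ideal.span {e ^ 2}) :=
      add_mem (Ideal.mem_sup_left (Ideal.mem_sup_left h))
        (Ideal.mem_sup_right (Ideal.mem_sup_right (Ideal.mem_span_singleton_self _)))
    rwa [show e * (1 - e) + e ^ 2 = e by ring, ← Ideal.span_singleton_le_iff_mem] at h1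

lemma eq_of_le_of_absNorm_eq_two {L : Type*} [Field L] [NumberField L] {P Q : Ideal (𝓞 L)}
    (hP : P.IsPrime) (h : Q ≤ P) (hQ : Ideal.absNorm Q = 2) : P = Q := by
  have : Q.IsPrime := Ideal.isPrime_of_irreducible_absNorm (hQ ▸ Nat.prime_two)
  have hQ0 : Q ≠ ⊥ := by
    rintro rfl
    rw [Ideal.absNorm_bot] at hQ
    exact absurd hQ (by norm_num)
  exact ((this.isMaximal hQ0).eq_of_le hP.ne_top h).symm

namespace Octic

variable {p₁ p₂ : ℕ} {K : Type*} [Field K] [NumberField K] (C : Octic p₁ p₂ K)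
  {Q2 : Type*} [Field Q2] [NumberField Q2] {ι₂ : Q2 →+* K}
  (h₂ : ∀ x, x ∈ ι₂.range ↔ C.a x = x ∧ C.b x = x)
  {k : Type*} [Field k] [NumberField k] {ιk : k →+* K} (hk : ∀ x, x ∈ ιk.range ↔ C.a x = x)
  {Kp : Type*} [Field Kp] [NumberField Kp] {ιp : Kp →+* K} (hp : ∀ x, x ∈ ιp.range ↔ C.b x = x)
  {z w : 𝓞 K} (hz : intHom (RingHom.id K) z = C.ζ) (hw : intHom (RingHom.id K) w = C.ω)

include hk in
lemma exists_rel_k_K : ∃ f g, QuadRel ιk (RingHom.id K) C.a f g := by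
  refine exists_quadRel _ _ _ (fun x => ?_) C.aa (fun x _ => ?_) ⟨C.t, ?_, fun h => ?_⟩
  · rw [hk]
    simp
  · simp
  · simp
  · rw [C.at'] at h
    have := C.charZero
    exact C.t_ne_zero (self_eq_neg.mp h.symm)

include hp in
lemma exists_rel_Kp_K : ∃ f g, QuadRel ιp (RingHom.id K) C.b f g := by
  refine exists_quadRel _ _ _ (fun x => ?_) C.bb (fun x _ => ?_) ⟨C.i, ?_, fun h => ?_⟩
  · rw [hp]
    simp
  · simp
  · simp
  · rw [C.bi] at h
    have := C.charZero
    exact C.i_ne_zero (self_eq_neg.mp h.symm)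

include h₂ hk in
lemma twoPart_conj_a {f : k →+* K} {g : K →+* K} (hfg : QuadRel ιk (RingHom.id K) C.a f g)
    {x : ClassGroup (𝓞 K)} (hx : x ∈ twoPart (ClassGroup (𝓞 K))) : classMap g x = x⁻¹ :=
  hfg.quad.conj_eq_inv_of_twoPart (C.twoPart_k h₂ hk) hx

include hz in
lemma one_sub_ne_zero : 1 - z ≠ 0 := by
  intro h
  apply C.one_sub_ζ_ne_zero
  rw [← hz, ← map_one (intHom (RingHom.id K)), ← map_sub, h, map_zero]

include h₂ hk hz in
lemma absNorm_one_sub_ζ : Ideal.absNorm (Ideal.span {1 - z}) = 4 := by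
  obtain ⟨f, g, hfg⟩ := C.exists_rel_k_K hk
  obtain ⟨z', hz'⟩ := exists_intHom_eq ιk ((hk _).mpr C.aζ) C.integral_ζ
  have h1 : RingOfIntegers.mapRingHom f (1 - z') = 1 - z :=
    intHom_injective (RingHom.id K) (by
      rw [hfg.int_base, map_sub, map_sub, hz', hz, map_one, map_one])
  have := hfg.quad.absNorm_extIdeal (Ideal.span {1 - z'})
  rw [extIdeal_span, h1, C.absNorm_one_sub_ζ_k h₂ hk hz'] at this
  exact this

lemma bζ' : C.b C.ζ = -C.ζ ^ 3 := by
  rw [C.bζ, inv_eq_of_mul_eq_one_right]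
  linear_combination -C.ζ4

lemma s_eq : C.s = (1 - C.ζ) ^ 2 * (C.ζ ^ 3 * (1 + C.ζ - C.ζ ^ 3)) := by
  rw [← C.ζ_add, C.bζ']
  linear_combination (C.ζ ^ 4 - 2 * C.ζ ^ 3 + C.ζ) * C.ζ4

include hw in
lemma mul_one_sub_ω : ∃ y : 𝓞 K, w * (1 - w) = 2 * y := by
  obtain ⟨κ, hκ⟩ := C.ω_mul
  refine ⟨-κ, intHom_injective (RingHom.id K) ?_⟩
  simp only [map_mul, map_sub, map_one, map_neg, map_natCast, hw, map_ofNat]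
  linear_combination -hκ

include hz hw in
lemma mul_one_sub_mem : w * (1 - w) ∈ Ideal.span {(1 - z) ^ 2} := by
  obtain ⟨y, hy⟩ := C.mul_one_sub_ω hw
  rw [hy, Ideal.mem_span_singleton]
  refine ⟨(1 - z) ^ 2 * (z ^ 3 * (1 + z - z ^ 3)) ^ 2 * y, intHom_injective (RingHom.id K) ?_⟩
  simp only [map_mul, map_sub, map_one, map_add, map_pow, hz, map_ofNat]
  linear_combination intHom (RingHom.id K) y * (-C.s2 +
    (C.s + (1 - C.ζ) ^ 2 * (C.ζ ^ 3 * (1 + C.ζ - C.ζ ^ 3))) * C.s_eq)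

end Octic

namespace Octic

variable {p₁ p₂ : ℕ} {K : Type*} [Field K] [NumberField K] (C : Octic p₁ p₂ K)
  {Q2 : Type*} [Field Q2] [NumberField Q2] {ι₂ : Q2 →+* K}
  (h₂ : ∀ x, x ∈ ι₂.range ↔ C.a x = x ∧ C.b x = x)
  {k : Type*} [Field k] [NumberField k] {ιk : k →+* K} (hk : ∀ x, x ∈ ιk.range ↔ C.a x = x)
  {Kp : Type*} [Field Kp] [NumberField Kp] {ιp : Kp →+* K} (hp : ∀ x, x ∈ ιp.range ↔ C.b x = x)
  {z w : 𝓞 K} (hz : intHom (RingHom.id K) z = C.ζ) (hw : intHom (RingHom.id K) w = C.ω)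
  {s₀ w₀ : 𝓞 Kp} (hs₀ : intHom ιp s₀ = C.s) (hw₀ : intHom ιp w₀ = C.ω)

include h₂ hk hz hw in
/-- A prime of `K` above 2. -/
lemma prime_K {f : k →+* K} {g : K →+* K} (hfg : QuadRel ιk (RingHom.id K) C.a f g) :
    (Ideal.span {1 - z} ⊔ Ideal.span {w}) * extIdeal g (Ideal.span {1 - z} ⊔ Ideal.span {w}) =
      Ideal.span {1 - z} ∧ Ideal.absNorm (Ideal.span {1 - z} ⊔ Ideal.span {w}) = 2 := by
  obtain ⟨z', hz'⟩ := exists_intHom_eq ιk ((hk _).mpr C.aζ) C.integral_ζ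
  have h1 : RingOfIntegers.mapRingHom f (1 - z') = 1 - z :=
    intHom_injective (RingHom.id K) (by
      rw [hfg.int_base, map_sub, map_sub, hz', hz, map_one, map_one])
  have h2 : RingOfIntegers.mapRingHom g w = 1 - w := intHom_injective (RingHom.id K) (by
    rw [hfg.int_conj, map_sub, map_one, hw, C.aω])
  rw [← h1, ← extIdeal_span]
  have he : w * RingOfIntegers.mapRingHom g w ∈ extIdeal f (Ideal.span {1 - z'}) := by
    rw [extIdeal_span, h1, h2, Ideal.mem_span_singleton]
    exact (dvd_pow_self _ two_ne_zero).trans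
      (Ideal.mem_span_singleton.mp (C.mul_one_sub_mem hz hw))
  have hc : ∃ y ∈ extIdeal f (Ideal.span {1 - z'}), ∃ z,
      y + z * (w + RingOfIntegers.mapRingHom g w) = 1 :=
    ⟨0, zero_mem _, 1, by rw [h2]; ring⟩
  exact ⟨hfg.quad.split_mul he hc,
    by rw [hfg.quad.absNorm_split he hc, C.absNorm_one_sub_ζ_k h₂ hk hz']⟩

include hz hw hs₀ hw₀ in
lemma extIdeal_prime_Kp {f : Kp →+* K} {g : K →+* K} (hfg : QuadRel ιp (RingHom.id K) C.b f g) :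
    extIdeal f (Ideal.span {s₀} ⊔ Ideal.span {w₀}) =
      (Ideal.span {1 - z} ⊔ Ideal.span {w}) ^ 2 := by
  rw [span_sup_span_sq (C.mul_one_sub_mem hz hw), extIdeal_span_sup_span]
  have h1 : RingOfIntegers.mapRingHom f s₀ = (1 - z) ^ 2 * (z ^ 3 * (1 + z - z ^ 3)) :=
    intHom_injective (RingHom.id K) (by
      simp only [hfg.int_base, map_mul, map_sub, map_one, map_add, map_pow, hz, hs₀]
      exact C.s_eq)
  have h2 : RingOfIntegers.mapRingHom f w₀ = w := intHom_injective (RingHom.id K) (by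
    rw [hfg.int_base, hw₀, hw])
  have h4 : z ^ 4 = -1 := intHom_injective (RingHom.id K) (by
    rw [map_pow, hz, C.ζ4, map_neg, map_one])
  rw [h1, h2, Ideal.span_singleton_mul_right_unit]
  refine IsUnit.of_mul_eq_one (-z * (z - z ^ 3 - 1)) ?_
  linear_combination (-z ^ 6 + 2 * z ^ 4 - 1) * h4

include hz hw in
lemma extIdeal_b_prime {f : Kp →+* K} {g : K →+* K} (hfg : QuadRel ιp (RingHom.id K) C.b f g) :
    extIdeal g (Ideal.span {1 - z} ⊔ Ideal.span {w}) = Ideal.span {1 - z} ⊔ Ideal.span {w} := by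
  rw [extIdeal_span_sup_span]
  have h4 : z ^ 4 = -1 := intHom_injective (RingHom.id K) (by
    rw [map_pow, hz, C.ζ4, map_neg, map_one])
  have h1 : RingOfIntegers.mapRingHom g (1 - z) = z ^ 3 * (1 - z) :=
    intHom_injective (RingHom.id K) (by
      simp only [hfg.int_conj, map_mul, map_sub, map_one, map_pow, hz]
      rw [C.bζ']
      linear_combination C.ζ4)
  have h2 : RingOfIntegers.mapRingHom g w = w := intHom_injective (RingHom.id K) (by
    rw [hfg.int_conj, hw, C.bω])
  rw [h1, h2, Ideal.span_singleton_mul_left_unit]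
  refine IsUnit.of_mul_eq_one (-z) ?_
  linear_combination -h4

include h₂ hk hp hz in
lemma classMap_Kp_K_injective {f : Kp →+* K} {g : K →+* K}
    (hfg : QuadRel ιp (RingHom.id K) C.b f g) : Function.Injective (classMap f) := by
  refine injective_of_ker_eq fun x hx => ?_
  refine (hfg.quad.class_ker (C.one_sub_ne_zero hz) (hfg.unit_hilbert90 fun u _ huu hN => ?_)
    hx).resolve_right ?_
  · obtain ⟨j, rfl⟩ := C.exists_eq_ζ_pow huu hN
    have hr : ∀ x : K, x ∈ (RingHom.id K).range := fun x => ⟨x, rfl⟩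
    have h1 : ∀ e : ℕ, C.ζ ^ e * C.b C.ζ ^ e = 1 := fun e => by
      rw [← mul_pow, C.ζ_mul, one_pow]
    rcases Nat.even_or_odd' j with ⟨e, rfl | rfl⟩
    · refine ⟨C.ζ ^ e, hr _, C.unitζ.pow _, Or.inl ?_⟩
      rw [map_pow]
      linear_combination C.ζ ^ e * h1 e
    · refine ⟨C.ζ ^ (e + 2), hr _, C.unitζ.pow _, Or.inr ?_⟩
      rw [map_sub, map_one, hz, map_mul, map_pow]
      linear_combination C.ζ ^ (e + 2) * C.one_sub_ζ_conj +
        C.ζ ^ (e + 1) * C.b C.ζ ^ 2 * C.b (1 - C.ζ) * h1 e +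
        C.ζ ^ (e + 1) * C.b (1 - C.ζ) * (C.b C.ζ - C.ζ ^ 3) * C.bζ'
  · rintro ⟨J, -, hJ, -⟩
    obtain ⟨f', g', hfg'⟩ := C.exists_rel_k_K hk
    obtain ⟨w₀, hw₀⟩ := exists_intHom_eq ιp ((hp _).mpr C.bω) C.integral_ω
    obtain ⟨κ, hκ⟩ := C.ω_mul
    refine hfg.quad.extIdeal_ne_span (C.absNorm_one_sub_ζ h₂ hk hz) (w := w₀) (w' := κ)
      (intHom_injective ιp ?_) (τ := g') (intHom_injective (RingHom.id K) ?_)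
      (intHom_injective (RingHom.id K) ?_) J hJ
    · rw [map_mul, map_sub, map_one, map_mul, hw₀, map_natCast, map_ofNat, hκ]
    · rw [hfg'.int_conj, map_sub, map_one, hz, map_sub, map_one, C.aζ]
    · rw [hfg'.int_conj, hfg.int_base, hw₀, map_sub, map_one, hfg.int_base, hw₀, C.aω]

include h₂ hk hp hz hw hs₀ hw₀ in
theorem twoPart_K {f : Kp →+* K} {g : K →+* K} (hfg : QuadRel ιp (RingHom.id K) C.b f g)
    {n r : ℕ} (hr : Odd r) (hrp : ∀ y : ClassGroup (𝓞 Kp), y ^ r ∈ twoPart (ClassGroup (𝓞 Kp)))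
    (hA : twoPart (ClassGroup (𝓞 Kp)) =
      Subgroup.zpowers (idealClass (Ideal.span {s₀} ⊔ Ideal.span {w₀}) ^ r))
    (hn : orderOf (idealClass (Ideal.span {s₀} ⊔ Ideal.span {w₀}) ^ r) = 2 ^ (n + 1))
    {ξ : ClassGroup (𝓞 K)} (hξ : ξ = idealClass (Ideal.span {1 - z} ⊔ Ideal.span {w}) ^ r) :
    orderOf ξ = 2 ^ (n + 2) ∧ classMap g ξ = ξ ∧
      (∀ x ∈ twoPart (ClassGroup (𝓞 K)), classMap g x = x → x ∈ Subgroup.zpowers ξ) ∧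
      ∀ x ∈ twoPart (ClassGroup (𝓞 K)), x * classMap g x ∈ Subgroup.zpowers (ξ ^ 2) := by
  have hinj := C.classMap_Kp_K_injective h₂ hk hp hz hfg
  have hgQ := C.extIdeal_b_prime hz hw hfg
  have hQ0 : Ideal.span {1 - z} ⊔ Ideal.span {w} ≠ 0 := span_sup_span_ne_zero (C.one_sub_ne_zero hz)
  have hs0 : s₀ ≠ 0 := by
    rintro rfl
    exact C.s_ne_zero (by rw [← hs₀, map_zero])
  have hext : ξ ^ 2 = classMap f (idealClass (Ideal.span {s₀} ⊔ Ideal.span {w₀}) ^ r) := by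
    rw [hξ, map_pow, classMap_idealClass _ (span_sup_span_ne_zero hs0),
      C.extIdeal_prime_Kp hz hw hs₀ hw₀ hfg, idealClass_pow hQ0, ← pow_mul, ← pow_mul, mul_comm]
  have hmem : ∀ y ∈ twoPart (ClassGroup (𝓞 Kp)), classMap f y ∈ Subgroup.zpowers (ξ ^ 2) := by
    intro y hy
    rw [hA] at hy
    obtain ⟨l, rfl⟩ := hy
    exact ⟨l, by rw [hext]; exact (map_zpow _ _ _).symm⟩
  refine ⟨orderOf_eq_of_sq ?_, ?_, fun x hx hgx => ?_, fun x hx => ?_⟩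
  · rw [hext, orderOf_injective _ hinj, hn]
  · rw [hξ, map_pow, classMap_idealClass _ hQ0, hgQ]
  · refine hfg.quad.mem_of_invariant_twoPart (hfg.unit_norm fun u hu huu x _ hxu => ?_) hr hrp _
      (fun y hy => ?_) (fun P hP hP0 _ hram => ?_) hx hgx
    · obtain ⟨v, hv, hvu, huv⟩ := C.exists_eq_sq huu hxu
      exact ⟨v, ⟨v, rfl⟩, hvu, by rw [hv, huv, sq]⟩
    · obtain ⟨l, hl⟩ := hmem y hy
      exact ⟨2 * l, by rw [← hl]; simp only [zpow_mul, zpow_ofNat]⟩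
    · obtain ⟨f', g', hfg'⟩ := C.exists_rel_k_K hk
      obtain ⟨hQQ, hN⟩ := C.prime_K h₂ hk hz hw hfg'
      have h1 : (1 - z) ^ 2 =
          (z - RingOfIntegers.mapRingHom g z) * (-z * (1 - z + z ^ 2 - z ^ 3 + z ^ 4)) :=
        intHom_injective (RingHom.id K) (by
          simp only [map_sub, map_mul, map_add, map_neg, map_pow, hfg.int_conj, hz, map_one]
          exact C.one_sub_ζ_sq)
      have h2 : 1 - z ∈ P := hP.mem_of_pow_mem 2 (h1 ▸ P.mul_mem_right _ (hram z))
      have h3 : w * (1 - w) ∈ P := by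
        refine (Ideal.span_singleton_le_iff_mem P).mpr ?_ (C.mul_one_sub_mem hz hw)
        exact P.pow_mem_of_mem h2 2 two_pos
      rcases hP.mem_or_mem h3 with h | h
      · rw [eq_of_le_of_absNorm_eq_two hP (sup_le ((Ideal.span_singleton_le_iff_mem P).mpr h2)
          ((Ideal.span_singleton_le_iff_mem P).mpr h)) hN, ← hξ]
        exact Subgroup.mem_zpowers _
      · have h5 : extIdeal g' (Ideal.span {1 - z} ⊔ Ideal.span {w}) ≤ P := by
          rw [extIdeal_span_sup_span]
          have h6 : RingOfIntegers.mapRingHom g' (1 - z) = 1 - z :=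
            intHom_injective (RingHom.id K) (by
              rw [hfg'.int_conj, map_sub, map_one, hz, map_sub, map_one, C.aζ])
          have h7 : RingOfIntegers.mapRingHom g' w = 1 - w :=
            intHom_injective (RingHom.id K) (by
              rw [hfg'.int_conj, map_sub, map_one, hw, C.aω])
          rw [h6, h7]
          exact sup_le ((Ideal.span_singleton_le_iff_mem P).mpr h2)
            ((Ideal.span_singleton_le_iff_mem P).mpr h)
        rw [eq_of_le_of_absNorm_eq_two hP h5 (by rw [hfg'.quad.absNorm_conj, hN])]
        have h8 : idealClass (Ideal.span {1 - z} ⊔ Ideal.span {w}) *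
            idealClass (extIdeal g' (Ideal.span {1 - z} ⊔ Ideal.span {w})) = 1 := by
          rw [← idealClass_mul hQ0 (extIdeal_ne_zero g' hQ0), hQQ,
            idealClass_span (C.one_sub_ne_zero hz)]
        rw [eq_inv_of_mul_eq_one_right h8, inv_pow, ← hξ]
        exact inv_mem (Subgroup.mem_zpowers _)
  · obtain ⟨y, hy⟩ := hfg.quad.mul_conj_mem_range x
    refine mem_of_odd_pow_mem (mul_mem hx (map_mem_twoPart _ hx)) hr ?_
    rw [← hy, ← map_pow]
    exact hmem _ (hrp y)

end Octic

namespace Octic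

variable {p₁ p₂ : ℕ} {K : Type*} [Field K] [NumberField K] (C : Octic p₁ p₂ K)

/-- The integer `(1 + √(-p₁p₂)) / √2`. -/
def θ : K := (1 + C.i * C.t) / C.s

lemma s_mul_θ : C.s * C.θ = 1 + C.i * C.t := by
  rw [θ, mul_div_cancel₀ _ C.s_ne_zero]

lemma it_sq : (C.i * C.t) ^ 2 = -(p₁ * p₂) := by
  rw [mul_pow, C.i2, C.t2]
  ring

lemma exists_θ : ∃ μ : ℕ, p₁ * p₂ = 8 * μ + 1 ∧ C.θ ^ 2 = C.s * C.θ - 1 - 4 * μ := by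
  refine ⟨p₁ * p₂ / 8, ?_, ?_⟩
  · have := C.d_mod
    lia
  · have h1 : p₁ * p₂ = 8 * (p₁ * p₂ / 8) + 1 := by
      have := C.d_mod
      lia
    have h2 : (p₁ : K) * p₂ = 8 * (p₁ * p₂ / 8 : ℕ) + 1 := by
      exact_mod_cast congrArg (Nat.cast (R := K)) h1
    have h3 : (C.s * C.θ) ^ 2 = 1 + 2 * (C.s * C.θ - 1) - p₁ * p₂ := by
      rw [C.s_mul_θ]
      linear_combination C.it_sq
    apply mul_left_cancel₀ C.two_ne
    linear_combination h3 - h2 - C.θ ^ 2 * C.s2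

lemma integral_θ : IsIntegral ℤ C.θ := by
  obtain ⟨μ, -, hμ⟩ := C.exists_θ
  have h1 : IsIntegral ℤ (C.i * C.t) := C.integral_i.mul C.integral_t
  have h2 : IsIntegral ℤ (4 * μ : K) := by
    simpa using isIntegral_algebraMap (R := ℤ) (A := K) (x := 4 * μ)
  refine IsIntegral.of_pow (n := 2) two_pos ?_
  rw [hμ, C.s_mul_θ]
  exact ((isIntegral_one.add h1).sub isIntegral_one).sub h2

lemma abi : C.a (C.b C.i) = -C.i := by rw [C.bi, map_neg, C.ai]

lemma abt : C.a (C.b C.t) = -C.t := by rw [C.bt, C.at']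

lemma abs : C.a (C.b C.s) = C.s := by rw [C.bs, C.as]

lemma abθ : C.a (C.b C.θ) = C.θ := by simp [θ, C.abi, C.abt, C.abs]

variable {F2 : Type*} [Field F2] [NumberField F2] {ι₂ : F2 →+* K}
  (h₂ : ∀ x, x ∈ ι₂.range ↔ C.a (C.b x) = x)
  {Fm : Type*} [Field Fm] [NumberField Fm] {ιm : Fm →+* K}
  (hm : ∀ x, x ∈ ιm.range ↔ C.a (C.b x) = x ∧ C.c x = x)

include h₂ hm in
lemma exists_rel_Fm_F2 : ∃ f g, QuadRel ιm ι₂ C.c f g := by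
  refine exists_quadRel _ _ _ (fun x => ?_) C.cc (fun x => ?_) ⟨C.s, ?_, fun h => ?_⟩
  · rw [hm, h₂]
  · simp only [h₂]
    intro h1
    rw [C.bc, C.ac, h1]
  · exact (h₂ _).mpr C.abs
  · rw [C.cs] at h
    have := C.charZero
    exact C.s_ne_zero (self_eq_neg.mp h.symm)

lemma it_ne_zero : C.i * C.t ≠ 0 := mul_ne_zero C.i_ne_zero C.t_ne_zero

include hm in
lemma it_mem_Fm : C.i * C.t ∈ ιm.range :=
  (hm _).mpr ⟨by rw [map_mul, map_mul, C.abi, C.abt, neg_mul_neg], by rw [map_mul, C.ci, C.ct]⟩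

lemma a_it : C.a (C.i * C.t) = -(C.i * C.t) := by rw [map_mul, C.ai, C.at', mul_neg]

include hm in
lemma exists_rel_rat_Fm : ∃ f g, QuadRel (Rat.castHom K) ιm C.a f g := by
  refine exists_quadRel _ _ _ (fun x => ?_) C.aa (fun x => ?_)
    ⟨C.i * C.t, C.it_mem_Fm hm, fun h => ?_⟩
  · rw [C.rat_range, hm]
    constructor
    · rintro ⟨h1, h2, h3⟩
      exact ⟨⟨by rw [h2, h1], h3⟩, h1⟩
    · rintro ⟨⟨h1, h2⟩, h3⟩
      exact ⟨h3, by rw [C.ab, h3] at h1; exact h1, h2⟩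
  · simp only [hm]
    rintro ⟨h1, h2⟩
    exact ⟨by rw [← C.ab, h1], by rw [← C.ac, h2]⟩
  · rw [C.a_it] at h
    have := C.charZero
    exact C.it_ne_zero (self_eq_neg.mp h.symm)

include hm in
lemma hasNormForm_Fm : HasNormForm Fm (-(p₁ * p₂)) := by
  obtain ⟨f, g, hfg⟩ := C.exists_rel_rat_Fm hm
  refine hasNormForm_quadratic hfg (δ := C.i * C.t) ?_ C.it_ne_zero (C.it_mem_Fm hm) C.a_it
  rw [C.it_sq]
  push_cast
  rfl

include C in
lemma not_sq_dvd_neg_d : ¬ (p₁ : ℤ) ^ 2 ∣ -(p₁ * p₂) := by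
  rw [dvd_neg]
  exact C.not_sq_dvd_d

include h₂ hm in
lemma hasNormForm_F2 : HasNormForm F2 (-(p₁ * p₂)) := by
  obtain ⟨f, g, hfg⟩ := C.exists_rel_Fm_F2 h₂ hm
  exact .of_quadExt hfg.quad (C.hasNormForm_Fm hm)

include hm in
lemma absNorm_two_Fm : Ideal.absNorm (Ideal.span {(2 : 𝓞 Fm)}) = 4 := by
  obtain ⟨f, g, hfg⟩ := C.exists_rel_rat_Fm hm
  have := hfg.quad.absNorm_span_natCast (p := 2) (k := 1) (by rw [absNorm_span_natCast_rat, pow_one])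
  exact_mod_cast this

section

variable {s θ : 𝓞 F2} (hs : intHom ι₂ s = C.s) (hθ : intHom ι₂ θ = C.θ)
  {δ : 𝓞 Fm} (hδ : intHom ιm δ = C.i * C.t)

include h₂ hm hs in
lemma absNorm_s_F2 : Ideal.absNorm (Ideal.span {s}) = 4 := by
  obtain ⟨f, g, hfg⟩ := C.exists_rel_Fm_F2 h₂ hm
  rw [hfg.quad.absNorm_span (y := -2), Ideal.span_singleton_neg, C.absNorm_two_Fm hm]
  apply intHom_injective ι₂
  rw [hfg.int_base, map_mul, hfg.int_conj, hs, C.cs, map_neg, map_ofNat]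
  linear_combination C.s2

include hs hθ in
/-- The square of the prime of `ℚ(√2, √(-p₁p₂))` above 2. -/
lemma prime_F2_sq : (Ideal.span {s} ⊔ Ideal.span {θ - 1}) ^ 2 = Ideal.span {s} := by
  obtain ⟨μ, -, hμ⟩ := C.exists_θ
  have hs2 : s ^ 2 = 2 := intHom_injective ι₂ (by rw [map_pow, hs, C.s2, map_ofNat])
  have hθ2 : (θ - 1) ^ 2 = s * (θ - s * (θ + 2 * μ)) := intHom_injective ι₂ (by
    simp only [map_pow, map_sub, map_mul, map_add, map_one, hs, hθ, map_ofNat, map_natCast]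
    linear_combination hμ + (C.θ + 2 * μ) * C.s2)
  rw [sq (Ideal.span {s} ⊔ _), Ideal.sup_mul, Ideal.mul_sup, Ideal.mul_sup]
  simp only [Ideal.span_singleton_mul_span_singleton]
  rw [← sq (θ - 1), hθ2]
  apply le_antisymm
  · simp only [sup_le_iff, Ideal.span_singleton_le_span_singleton]
    exact ⟨⟨dvd_mul_right _ _, dvd_mul_right _ _⟩, dvd_mul_left _ _, dvd_mul_right _ _⟩
  · have h1 : s * (θ - s * (θ + 2 * μ)) + s * s * (θ + 2 * μ) - s * (θ - 1) ∈
        Ideal.span {s * s} ⊔ Ideal.span {s * (θ - 1)} ⊔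
        (Ideal.span {(θ - 1) * s} ⊔ Ideal.span {s * (θ - s * (θ + 2 * μ))}) :=
      sub_mem (add_mem
        (Ideal.mem_sup_right (Ideal.mem_sup_right (Ideal.mem_span_singleton_self _)))
        (Ideal.mem_sup_left (Ideal.mem_sup_left
          (Ideal.mul_mem_right _ _ (Ideal.mem_span_singleton_self _)))))
        (Ideal.mem_sup_left (Ideal.mem_sup_right (Ideal.mem_span_singleton_self _)))
    rwa [show s * (θ - s * (θ + 2 * μ)) + s * s * (θ + 2 * μ) - s * (θ - 1) = s by ring,
      ← Ideal.span_singleton_le_iff_mem] at h1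

include h₂ hm hs hθ in
lemma absNorm_prime_F2 : Ideal.absNorm (Ideal.span {s} ⊔ Ideal.span {θ - 1}) = 2 := by
  have := congrArg Ideal.absNorm (C.prime_F2_sq hs hθ)
  rw [map_pow, C.absNorm_s_F2 h₂ hm hs, show 4 = 2 ^ 2 from rfl] at this
  exact (pow_left_inj₀ zero_le zero_le two_ne_zero).mp this

include hδ in
lemma prime_Fm_sq : (Ideal.span {2} ⊔ Ideal.span {1 + δ}) ^ 2 = Ideal.span {2} := by
  obtain ⟨μ, hd, -⟩ := C.exists_θ
  have hδ2 : (1 + δ) * (1 + δ) = 2 * (δ - 4 * μ) := intHom_injective ιm (by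
    have h2 : (p₁ : K) * p₂ = 8 * μ + 1 := by exact_mod_cast congrArg (Nat.cast (R := K)) hd
    simp only [map_sub, map_mul, map_add, map_one, hδ, map_ofNat, map_natCast]
    linear_combination C.it_sq - h2)
  rw [sq (Ideal.span {2} ⊔ _), Ideal.sup_mul, Ideal.mul_sup, Ideal.mul_sup]
  simp only [Ideal.span_singleton_mul_span_singleton]
  rw [hδ2]
  apply le_antisymm
  · simp only [sup_le_iff, Ideal.span_singleton_le_span_singleton]
    exact ⟨⟨dvd_mul_right _ _, dvd_mul_right _ _⟩, dvd_mul_left _ _, dvd_mul_right _ _⟩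
  · have h1 : 2 * (1 + δ) - 2 * 2 * (2 * μ) - 2 * (δ - 4 * μ) ∈
        Ideal.span {(2 * 2 : 𝓞 Fm)} ⊔ Ideal.span {2 * (1 + δ)} ⊔
        (Ideal.span {(1 + δ) * 2} ⊔ Ideal.span {2 * (δ - 4 * μ)}) :=
      sub_mem (sub_mem
        (Ideal.mem_sup_left (Ideal.mem_sup_right (Ideal.mem_span_singleton_self _)))
        (Ideal.mem_sup_left (Ideal.mem_sup_left
          (Ideal.mul_mem_right _ _ (Ideal.mem_span_singleton_self _)))))
        (Ideal.mem_sup_right (Ideal.mem_sup_right (Ideal.mem_span_singleton_self _)))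
    rwa [show 2 * (1 + δ) - 2 * 2 * (2 * μ) - 2 * (δ - 4 * μ) = 2 by ring,
      ← Ideal.span_singleton_le_iff_mem] at h1

end

end Octic

lemma mem_zpowers_of_sq_eq_one {G : Type*} [Group G] {t x : G} (ht : t ^ 2 = 1)
    (hx : x ∈ Subgroup.zpowers t) : x = 1 ∨ x = t := by
  obtain ⟨k, rfl⟩ := Subgroup.mem_zpowers_iff.mp hx
  rcases Int.even_or_odd' k with ⟨l, rfl | rfl⟩
  · left
    rw [zpow_mul, zpow_ofNat, ht, one_zpow]
  · right
    rw [zpow_add, zpow_mul, zpow_ofNat, ht, one_zpow, one_mul, zpow_one]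

lemma idealClass_sq_eq_one {L : Type*} [Field L] [NumberField L] {I : Ideal (𝓞 L)} {x : 𝓞 L}
    (hx : x ≠ 0) (h : I ^ 2 = Ideal.span {x}) : idealClass I ^ 2 = 1 := by
  have hI : I ≠ 0 := by
    rintro rfl
    rw [zero_pow two_ne_zero] at h
    exact span_ne_zero hx h.symm
  rw [← idealClass_pow hI, h, idealClass_span hx]

namespace Octic

variable {p₁ p₂ : ℕ} {K : Type*} [Field K] [NumberField K] (C : Octic p₁ p₂ K)
  {F2 : Type*} [Field F2] [NumberField F2] {ι₂ : F2 →+* K}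
  (h₂ : ∀ x, x ∈ ι₂.range ↔ C.a (C.b x) = x)
  {Fm : Type*} [Field Fm] [NumberField Fm] {ιm : Fm →+* K}
  (hm : ∀ x, x ∈ ιm.range ↔ C.a (C.b x) = x ∧ C.c x = x)
  {s θ : 𝓞 F2} (hs : intHom ι₂ s = C.s) (hθ : intHom ι₂ θ = C.θ)
  {δ : 𝓞 Fm} (hδ : intHom ιm δ = C.i * C.t)
  {f : Fm →+* F2} {g : F2 →+* F2} (hfg : QuadRel ιm ι₂ C.c f g)

include hs in
lemma s_F2_ne_zero : s ≠ 0 := by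
  rintro rfl
  exact C.s_ne_zero (by rw [← hs, map_zero])

include hs hθ in
lemma idealClass_prime_F2_sq : idealClass (Ideal.span {s} ⊔ Ideal.span {θ - 1}) ^ 2 = 1 :=
  idealClass_sq_eq_one (C.s_F2_ne_zero hs) (C.prime_F2_sq hs hθ)

include hδ in
lemma idealClass_prime_Fm_sq : idealClass (Ideal.span {2} ⊔ Ideal.span {1 + δ}) ^ 2 = 1 :=
  idealClass_sq_eq_one two_ne_zero (C.prime_Fm_sq hδ)

include h₂ hm hs hθ hfg in
lemma mem_of_invariant_F2 {r : ℕ} (hr : Odd r)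
    (hrm : ∀ y : ClassGroup (𝓞 Fm), y ^ r ∈ twoPart (ClassGroup (𝓞 Fm)))
    {x : ClassGroup (𝓞 F2)} (hx : x ∈ twoPart (ClassGroup (𝓞 F2))) (hgx : classMap g x = x) :
    ∃ y ∈ twoPart (ClassGroup (𝓞 Fm)), x = classMap f y ∨
      x = classMap f y * idealClass (Ideal.span {s} ⊔ Ideal.span {θ - 1}) := by
  set 𝔱 := Ideal.span {s} ⊔ Ideal.span {θ - 1} with h𝔱
  have hmem : x ∈ (twoPart (ClassGroup (𝓞 Fm))).map (classMap f) ⊔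
      Subgroup.zpowers (idealClass 𝔱) := by
    refine hfg.quad.mem_of_invariant_twoPart (hfg.unit_norm fun u hu huu x _ hxu => ?_) hr hrm _
      (fun y hy => Subgroup.mem_sup_left (Subgroup.mem_map_of_mem _ hy)) (fun P hP hP0 _ hram => ?_) hx hgx
    · obtain ⟨hab, hc⟩ := (hm _).mp hu
      obtain ⟨l, hl⟩ := C.exists_eq_e₂_zpow huu hab
      have he : C.e₂ ∈ ι₂.range := (h₂ _).mpr (by rw [C.b₂, C.a₂])
      have h1 : u = 1 ∨ u = -1 := by
        have hb : C.b u = u := by rcases hl with rfl | rfl <;> simp [map_zpow₀, C.b₂]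
        rw [hb] at hab
        exact C.rat_unit huu hab hb hc
      rcases h1 with rfl | rfl
      · exact ⟨1, one_mem _, .one, by rw [map_one, one_mul]⟩
      · exact ⟨C.e₂, he, C.unit₂, C.norm₂.symm⟩
    · refine Subgroup.mem_sup_right (Subgroup.pow_mem _ ?_ r)
      obtain ⟨μ, -, hμ⟩ := C.exists_θ
      have h1 : s - RingOfIntegers.mapRingHom g s = s ^ 3 := intHom_injective ι₂ (by
        rw [map_sub, hfg.int_conj, map_pow, hs, C.cs]
        linear_combination -C.s * C.s2)
      have h2 : s ∈ P := hP.mem_of_pow_mem 3 (h1 ▸ hram s)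
      have hθ2 : (θ - 1) ^ 2 = s * (θ - s * (θ + 2 * μ)) := intHom_injective ι₂ (by
        simp only [map_pow, map_sub, map_mul, map_add, map_one, hs, hθ, map_ofNat, map_natCast]
        linear_combination hμ + (C.θ + 2 * μ) * C.s2)
      have h3 : θ - 1 ∈ P := hP.mem_of_pow_mem 2 (hθ2 ▸ P.mul_mem_right _ h2)
      rw [eq_of_le_of_absNorm_eq_two hP (sup_le ((Ideal.span_singleton_le_iff_mem P).mpr h2)
        ((Ideal.span_singleton_le_iff_mem P).mpr h3)) (C.absNorm_prime_F2 h₂ hm hs hθ)]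
      exact Subgroup.mem_zpowers _
  obtain ⟨_, ⟨y, hy, rfl⟩, z, hz, rfl⟩ := Subgroup.mem_sup.mp hmem
  refine ⟨y, hy, ?_⟩
  rcases mem_zpowers_of_sq_eq_one (C.idealClass_prime_F2_sq hs hθ) hz with rfl | rfl
  · left
    rw [mul_one]
  · right
    rfl

include hs hδ hfg in
lemma extIdeal_prime_Fm :
    extIdeal f (Ideal.span {2} ⊔ Ideal.span {1 + δ}) = Ideal.span {s} := by
  apply ideal_eq_of_sq_eq
  rw [← extIdeal_pow, C.prime_Fm_sq hδ, extIdeal_span, Ideal.span_singleton_pow, map_ofNat]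
  congr 2
  exact intHom_injective ι₂ (by rw [map_pow, hs, C.s2, map_ofNat])

lemma prime_Fm_ne_zero : Ideal.span {2} ⊔ Ideal.span {1 + δ} ≠ 0 :=
  span_sup_span_ne_zero two_ne_zero

include hm hδ in
lemma idealClass_prime_Fm_ne_one : idealClass (Ideal.span {2} ⊔ Ideal.span {1 + δ}) ≠ 1 := by
  intro h
  rw [← idealClass_one] at h
  refine (C.hasNormForm_Fm hm).absNorm_mul_ne C.prime₁ C.mod₁ ?_ C.not_sq_dvd_neg_d
    prime_Fm_ne_zero one_ne_zero h (w := 1) ?_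
  · exact (dvd_mul_right _ _).neg_right
  · have := congrArg Ideal.absNorm (C.prime_Fm_sq hδ)
    rw [map_pow, C.absNorm_two_Fm hm, show 4 = 2 ^ 2 from rfl] at this
    rw [(pow_left_inj₀ zero_le zero_le two_ne_zero).mp this, map_one]
    norm_num

include h₂ hm hs hδ hfg in
lemma classMap_Fm_F2_eq_one {x : ClassGroup (𝓞 Fm)} : classMap f x = 1 ↔
    x = 1 ∨ x = idealClass (Ideal.span {2} ⊔ Ideal.span {1 + δ}) := by
  have h𝔱 := C.extIdeal_prime_Fm hs hδ hfg
  constructor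
  · intro hx
    refine (hfg.quad.class_ker (C.s_F2_ne_zero hs) (hfg.unit_hilbert90 fun u hu huu hN => ?_)
      hx).imp_right ?_
    · obtain ⟨k, hk⟩ := C.exists_eq_e₂_zpow huu ((h₂ _).mp hu)
      have := C.charZero
      have hk1 : C.e₂ ^ k * C.c (C.e₂ ^ k) = 1 := by
        rcases hk with rfl | rfl
        · exact hN
        · rwa [map_neg, neg_mul_neg] at hN
      obtain ⟨l, hl⟩ := norm_pow_zpow C.norm₂ hk1 C.neg_one_ne_one
      have he : C.e₂ ^ l ∈ ι₂.range := (h₂ _).mpr (by simp only [map_zpow₀, C.b₂, C.a₂])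
      have h1 : C.e₂ ^ l * C.c (C.e₂ ^ l) = 1 ∨ C.e₂ ^ l * C.c (C.e₂ ^ l) = -1 := by
        rw [← sq_eq_one_iff, mul_pow, ← map_pow, ← hl, hk1]
      refine ⟨_, he, C.unit₂.zpow l, ?_⟩
      rw [hs, map_mul, C.cs]
      rcases hk with rfl | rfl <;> rcases h1 with h1 | h1 <;> rw [hl]
      · left
        linear_combination C.e₂ ^ l * h1
      · right
        linear_combination -C.e₂ ^ l * C.s * h1
      · right
        linear_combination C.e₂ ^ l * C.s * h1
      · left
        linear_combination -C.e₂ ^ l * h1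
    · rintro ⟨J, hJ, hJs, rfl⟩
      rw [extIdeal_injective f (hJs.trans h𝔱.symm), inv_eq_iff_mul_eq_one, ← sq,
        C.idealClass_prime_Fm_sq hδ]
  · rintro (rfl | rfl)
    · exact map_one _
    · rw [classMap_idealClass _ prime_Fm_ne_zero, h𝔱, idealClass_span (C.s_F2_ne_zero hs)]

end Octic

namespace Octic

variable {p₁ p₂ : ℕ} {K : Type*} [Field K] [NumberField K] (C : Octic p₁ p₂ K)
  {F2 : Type*} [Field F2] [NumberField F2] {ι₂ : F2 →+* K}
  (h₂ : ∀ x, x ∈ ι₂.range ↔ C.a (C.b x) = x)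
  {s θ : 𝓞 F2} (hs : intHom ι₂ s = C.s) (hθ : intHom ι₂ θ = C.θ)
  {z : 𝓞 K} (hz : intHom (RingHom.id K) z = C.ζ)

include h₂ in
lemma exists_rel_F2_K : ∃ f g, QuadRel ι₂ (RingHom.id K) (C.a.comp C.b) f g := by
  refine exists_quadRel _ _ _ (fun x => ?_) (fun x => ?_) (fun x _ => ?_) ⟨C.t, ?_, fun h => ?_⟩
  · rw [h₂]
    simp
  · simp [← C.ab, C.aa, C.bb]
  · simp
  · simp
  · rw [RingHom.comp_apply, C.abt] at h
    have := C.charZero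
    exact C.t_ne_zero (self_eq_neg.mp h.symm)

variable {f : F2 →+* K} {g : K →+* K} (hfg : QuadRel ι₂ (RingHom.id K) (C.a.comp C.b) f g)

include h₂ hfg in
lemma exists_classMap_F2_K_eq {r : ℕ} (hr : Odd r)
    (hrF : ∀ y : ClassGroup (𝓞 F2), y ^ r ∈ twoPart (ClassGroup (𝓞 F2)))
    {x : ClassGroup (𝓞 K)} (hx : x ∈ twoPart (ClassGroup (𝓞 K))) (hgx : classMap g x = x) :
    ∃ y ∈ twoPart (ClassGroup (𝓞 F2)), classMap f y = x := by
  refine hfg.quad.mem_of_invariant_twoPart (hfg.unit_norm fun u hu huu x _ hxu => ?_) hr hrF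
    ((twoPart (ClassGroup (𝓞 F2))).map (classMap f))
    (fun y hy => Subgroup.mem_map_of_mem _ hy) (fun P hP hP0 _ hram => ?_) hx hgx
  · obtain ⟨k, hk⟩ := C.exists_eq_e₂_zpow huu ((h₂ _).mp hu)
    obtain ⟨v, -, hv, huv⟩ := exists_norm_of_zpow (R := ⊤) (τ := C.a.comp C.b)
      (e := C.e₂) (f := C.eₚ) (g := C.η) trivial trivial
      C.unitₚ C.unitη (by rw [RingHom.comp_apply, C.bₚ, C.normₚ])
      (by rw [RingHom.comp_apply, C.bη]; exact C.norm_aη) hk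
    exact ⟨v, ⟨v, rfl⟩, hv, huv⟩
  · exfalso
    obtain ⟨i, hi⟩ := exists_intHom_eq (RingHom.id K) (x := C.i) ⟨_, rfl⟩ C.integral_i
    obtain ⟨w, hw⟩ := exists_intHom_eq (RingHom.id K) (x := C.ω) ⟨_, rfl⟩ C.integral_ω
    have h1 : (2 : 𝓞 K) * i ∈ P := by
      convert hram i using 1
      exact intHom_injective (RingHom.id K) (by
        rw [map_mul, map_sub, hfg.int_conj, hi, RingHom.comp_apply, C.abi, map_ofNat]
        ring)
    have h2 : (2 : 𝓞 K) ∈ P := by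
      convert P.mul_mem_left (-i) h1 using 1
      exact intHom_injective (RingHom.id K) (by
        simp only [map_mul, map_neg, hi, map_ofNat]
        linear_combination 2 * C.i2)
    have h3 : 2 * w - 1 ∈ P := by
      convert hram w using 1
      exact intHom_injective (RingHom.id K) (by
        rw [map_sub, map_sub, map_mul, map_one, hfg.int_conj, hw, RingHom.comp_apply, C.bω, C.aω,
          map_ofNat]
        ring)
    refine hP.ne_top ((Ideal.eq_top_iff_one _).mpr ?_)
    convert sub_mem (P.mul_mem_right w h2) h3 using 1
    ring

lemma prime_F2_ne_zero (hs0 : s ≠ 0) : Ideal.span {s} ⊔ Ideal.span {θ - 1} ≠ 0 :=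
  span_sup_span_ne_zero hs0

include hs hθ hz hfg in
lemma extIdeal_prime_F2 :
    extIdeal f (Ideal.span {s} ⊔ Ideal.span {θ - 1}) = Ideal.span {1 - z} := by
  apply ideal_eq_of_sq_eq
  have h4 : z ^ 4 = -1 := intHom_injective (RingHom.id K) (by
    rw [map_pow, hz, C.ζ4, map_neg, map_one])
  have h1 : RingOfIntegers.mapRingHom f s = (1 - z) ^ 2 * (z ^ 3 * (1 + z - z ^ 3)) :=
    intHom_injective (RingHom.id K) (by
      simp only [hfg.int_base, map_mul, map_sub, map_one, map_add, map_pow, hz, hs]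
      exact C.s_eq)
  rw [← extIdeal_pow, C.prime_F2_sq hs hθ, extIdeal_span, Ideal.span_singleton_pow, h1,
    Ideal.span_singleton_mul_right_unit]
  refine IsUnit.of_mul_eq_one (-z * (z - z ^ 3 - 1)) ?_
  linear_combination (-z ^ 6 + 2 * z ^ 4 - 1) * h4

include hs hθ hz hfg in
lemma classMap_F2_K_eq_one {x : ClassGroup (𝓞 F2)} : classMap f x = 1 ↔
    x = 1 ∨ x = idealClass (Ideal.span {s} ⊔ Ideal.span {θ - 1}) := by
  have h𝔱 := C.extIdeal_prime_F2 hs hθ hz hfg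
  constructor
  · intro hx
    refine (hfg.quad.class_ker (C.one_sub_ne_zero hz) (hfg.unit_hilbert90 fun u _ huu hN => ?_)
      hx).imp_right ?_
    · obtain ⟨v, hv, h⟩ := C.unit_hilbert90_ab huu hN
      refine ⟨v, ⟨v, rfl⟩, hv, h.imp id fun h => ?_⟩
      rw [map_sub, map_one, hz]
      exact h
    · rintro ⟨J, hJ, hJs, rfl⟩
      rw [extIdeal_injective f (hJs.trans h𝔱.symm), inv_eq_iff_mul_eq_one, ← sq,
        C.idealClass_prime_F2_sq hs hθ]
  · rintro (rfl | rfl)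
    · exact map_one _
    · rw [classMap_idealClass _ (prime_F2_ne_zero (C.s_F2_ne_zero hs)), h𝔱,
        idealClass_span (C.one_sub_ne_zero hz)]

end Octic

lemma exists_prime_sqrt_neg_mul {p₁ p₂ : ℕ} (h₁ : p₁.Prime) (h₂ : p₂.Prime) (hne : p₁ ≠ p₂)
    (hm₁ : p₁ % 8 = 5) (hm₂ : p₂ % 8 = 5) :
    ∃ q : ℕ, q.Prime ∧ q % 8 = 7 ∧ (∃ α : ℤ, (q : ℤ) ∣ α ^ 2 - 2) ∧
      (∃ β : ℤ, (q : ℤ) ∣ β ^ 2 - -(p₁ * p₂)) ∧ ¬ q ∣ p₁ * p₂ := by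
  have := Fact.mk h₁
  have := Fact.mk h₂
  have c8 : ∀ p : ℕ, p % 8 = 5 → Nat.Coprime 8 p := fun p hp => by
    rw [show 8 = 2 ^ 3 from rfl]
    exact Nat.Coprime.pow_left 3 (Nat.coprime_two_left.mpr (Nat.odd_iff.mpr (by lia)))
  have c12 : Nat.Coprime p₁ p₂ := (Nat.coprime_primes h₁ h₂).mpr hne
  obtain ⟨ν, hν⟩ := FiniteField.exists_nonsquare (F := ZMod p₂) (by
    rw [ZMod.ringChar_zmod_n]
    lia)
  have hν0 : ν ≠ 0 := fun h => hν (h ▸ IsSquare.zero)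
  obtain ⟨x₁, hx8, hx1⟩ := Nat.chineseRemainder (c8 _ hm₁) 7 1
  obtain ⟨x, hx, hx2⟩ := Nat.chineseRemainder (Nat.Coprime.mul_left (c8 _ hm₂) c12) x₁ ν.val
  have hx8 : x ≡ 7 [MOD 8] := (hx.of_mul_right p₁).trans hx8
  have hx1 : x ≡ 1 [MOD p₁] := (hx.of_mul_left 8).trans hx1
  have hcop : Nat.Coprime x (8 * p₁ * p₂) := by
    refine Nat.Coprime.mul_right (Nat.Coprime.mul_right ?_ ?_) ?_
    · rw [Nat.Coprime, hx8.gcd_eq]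
      rfl
    · rw [Nat.Coprime, hx1.gcd_eq]
      exact Nat.gcd_one_left _
    · rw [Nat.Coprime, hx2.gcd_eq]
      exact ((Nat.Prime.coprime_iff_not_dvd h₂).mpr fun h => hν0
        (by rw [← ZMod.natCast_zmod_val ν]; exact (ZMod.natCast_eq_zero_iff _ _).mpr h)).symm
  have : NeZero (8 * p₁ * p₂) := ⟨by simp [h₁.ne_zero, h₂.ne_zero]⟩
  obtain ⟨q, hq1, hq, hqx⟩ := Nat.forall_exists_prime_gt_and_eq_mod
    ((ZMod.isUnit_iff_coprime _ _).mpr hcop) (p₁ + p₂)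
  have := Fact.mk hq
  have hqx := (ZMod.natCast_eq_natCast_iff _ _ _).mp hqx
  have hq8 : q ≡ 7 [MOD 8] := ((hqx.of_mul_right p₂).of_mul_right p₁).trans hx8
  have hqp1 : q ≡ 1 [MOD p₁] := ((hqx.of_mul_right p₂).of_mul_left 8).trans hx1
  have hqp2 : q ≡ ν.val [MOD p₂] := (hqx.of_mul_left _).trans hx2
  have hq7 : q % 8 = 7 := hq8
  have hq2 : q ≠ 2 := by lia
  have hlift : ∀ D : ℤ, IsSquare (D : ZMod q) → ∃ α : ℤ, (q : ℤ) ∣ α ^ 2 - D := by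
    rintro D ⟨y, hy⟩
    refine ⟨y.val, (ZMod.intCast_zmod_eq_zero_iff_dvd _ _).mp ?_⟩
    push_cast
    rw [ZMod.natCast_zmod_val, hy]
    ring
  have hnd : ¬ q ∣ p₁ * p₂ := fun h => by
    rcases (Nat.Prime.dvd_mul hq).mp h with h | h
    · have := Nat.le_of_dvd h₁.pos h
      lia
    · have := Nat.le_of_dvd h₂.pos h
      lia
  refine ⟨q, hq, hq7, hlift 2 ?_, hlift _ ?_, hnd⟩
  · exact_mod_cast (ZMod.exists_sq_eq_two_iff hq2).mpr (Or.inr hq7)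
  · rw [← legendreSym.eq_one_iff, neg_eq_neg_one_mul, legendreSym.mul, legendreSym.mul,
      legendreSym.at_neg_one hq2, ZMod.χ₄_nat_three_mod_four (by lia),
      legendreSym.quadratic_reciprocity_one_mod_four (by lia) hq2,
      legendreSym.quadratic_reciprocity_one_mod_four (by lia) hq2]
    · have e1 : legendreSym p₁ q = 1 := by
        rw [legendreSym, Int.cast_natCast, (ZMod.natCast_eq_natCast_iff _ _ _).mpr hqp1, Nat.cast_one,
          map_one]
      have e2 : legendreSym p₂ q = -1 := by
        rw [legendreSym.eq_neg_one_iff, Int.cast_natCast, (ZMod.natCast_eq_natCast_iff _ _ _).mpr hqp2,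
          ZMod.natCast_zmod_val]
        exact hν
      rw [e1, e2]
      norm_num
    · intro h
      refine hnd ((ZMod.natCast_eq_zero_iff _ _).mp ?_)
      push_cast at h ⊢
      exact neg_eq_zero.mp h

namespace QuadExt

lemma exists_split {F L : Type*} [Field F] [NumberField F] [Field L] [NumberField L]
    {f : F →+* L} {g : L →+* L} (h : QuadExt f g) {q : ℕ} (hq : q.Prime) (hq2 : q ≠ 2)
    {I : Ideal (𝓞 F)} (hI : (q : 𝓞 F) ∈ I) {δ : 𝓞 L} (hδ : RingOfIntegers.mapRingHom g δ = -δ)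
    {D : ℤ} (hD : δ ^ 2 = D) (hqD : ¬ (q : ℤ) ∣ D) {β : ℤ} (hβ : (q : ℤ) ∣ β ^ 2 - D) :
    ∃ J : Ideal (𝓞 L), (q : 𝓞 L) ∈ J ∧ Ideal.absNorm J = Ideal.absNorm I := by
  have hqI : (q : 𝓞 L) ∈ extIdeal f I := by
    have : RingOfIntegers.mapRingHom f (q : 𝓞 F) ∈ extIdeal f I := Ideal.mem_map_of_mem _ hI
    rwa [map_natCast] at this
  refine ⟨_, Ideal.mem_sup_left hqI, h.absNorm_split (e := δ - (β : 𝓞 L)) ?_ ?_⟩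
  · obtain ⟨c, hc⟩ := hβ
    have h1 : (β : 𝓞 L) ^ 2 - (D : 𝓞 L) = q * c := by exact_mod_cast congrArg (Int.cast (R := 𝓞 L)) hc
    rw [map_sub, map_intCast, hδ, show (δ - (β : 𝓞 L)) * (-δ - β) = q * c by
      linear_combination h1 - hD]
    exact Ideal.mul_mem_right _ _ hqI
  · have hβ2 : ¬ (q : ℤ) ∣ -(2 * β) := by
      rw [dvd_neg, (Nat.prime_iff_prime_int.mp hq).dvd_mul, not_or]
      refine ⟨fun h => hq2 ((Nat.prime_dvd_prime_iff_eq hq Nat.prime_two).mp (by exact_mod_cast h)),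
        fun h => hqD ?_⟩
      have := dvd_sub (h.trans (dvd_pow_self β two_ne_zero)) hβ
      rwa [sub_sub_cancel] at this
    obtain ⟨u, v, huv⟩ :=
      (Prime.coprime_iff_not_dvd (Nat.prime_iff_prime_int.mp hq)).mpr hβ2
    refine ⟨u * q, Ideal.mul_mem_left _ _ hqI, v, ?_⟩
    have h1 : (u : 𝓞 L) * q + v * (-(2 * β)) = 1 := by
      exact_mod_cast congrArg (Int.cast (R := 𝓞 L)) huv
    rw [map_sub, map_intCast, hδ]
    linear_combination h1

end QuadExt

namespace Octic

variable {p₁ p₂ : ℕ} {K : Type*} [Field K] [NumberField K] (C : Octic p₁ p₂ K)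
  {F2 : Type*} [Field F2] [NumberField F2] {ι₂ : F2 →+* K}
  (h₂ : ∀ x, x ∈ ι₂.range ↔ C.a (C.b x) = x)
  {Fm : Type*} [Field Fm] [NumberField Fm] {ιm : Fm →+* K}
  (hm : ∀ x, x ∈ ιm.range ↔ C.a (C.b x) = x ∧ C.c x = x)
  {M : Type*} [Field M] [NumberField M] {ιM : M →+* K}
  (hM : ∀ x, x ∈ ιM.range ↔ C.a (C.b x) = x ∧ C.a (C.c x) = x)
  {s : 𝓞 F2} (hs : intHom ι₂ s = C.s) {δ : 𝓞 Fm} (hδ : intHom ιm δ = C.i * C.t)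

lemma sit_ne_zero : C.s * (C.i * C.t) ≠ 0 := mul_ne_zero C.s_ne_zero C.it_ne_zero

include hM in
lemma hasNormForm_M : HasNormForm M (-(2 * (p₁ * p₂))) := by
  have := C.charZero
  have hr : C.s * (C.i * C.t) ∈ ιM.range := (hM _).mpr ⟨by
    rw [map_mul, map_mul, map_mul, map_mul, C.abi, C.abt, C.abs]
    ring, by
    rw [map_mul, map_mul, C.cs, map_mul, C.ci, C.ct, map_neg, C.as, C.a_it]
    ring⟩
  have ha : C.a (C.s * (C.i * C.t)) = -(C.s * (C.i * C.t)) := by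
    rw [map_mul, C.as, C.a_it, mul_neg]
  obtain ⟨f, g, hfg⟩ : ∃ f g, QuadRel (Rat.castHom K) ιM C.a f g := by
    refine exists_quadRel _ _ _ (fun x => ?_) C.aa (fun x => ?_) ⟨_, hr, fun h => ?_⟩
    · rw [C.rat_range, hM]
      constructor
      · rintro ⟨h1, h2, h3⟩
        exact ⟨⟨by rw [h2, h1], by rw [h3, h1]⟩, h1⟩
      · rintro ⟨⟨h1, h2⟩, h3⟩
        exact ⟨h3, by rw [C.ab, h3] at h1; exact h1, by rw [C.ac, h3] at h2; exact h2⟩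
    · simp only [hM]
      rintro ⟨h1, h2⟩
      exact ⟨by rw [← C.ab, h1], by rw [← C.ac, h2]⟩
    · rw [ha] at h
      exact C.sit_ne_zero (self_eq_neg.mp h.symm)
  refine hasNormForm_quadratic hfg (δ := C.s * (C.i * C.t)) ?_ C.sit_ne_zero hr ha
  rw [mul_pow, C.it_sq, C.s2]
  push_cast
  ring

include h₂ hM in
lemma hasNormForm_F2' : HasNormForm F2 (-(2 * (p₁ * p₂))) := by
  have := C.charZero
  obtain ⟨f, g, hfg⟩ : ∃ f g, QuadRel ιM ι₂ (C.a.comp C.c) f g := by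
    refine exists_quadRel _ _ _ (fun x => ?_) (fun x => ?_) (fun x => ?_)
      ⟨C.s, (h₂ _).mpr C.abs, fun h => ?_⟩
    · rw [hM, h₂, RingHom.comp_apply]
    · rw [RingHom.comp_apply, RingHom.comp_apply, ← C.ac, C.aa, C.cc]
    · simp only [h₂, RingHom.comp_apply]
      intro h1
      rw [← C.ab, C.bc, C.ac (C.b x), h1]
    · rw [RingHom.comp_apply, C.cs, map_neg, C.as] at h
      exact C.s_ne_zero (self_eq_neg.mp h.symm)
  exact .of_quadExt hfg.quad (C.hasNormForm_M hM)

include h₂ hm hs hδ in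
lemma exists_ideal_F2 : ∃ (q : ℕ) (R : Ideal (𝓞 F2)), q % 8 = 7 ∧ Ideal.absNorm R = q := by
  obtain ⟨q, hq, hq8, ⟨α, hα⟩, ⟨β, hβ⟩, hqd⟩ :=
    exists_prime_sqrt_neg_mul C.prime₁ C.prime₂ C.ne C.mod₁ C.mod₂
  obtain ⟨f, g, hfg⟩ := C.exists_rel_rat_Fm hm
  obtain ⟨f', g', hfg'⟩ := C.exists_rel_Fm_F2 h₂ hm
  have hq2 : q ≠ 2 := by lia
  obtain ⟨I, hI, hIn⟩ := hfg.quad.exists_split hq hq2 (Ideal.mem_span_singleton_self _) (δ := δ)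
    (intHom_injective ιm (by rw [hfg.int_conj, hδ, C.a_it, map_neg, hδ])) (D := -(p₁ * p₂))
    (intHom_injective ιm (by
      rw [map_pow, hδ, C.it_sq, map_intCast]
      push_cast
      rfl)) (by rw [dvd_neg]; exact_mod_cast hqd) hβ
  obtain ⟨J, hJ, hJn⟩ := hfg'.quad.exists_split hq hq2 hI (δ := s)
    (intHom_injective ι₂ (by rw [hfg'.int_conj, hs, C.cs, map_neg, hs])) (D := 2)
    (intHom_injective ι₂ (by
      rw [map_pow, hs, C.s2, map_intCast]
      push_cast
      rfl)) (fun h => hq2 ((Nat.prime_dvd_prime_iff_eq hq Nat.prime_two).mp (by exact_mod_cast h))) hα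
  exact ⟨q, J, hq8, by rw [hJn, hIn, absNorm_span_natCast_rat]⟩

end Octic

lemma Subgroup.card_ker_mul_card_map {G H : Type*} [Group G] [Group H] (φ : G →* H)
    {S V : Subgroup G} (hV : ∀ x, x ∈ V ↔ x ∈ S ∧ φ x = 1) :
    Nat.card V * Nat.card (S.map φ) = Nat.card S := by
  have h1 : (φ.comp S.subtype).ker = V.subgroupOf S := by
    ext x
    simp [Subgroup.mem_subgroupOf, hV]
  have h2 : V ≤ S := fun x hx => ((hV x).mp hx).1
  rw [← Subgroup.card_mul_index (φ.comp S.subtype).ker, Subgroup.index_ker, h1,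
    Nat.card_congr (Subgroup.subgroupOfEquivOfLe h2).toEquiv, MonoidHom.range_comp,
    Subgroup.range_subtype]

lemma Subgroup.card_eq_two_mul_card_map {G H : Type*} [Group G] [Group H] (φ : G →* H)
    {S : Subgroup G} {w : G} (hw : w ∈ S) (hw1 : w ≠ 1) (hw2 : w ^ 2 = 1)
    (hker : ∀ x ∈ S, φ x = 1 ↔ x = 1 ∨ x = w) : Nat.card S = 2 * Nat.card (S.map φ) := by
  rw [← Subgroup.card_ker_mul_card_map φ (V := Subgroup.zpowers w), Nat.card_zpowers,
    orderOf_eq_prime hw2 hw1]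
  intro x
  constructor
  · intro hx
    have hxS : x ∈ S := (Subgroup.zpowers_le.mpr hw) hx
    exact ⟨hxS, (hker x hxS).mpr (mem_zpowers_of_sq_eq_one hw2 hx)⟩
  · rintro ⟨hxS, hx⟩
    rcases (hker x hxS).mp hx with rfl | rfl
    · exact one_mem _
    · exact Subgroup.mem_zpowers _

lemma eq_pow_of_mem_zpowers {G : Type*} [Group G] {ξ x : G} {n : ℕ}
    (hξ : orderOf ξ = 2 ^ (n + 1)) (hx : x ∈ Subgroup.zpowers ξ) (hx2 : x ^ 2 = 1) :
    x = 1 ∨ x = ξ ^ 2 ^ n := by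
  obtain ⟨k, rfl⟩ := Subgroup.mem_zpowers_iff.mp hx
  rw [← zpow_natCast, ← zpow_mul, ← orderOf_dvd_iff_zpow_eq_one, hξ, pow_succ] at hx2
  push_cast at hx2
  obtain ⟨l, rfl⟩ := (mul_dvd_mul_iff_right two_ne_zero).mp hx2
  refine mem_zpowers_of_sq_eq_one ?_ (Subgroup.mem_zpowers_iff.mpr ⟨l, ?_⟩)
  · rw [← pow_mul, ← pow_succ, ← hξ, pow_orderOf_eq_one]
  · rw [← zpow_natCast, ← zpow_mul]
    push_cast
    rfl

/-- The structure of a 2-group with two commuting involutions, from their fixed points. -/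
theorem nonempty_addEquiv_of_involutions {G : Type*} [CommGroup G] [Finite G] {S : Subgroup G}
    (hS : S ≤ twoPart G) {b c : G →* G} {ξ : G} {n m : ℕ} (hξS : ξ ∈ S) (hbξ : b ξ = ξ)
    (hξ : orderOf ξ = 2 ^ (n + 2)) (hfix : ∀ x ∈ S, b x = x → x ∈ Subgroup.zpowers ξ)
    (hnorm : ∀ x ∈ S, x * b x ∈ Subgroup.zpowers (ξ ^ 2)) (hcc : ∀ x, c (c x) = x)
    (hcS : ∀ x ∈ S, c x ∈ S) (hbc : ∀ x, b (c x) = c (b x)) {W : Subgroup G}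
    (hW : ∀ x, x ∈ W ↔ x ∈ S ∧ b x = x⁻¹ ∧ c x = x) (hWm : Nat.card W = 2 ^ m) (hm : 2 ≤ m)
    (hmov : ∃ x ∈ S, b x = x⁻¹ ∧ c x ≠ x) :
    Nonempty (Additive S ≃+ ZMod (2 ^ min m (n + 1)) × ZMod (2 ^ max (m + 1) (n + 2))) := by
  let ψ : G →* G := MonoidHom.id G * b
  have hψ : ∀ x, ψ x = x * b x := fun x => rfl
  let V : Subgroup G := S ⊓ ψ.ker
  have hVψ : ∀ x, x ∈ V ↔ x ∈ S ∧ ψ x = 1 := fun x => Iff.rfl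
  have hV : ∀ x, x ∈ V ↔ x ∈ S ∧ b x = x⁻¹ := fun x => by
    rw [hVψ, hψ, mul_eq_one_iff_inv_eq, eq_comm (a := x⁻¹)]
  have h2 : ∀ x ∈ V, x ^ 2 = 1 → x = 1 ∨ x = ξ ^ 2 ^ (n + 1) := fun x hx hx2 => by
    obtain ⟨hxS, hbx⟩ := (hV x).mp hx
    refine eq_pow_of_mem_zpowers hξ (hfix x hxS ?_) hx2
    rw [hbx, inv_eq_iff_mul_eq_one, ← sq, hx2]
  have hWV : ∀ x, x ∈ W ↔ x ∈ V ∧ c x = x := fun x => by rw [hW, hV, and_assoc]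
  obtain ⟨hVcard, v, hv, hVv⟩ := card_eq_two_mul_card_fixed (inf_le_left.trans hS) h2 hcc
    (fun x hx => by
      obtain ⟨hxS, hbx⟩ := (hV x).mp hx
      exact (hV _).mpr ⟨hcS x hxS, by rw [hbc, hbx, map_inv]⟩)
    (by
      by_contra! hcon
      have h3 : (W : Set G) ⊆ {1, ξ ^ 2 ^ (n + 1)} := fun x hx => by
        obtain ⟨hxV, hcx⟩ := (hWV x).mp hx
        exact h2 x hxV (hcon x hxV hcx)
      have h4 := (Set.ncard_le_ncard h3).trans (Set.ncard_insert_le _ _)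
      rw [Set.ncard_singleton, ← Nat.card_coe_set_eq] at h4
      have h5 : 2 ^ 2 ≤ 2 ^ m := Nat.pow_le_pow_right two_pos hm
      rw [← hWm] at h5
      change Nat.card W ≤ 2 at h4
      lia)
    (by
      obtain ⟨x, hx, hbx, hcx⟩ := hmov
      exact ⟨x, (hV x).mpr ⟨hx, hbx⟩, hcx⟩) hWV
  rw [hWm, ← pow_succ'] at hVcard
  have hξ2 : orderOf (ξ ^ 2) = 2 ^ (n + 1) := by
    rw [orderOf_pow, hξ, pow_succ 2 (n + 1), Nat.gcd_mul_left_left, Nat.mul_div_cancel _ two_pos]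
  have hmap : S.map ψ = Subgroup.zpowers (ξ ^ 2) := by
    apply le_antisymm
    · rintro _ ⟨x, hx, rfl⟩
      exact hnorm x hx
    · rw [Subgroup.zpowers_le]
      exact ⟨ξ, hξS, by rw [hψ, hbξ, sq]⟩
  have hcard := Subgroup.card_ker_mul_card_map ψ hVψ
  rw [hmap, Nat.card_zpowers, hξ2, hVcard] at hcard
  have hvS : v ∈ S := ((hV v).mp hv).1
  have hVz : V = Subgroup.zpowers v := le_antisymm hVv (Subgroup.zpowers_le.mpr hv)
  have hvo : orderOf v = 2 ^ (m + 1) := by rw [← Nat.card_zpowers, ← hVz, hVcard]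
  have hgen : ∀ z ∈ S, ∃ i j : ℤ, z = ξ ^ i * v ^ j := fun z hz => by
    obtain ⟨k, hk⟩ := Subgroup.mem_zpowers_iff.mp (hnorm z hz)
    have h3 : (ξ ^ k)⁻¹ * z ∈ V := by
      refine (hVψ _).mpr ⟨mul_mem (inv_mem (zpow_mem hξS k)) hz, ?_⟩
      rw [map_mul, map_inv, hψ z, ← hk, map_zpow, hψ, hbξ, ← sq, inv_mul_cancel]
    obtain ⟨j, hj⟩ := Subgroup.mem_zpowers_iff.mp (hVv _ h3)
    exact ⟨k, j, by rw [hj, mul_inv_cancel_left]⟩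
  have hw : v ^ 2 ^ m = ξ ^ 2 ^ (n + 1) := by
    refine (h2 _ (pow_mem hv _) ?_).resolve_left fun h => ?_
    · rw [← pow_mul, ← pow_succ, ← hvo, pow_orderOf_eq_one]
    · rw [← orderOf_dvd_iff_pow_eq_one, hvo] at h
      exact absurd (Nat.le_of_dvd (by positivity) h)
        (not_le.mpr (Nat.pow_lt_pow_right one_lt_two (Nat.lt_succ_self m)))
  rcases le_total (m + 1) (n + 2) with h | h
  · rw [min_eq_left (by lia), max_eq_right h]
    exact nonempty_addEquiv_of_generators (s := m + 1) (by lia) h hvS hξS hw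
      (by rw [← hξ, pow_orderOf_eq_one])
      (fun z hz => by
        obtain ⟨i, j, h⟩ := hgen z hz
        exact ⟨j, i, by rw [h, mul_comm]⟩)
      (by rw [← hcard, Nat.add_sub_cancel]; ring)
  · rw [min_eq_right (by lia), max_eq_left h]
    exact nonempty_addEquiv_of_generators (s := n + 2) (by lia) h hξS hvS hw.symm
      (by rw [← hvo, pow_orderOf_eq_one]) hgen
      (by rw [← hcard]; exact mul_comm _ _)

lemma QuadRel.eq_of_id {F K : Type*} [Field F] [Field K] {ι : F →+* K} {γ : K →+* K} {f : F →+* K}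
    {g : K →+* K} (h : QuadRel ι (RingHom.id K) γ f g) : g = γ :=
  RingHom.ext h.conj

namespace Octic

variable {p₁ p₂ : ℕ} {K : Type*} [Field K] [NumberField K] (C : Octic p₁ p₂ K)
  {F2 : Type*} [Field F2] [NumberField F2] {ι₂ : F2 →+* K}
  (h₂ : ∀ x, x ∈ ι₂.range ↔ C.a (C.b x) = x)
  {Fm : Type*} [Field Fm] [NumberField Fm] {ιm : Fm →+* K}
  (hm : ∀ x, x ∈ ιm.range ↔ C.a (C.b x) = x ∧ C.c x = x)
  {s θ : 𝓞 F2} (hs : intHom ι₂ s = C.s) (hθ : intHom ι₂ θ = C.θ)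
  {δ : 𝓞 Fm} (hδ : intHom ιm δ = C.i * C.t)
  {z : 𝓞 K} (hz : intHom (RingHom.id K) z = C.ζ)
  {f₀ : Fm →+* F2} {g₀ : F2 →+* F2} (hfg₀ : QuadRel ιm ι₂ C.c f₀ g₀)
  {f : F2 →+* K} {g : K →+* K} (hfg : QuadRel ι₂ (RingHom.id K) (C.a.comp C.b) f g)

include hfg₀ hfg in
lemma classMap_c (y : ClassGroup (𝓞 F2)) :
    classMap C.c (classMap f y) = classMap f (classMap g₀ y) := by
  rw [classMap_comp, classMap_comp]
  congr 2
  ext x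
  have h1 : ∀ x, f x = ι₂ x := hfg.base
  rw [RingHom.comp_apply, RingHom.comp_apply, h1, h1, hfg₀.conj]

include hs hθ hz hfg in
lemma classMap_F2_eq_iff {y y' : ClassGroup (𝓞 F2)} : classMap f y = classMap f y' ↔
    y = y' ∨ y = y' * idealClass (Ideal.span {s} ⊔ Ideal.span {θ - 1}) := by
  rw [← inv_mul_eq_one, ← map_inv, ← map_mul, ← inv_inv (y⁻¹ * y'), map_inv, inv_eq_one,
    C.classMap_F2_K_eq_one hs hθ hz hfg, mul_inv_rev, inv_inv, inv_mul_eq_one, inv_mul_eq_iff_eq_mul,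
    eq_comm (a := y')]

include h₂ hm hs hθ hz hfg₀ hfg in
/-- The classes inverted by complex conjugation and fixed by `C.c` come from the imaginary quadratic
field. -/
lemma mem_minus_fixed_iff {r : ℕ} (hr : Odd r)
    (hrm : ∀ y : ClassGroup (𝓞 Fm), y ^ r ∈ twoPart (ClassGroup (𝓞 Fm)))
    (hr₂ : ∀ y : ClassGroup (𝓞 F2), y ^ r ∈ twoPart (ClassGroup (𝓞 F2)))
    (ha : ∀ x ∈ twoPart (ClassGroup (𝓞 K)), classMap C.a x = x⁻¹) (x : ClassGroup (𝓞 K)) :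
    x ∈ (twoPart (ClassGroup (𝓞 Fm))).map ((classMap f).comp (classMap f₀)) ↔
      x ∈ twoPart (ClassGroup (𝓞 K)) ∧ classMap C.b x = x⁻¹ ∧ classMap C.c x = x := by
  have hg := hfg.eq_of_id
  have hab : ∀ x, classMap g x = classMap C.a (classMap C.b x) := fun x => by
    rw [classMap_comp, hg]
  have hbA : ∀ x ∈ twoPart (ClassGroup (𝓞 K)), classMap C.b x ∈ twoPart (ClassGroup (𝓞 K)) :=
    fun x hx => map_mem_twoPart _ hx
  constructor
  · rintro ⟨y, hy, rfl⟩
    have hy' := map_mem_twoPart ((classMap f).comp (classMap f₀)) hy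
    have h1 := hab ((classMap f).comp (classMap f₀) y)
    rw [MonoidHom.comp_apply] at h1 hy' ⊢
    refine ⟨hy', ?_, ?_⟩
    · rw [hfg.quad.classMap_conj_base, ha _ (hbA _ hy')] at h1
      exact (inv_eq_iff_eq_inv.mpr h1).symm
    · rw [C.classMap_c hfg₀ hfg, hfg₀.quad.classMap_conj_base]
  · rintro ⟨hx, hbx, hcx⟩
    obtain ⟨y, hy, rfl⟩ := C.exists_classMap_F2_K_eq h₂ hfg hr hr₂ hx (by
      rw [hab, hbx, map_inv, ha _ hx, inv_inv])
    have hs0 := C.s_F2_ne_zero hs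
    rw [C.classMap_c hfg₀ hfg, C.classMap_F2_eq_iff hs hθ hz hfg] at hcx
    have hcy : classMap g₀ y = y := by
      refine hcx.resolve_right fun h => ?_
      obtain ⟨I, hI, rfl⟩ := exists_idealClass y
      rw [classMap_idealClass _ hI, ← idealClass_mul hI (prime_F2_ne_zero hs0)] at h
      refine (C.hasNormForm_F2 h₂ hm).absNorm_mul_ne C.prime₁ C.mod₁
        (dvd_mul_right _ _).neg_right C.not_sq_dvd_neg_d (extIdeal_ne_zero _ hI)
        (mul_ne_zero hI (prime_F2_ne_zero hs0)) h (w := Ideal.absNorm I) ?_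
      rw [hfg₀.quad.absNorm_conj, map_mul, C.absNorm_prime_F2 h₂ hm hs hθ]
      ring
    obtain ⟨y', hy', h⟩ := C.mem_of_invariant_F2 h₂ hm hs hθ hfg₀ hr hrm hy hcy
    refine ⟨y', hy', ?_⟩
    rw [MonoidHom.comp_apply, eq_comm]
    exact (C.classMap_F2_eq_iff hs hθ hz hfg).mpr h

include h₂ hm hs hθ hδ hz hfg₀ hfg in
lemma card_map_Fm {m : ℕ} (hcard : Nat.card (twoPart (ClassGroup (𝓞 Fm))) = 2 ^ (m + 1)) :
    Nat.card ((twoPart (ClassGroup (𝓞 Fm))).map ((classMap f).comp (classMap f₀))) = 2 ^ m := by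
  have h1 := Subgroup.card_eq_two_mul_card_map ((classMap f).comp (classMap f₀))
    (S := twoPart (ClassGroup (𝓞 Fm)))
    (w := idealClass (Ideal.span {2} ⊔ Ideal.span {1 + δ})) ⟨1, C.idealClass_prime_Fm_sq hδ⟩
    (C.idealClass_prime_Fm_ne_one hm hδ) (C.idealClass_prime_Fm_sq hδ) (fun y _ => ?_)
  · rw [hcard, pow_succ'] at h1
    exact (Nat.mul_left_cancel two_pos h1).symm
  · rw [MonoidHom.comp_apply, C.classMap_F2_K_eq_one hs hθ hz hfg,
      C.classMap_Fm_F2_eq_one h₂ hm hs hδ hfg₀, or_iff_left]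
    intro h
    obtain ⟨I, hI, rfl⟩ := exists_idealClass y
    rw [classMap_idealClass _ hI] at h
    refine (C.hasNormForm_F2 h₂ hm).idealClass_pow_ne C.prime₁ C.mod₁
      (dvd_mul_right _ _).neg_right C.not_sq_dvd_neg_d (C.absNorm_prime_F2 h₂ hm hs hθ)
      (extIdeal_ne_zero f₀ hI) (hfg₀.quad.absNorm_extIdeal I) odd_one ?_
    rw [pow_one, h]

include h₂ hm hs hθ hδ hz hfg₀ hfg in
lemma exists_classMap_c_ne {M : Type*} [Field M] [NumberField M] {ιM : M →+* K}
    (hM : ∀ x, x ∈ ιM.range ↔ C.a (C.b x) = x ∧ C.a (C.c x) = x) {r : ℕ} (hr : Odd r)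
    (hrm : ∀ y : ClassGroup (𝓞 Fm), y ^ r ∈ twoPart (ClassGroup (𝓞 Fm)))
    (hr₂ : ∀ y : ClassGroup (𝓞 F2), y ^ r ∈ twoPart (ClassGroup (𝓞 F2)))
    (ha : ∀ x ∈ twoPart (ClassGroup (𝓞 K)), classMap C.a x = x⁻¹) :
    ∃ x ∈ twoPart (ClassGroup (𝓞 K)), classMap C.b x = x⁻¹ ∧ classMap C.c x ≠ x := by
  obtain ⟨q, R, hq, hR⟩ := C.exists_ideal_F2 h₂ hm hs hδ
  have hs0 := C.s_F2_ne_zero hs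
  have hR0 : R ≠ 0 := by
    rintro rfl
    rw [Submodule.zero_eq_bot, Ideal.absNorm_bot] at hR
    lia
  have hx := map_mem_twoPart (classMap f) (hr₂ (idealClass R))
  have hbx : classMap C.b (classMap f (idealClass R ^ r)) = (classMap f (idealClass R ^ r))⁻¹ := by
    have h1 := hfg.quad.classMap_conj_base (idealClass R ^ r)
    rw [hfg.eq_of_id, ← classMap_comp, ha _ (map_mem_twoPart _ hx)] at h1
    rw [← inv_inv (classMap C.b _), h1]
  refine ⟨_, hx, hbx, fun hc => ?_⟩
  obtain ⟨y, hy, h⟩ := (C.mem_minus_fixed_iff h₂ hm hs hθ hz hfg₀ hfg hr hrm hr₂ ha _).mpr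
    ⟨hx, hbx, hc⟩
  obtain ⟨I, hI, rfl⟩ := exists_idealClass y
  obtain ⟨l, rfl⟩ := hr
  have hd : ((p₁ : ℤ) * p₂) % 8 = 1 := by exact_mod_cast C.d_mod
  have hd0 : (0 : ℤ) < p₁ * p₂ := by exact_mod_cast Nat.mul_pos C.prime₁.pos C.prime₂.pos
  have hRr := pow_ne_zero (2 * l + 1) hR0
  have hne := fun e w J hJ h => (C.hasNormForm_F2' h₂ hM).absNorm_mul_ne_of_mod_eight hd hd0 hq
    (e := e) (w := w) (I := R ^ (2 * l + 1)) (J := J) hRr hJ h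
  rw [MonoidHom.comp_apply, classMap_idealClass _ hI, eq_comm, ← idealClass_pow hR0 (2 * l + 1),
    C.classMap_F2_eq_iff hs hθ hz hfg] at h
  have hI' := extIdeal_ne_zero f₀ hI
  rcases h with h | h
  · refine hne 0 (q ^ l * Ideal.absNorm I) _ hI' h ?_
    rw [map_pow, hR, hfg₀.quad.absNorm_extIdeal]
    ring
  · rw [← idealClass_mul hI' (prime_F2_ne_zero hs0)] at h
    refine hne 1 (q ^ l * Ideal.absNorm I) _ (mul_ne_zero hI' (prime_F2_ne_zero hs0)) h ?_
    rw [map_pow, hR, map_mul, hfg₀.quad.absNorm_extIdeal, C.absNorm_prime_F2 h₂ hm hs hθ]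
    ring

end Octic

lemma numberField_of_ringHom {F K : Type*} [Field F] [Field K] [NumberField K] (ι : F →+* K) :
    NumberField F := by
  have : CharZero F := (RingHom.charZero_iff ι.injective).mpr inferInstance
  have : FiniteDimensional ℚ F :=
    FiniteDimensional.of_injective ι.toRatAlgHom.toLinearMap ι.injective
  exact { }

namespace Octic

variable {p₁ p₂ : ℕ} {K : Type*} [Field K] [NumberField K] (C : Octic p₁ p₂ K)
  {Fp : Type*} [Field Fp] [NumberField Fp] {ιF : Fp →+* K}
  (hF : ∀ x, x ∈ ιF.range ↔ C.b x = x ∧ C.c x = x)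
  {Fm : Type*} [Field Fm] [NumberField Fm] {ιm : Fm →+* K}
  (hm : ∀ x, x ∈ ιm.range ↔ C.a (C.b x) = x ∧ C.c x = x)

include hF hm in
theorem nonempty_addEquiv {n m : ℕ} (hn : Nat.card (twoPart (ClassGroup (𝓞 Fp))) = 2 ^ n)
    (hmc : Nat.card (twoPart (ClassGroup (𝓞 Fm))) = 2 ^ (m + 1)) (hm2 : 2 ≤ m) :
    Nonempty (Additive (twoPart (ClassGroup (𝓞 K))) ≃+
      ZMod (2 ^ min m (n + 1)) × ZMod (2 ^ max (m + 1) (n + 2))) := by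
  let fix (γ : K →+* K) : Subfield K := γ.eqLocusField (RingHom.id K)
  have hfix (γ : K →+* K) (x : K) : x ∈ fix γ ↔ γ x = x := Iff.rfl
  have hrange (S : Subfield K) (x : K) : x ∈ S.subtype.range ↔ x ∈ S := by
    simp
  have inst (S : Subfield K) : NumberField S := numberField_of_ringHom S.subtype
  have hQ : ∀ x, x ∈ (fix C.a ⊓ fix C.b).subtype.range ↔ C.a x = x ∧ C.b x = x := fun x => by
    rw [hrange, Subfield.mem_inf, hfix, hfix]
  have hk : ∀ x, x ∈ (fix C.a).subtype.range ↔ C.a x = x := fun x => by rw [hrange, hfix]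
  have hp : ∀ x, x ∈ (fix C.b).subtype.range ↔ C.b x = x := fun x => by rw [hrange, hfix]
  have h₂ : ∀ x, x ∈ (fix (C.a.comp C.b)).subtype.range ↔ C.a (C.b x) = x := fun x => by
    rw [hrange, hfix, RingHom.comp_apply]
  have hM : ∀ x, x ∈ (fix (C.a.comp C.b) ⊓ fix (C.a.comp C.c)).subtype.range ↔
      C.a (C.b x) = x ∧ C.a (C.c x) = x := fun x => by
    rw [hrange, Subfield.mem_inf, hfix, hfix, RingHom.comp_apply, RingHom.comp_apply]
  obtain ⟨z, hz⟩ := exists_intHom_eq (RingHom.id K) (x := C.ζ) ⟨_, rfl⟩ C.integral_ζ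
  obtain ⟨w, hw⟩ := exists_intHom_eq (RingHom.id K) (x := C.ω) ⟨_, rfl⟩ C.integral_ω
  obtain ⟨s₀, hs₀⟩ := exists_intHom_eq _ ((hp _).mpr C.bs) C.integral_s
  obtain ⟨w₀, hw₀⟩ := exists_intHom_eq _ ((hp _).mpr C.bω) C.integral_ω
  obtain ⟨t₀, ht₀⟩ := exists_intHom_eq _ ((hp _).mpr C.bt) C.integral_t
  obtain ⟨s, hs⟩ := exists_intHom_eq _ ((h₂ _).mpr C.abs) C.integral_s
  obtain ⟨θ, hθ⟩ := exists_intHom_eq _ ((h₂ _).mpr C.abθ) C.integral_θ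
  obtain ⟨δ, hδ⟩ := exists_intHom_eq ιm (C.it_mem_Fm hm) (C.integral_i.mul C.integral_t)
  obtain ⟨rQ, hrQ, hrQ'⟩ := exists_odd_pow_mem_twoPart (ClassGroup (𝓞 ↥(fix C.a ⊓ fix C.b)))
  obtain ⟨rF, hrF, hrF'⟩ := exists_odd_pow_mem_twoPart (ClassGroup (𝓞 Fp))
  obtain ⟨rp, hrp, hrp'⟩ := exists_odd_pow_mem_twoPart (ClassGroup (𝓞 ↥(fix C.b)))
  obtain ⟨rm, hrm, hrm'⟩ := exists_odd_pow_mem_twoPart (ClassGroup (𝓞 Fm))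
  obtain ⟨r₂, hr₂, hr₂'⟩ := exists_odd_pow_mem_twoPart (ClassGroup (𝓞 ↥(fix (C.a.comp C.b))))
  obtain ⟨rK, hrK, hrK'⟩ := exists_odd_pow_mem_twoPart (ClassGroup (𝓞 K))
  obtain ⟨r, hr, hdvd⟩ : ∃ r, Odd r ∧ rQ ∣ r ∧ rF ∣ r ∧ rp ∣ r ∧ rm ∣ r ∧ r₂ ∣ r ∧ rK ∣ r :=
    ⟨rQ * rF * rp * rm * r₂ * rK, ((((hrQ.mul hrF).mul hrp).mul hrm).mul hr₂).mul hrK,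
      ⟨rF * rp * rm * r₂ * rK, by ring⟩, ⟨rQ * rp * rm * r₂ * rK, by ring⟩,
      ⟨rQ * rF * rm * r₂ * rK, by ring⟩, ⟨rQ * rF * rp * r₂ * rK, by ring⟩,
      ⟨rQ * rF * rp * rm * rK, by ring⟩, ⟨rQ * rF * rp * rm * r₂, by ring⟩⟩
  obtain ⟨dQ, dF, dp, dm, d₂, dK⟩ := hdvd
  replace hrQ' := pow_mem_twoPart_of_dvd dQ hrQ'
  replace hrF' := pow_mem_twoPart_of_dvd dF hrF'
  replace hrp' := pow_mem_twoPart_of_dvd dp hrp'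
  replace hrm' := pow_mem_twoPart_of_dvd dm hrm'
  replace hr₂' := pow_mem_twoPart_of_dvd d₂ hr₂'
  replace hrK' := pow_mem_twoPart_of_dvd dK hrK'
  obtain ⟨fk, gk, hfgk⟩ := C.exists_rel_k_K hk
  obtain ⟨fp, gp, hfgp⟩ := C.exists_rel_Kp_K hp
  obtain ⟨f, g, hfg⟩ := C.exists_rel_F2_K h₂
  obtain ⟨f₀, g₀, hfg₀⟩ := C.exists_rel_Fm_F2 h₂ hm
  have ha : ∀ x ∈ twoPart (ClassGroup (𝓞 K)), classMap C.a x = x⁻¹ := fun x hx => by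
    have := C.twoPart_conj_a hQ hk hfgk hx
    rwa [hfgk.eq_of_id] at this
  obtain ⟨hA, hAn⟩ := C.twoPart_Kp hQ hp hF hs₀ hw₀ ht₀ hn hr hrQ' hrF' hrp'
  obtain ⟨hξ, hbξ, hfixb, hnorm⟩ := C.twoPart_K hQ hk hp hz hw hs₀ hw₀ hfgp hr hrp' hA hAn rfl
  rw [hfgp.eq_of_id] at hbξ hfixb hnorm
  refine nonempty_addEquiv_of_involutions le_rfl (b := classMap C.b) (c := classMap C.c)
    (hrK' _) hbξ hξ hfixb hnorm (fun x => ?_) (fun x hx => map_mem_twoPart _ hx) (fun x => ?_)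
    (C.mem_minus_fixed_iff h₂ hm hs hθ hz hfg₀ hfg hr hrm' hr₂' ha)
    (C.card_map_Fm h₂ hm hs hθ hδ hz hfg₀ hfg hmc) hm2
    (C.exists_classMap_c_ne h₂ hm hs hθ hδ hz hfg₀ hfg hM hr hrm' hr₂' ha)
  · rw [classMap_comp, show C.c.comp C.c = RingHom.id K from RingHom.ext C.cc, classMap_id]
  · rw [classMap_comp, classMap_comp, show C.b.comp C.c = C.c.comp C.b from RingHom.ext C.bc]

end Octic

section QuadraticClosure

variable {L : Type*} [Field L]

/-- The elements `p + q u` with `p`, `q` in a subfield `E` containing `u ^ 2`. -/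
def Subfield.quadExt (E : Subfield L) (u : L) (hu : u ^ 2 ∈ E) : Subfield L where
  carrier := {x | ∃ p ∈ E, ∃ q ∈ E, x = p + q * u}
  mul_mem' := by
    rintro _ _ ⟨p, hp, q, hq, rfl⟩ ⟨p', hp', q', hq', rfl⟩
    exact ⟨p * p' + q * q' * u ^ 2, add_mem (mul_mem hp hp') (mul_mem (mul_mem hq hq') hu),
      p * q' + q * p', add_mem (mul_mem hp hq') (mul_mem hq hp'), by ring⟩
  one_mem' := ⟨1, one_mem _, 0, zero_mem _, by ring⟩
  add_mem' := by
    rintro _ _ ⟨p, hp, q, hq, rfl⟩ ⟨p', hp', q', hq', rfl⟩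
    exact ⟨p + p', add_mem hp hp', q + q', add_mem hq hq', by ring⟩
  zero_mem' := ⟨0, zero_mem _, 0, zero_mem _, by ring⟩
  neg_mem' := by
    rintro _ ⟨p, hp, q, hq, rfl⟩
    exact ⟨-p, neg_mem hp, -q, neg_mem hq, by ring⟩
  inv_mem' := by
    rintro _ ⟨p, hp, q, hq, rfl⟩
    by_cases h : p - q * u = 0
    · have hx : p + q * u ∈ E := by
        rw [show p + q * u = p + p by linear_combination -h]
        exact add_mem hp hp
      exact ⟨_, inv_mem hx, 0, zero_mem _, by ring⟩
    · by_cases h' : p + q * u = 0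
      · exact ⟨0, zero_mem _, 0, zero_mem _, by rw [h']; simp⟩
      have hN : (p ^ 2 - q ^ 2 * u ^ 2) ∈ E :=
        sub_mem (pow_mem hp 2) (mul_mem (pow_mem hq 2) hu)
      have hN0 : p ^ 2 - q ^ 2 * u ^ 2 ≠ 0 := by
        rw [show p ^ 2 - q ^ 2 * u ^ 2 = (p - q * u) * (p + q * u) by ring]
        exact mul_ne_zero h h'
      refine ⟨p * (p ^ 2 - q ^ 2 * u ^ 2)⁻¹, mul_mem hp (inv_mem hN),
        -q * (p ^ 2 - q ^ 2 * u ^ 2)⁻¹, mul_mem (neg_mem hq) (inv_mem hN), ?_⟩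
      rw [inv_eq_iff_eq_inv, ← div_eq_mul_inv, ← div_eq_mul_inv, div_mul_eq_mul_div, ← add_div,
        inv_div, eq_div_iff (by rwa [neg_mul, ← sub_eq_add_neg])]
      ring

variable {S : Set L} {u : L}

lemma exists_eq_add_mul_of_mem_closure_insert (hu : u ^ 2 ∈ Subfield.closure S) {x : L}
    (hx : x ∈ Subfield.closure (insert u S)) :
    ∃ p ∈ Subfield.closure S, ∃ q ∈ Subfield.closure S, x = p + q * u := by
  have : Subfield.closure (insert u S) ≤ (Subfield.closure S).quadExt u hu := by
    rw [Subfield.closure_le]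
    rintro y (rfl | hy)
    · exact ⟨0, zero_mem _, 1, one_mem _, by ring⟩
    · exact ⟨y, Subfield.subset_closure hy, 0, zero_mem _, by ring⟩
  exact this hx

lemma mem_or_mul_mem_of_mem_closure_insert (h2 : (2 : L) ≠ 0) (hu : u ^ 2 ∈ Subfield.closure S)
    {w : L} (hw : w ^ 2 ∈ Subfield.closure S) (h : w ∈ Subfield.closure (insert u S)) :
    w ∈ Subfield.closure S ∨ w * u ∈ Subfield.closure S := by
  obtain ⟨p, hp, q, hq, rfl⟩ := exists_eq_add_mul_of_mem_closure_insert hu h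
  by_cases hp0 : p = 0
  · right
    rw [hp0, zero_add, mul_assoc, ← sq]
    exact mul_mem hq hu
  by_cases hq0 : q = 0
  · left
    rwa [hq0, zero_mul, add_zero]
  left
  have : u = ((p + q * u) ^ 2 - p ^ 2 - q ^ 2 * u ^ 2) * (2 * p * q)⁻¹ := by
    field_simp
    ring
  have hE : u ∈ Subfield.closure S := by
    rw [this]
    exact mul_mem (sub_mem (sub_mem hw (pow_mem hp 2)) (mul_mem (pow_mem hq 2) hu))
      (inv_mem (mul_mem (mul_mem (ofNat_mem _ 2) hp) hq))
  exact add_mem hp (mul_mem hq hE)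

lemma mem_closure_of_fixed (h2 : (2 : L) ≠ 0) (hu : u ^ 2 ∈ Subfield.closure S) (hu0 : u ≠ 0)
    {τ : L →+* L} (hτ : ∀ x ∈ S, τ x = x) (hτu : τ u = -u) {x : L}
    (hx : x ∈ Subfield.closure (insert u S)) (h : τ x = x) : x ∈ Subfield.closure S := by
  obtain ⟨p, hp, q, hq, rfl⟩ := exists_eq_add_mul_of_mem_closure_insert hu hx
  have hfix : ∀ y ∈ Subfield.closure S, τ y = y := fun y hy =>
    RingHom.eqOn_field_closure (f := τ) (g := RingHom.id L) hτ hy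
  rw [map_add, map_mul, hfix p hp, hfix q hq, hτu] at h
  have hq0 : q = 0 := by
    have : 2 * u * q = 0 := by linear_combination -h
    exact (mul_eq_zero.mp this).resolve_left (mul_ne_zero h2 hu0)
  rwa [hq0, zero_mul, add_zero]

lemma exists_ringHom_neg (hu : u ^ 2 ∈ Subfield.closure S)
    (huS : u ∉ Subfield.closure S) (htop : Subfield.closure (insert u S) = ⊤) :
    ∃ τ : L →+* L, (∀ x ∈ S, τ x = x) ∧ τ u = -u := by
  have hex : ∀ x : L, ∃ p ∈ Subfield.closure S, ∃ q ∈ Subfield.closure S, x = p + q * u :=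
    fun x => exists_eq_add_mul_of_mem_closure_insert hu (htop ▸ Subfield.mem_top x)
  choose P hP Q hQ hPQ using hex
  have huniq : ∀ x p q, p ∈ Subfield.closure S → q ∈ Subfield.closure S → x = p + q * u →
      P x - Q x * u = p - q * u := by
    intro x p q hp hq hx
    have h := (hPQ x).symm.trans hx
    have hq' : Q x = q := by
      by_contra hne
      have hne' : Q x - q ≠ 0 := sub_ne_zero.mpr hne
      apply huS
      rw [show u = (p - P x) * (Q x - q)⁻¹ by field_simp; linear_combination h]
      exact mul_mem (sub_mem hp (hP x)) (inv_mem (sub_mem (hQ x) hq))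
    rw [hq'] at h ⊢
    linear_combination h
  refine ⟨⟨⟨⟨fun x => P x - Q x * u, ?_⟩, ?_⟩, ?_, ?_⟩, ?_, ?_⟩
  · rw [huniq 1 1 0 (one_mem _) (zero_mem _) (by ring)]
    ring
  · intro x y
    dsimp only
    rw [huniq (x * y) (P x * P y + Q x * Q y * u ^ 2) (P x * Q y + Q x * P y)
      (add_mem (mul_mem (hP x) (hP y)) (mul_mem (mul_mem (hQ x) (hQ y)) hu))
      (add_mem (mul_mem (hP x) (hQ y)) (mul_mem (hQ x) (hP y)))
      (by linear_combination y * hPQ x + (P x + Q x * u) * hPQ y)]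
    ring
  · dsimp only
    rw [huniq 0 0 0 (zero_mem _) (zero_mem _) (by ring)]
    ring
  · intro x y
    dsimp only
    rw [huniq (x + y) (P x + P y) (Q x + Q y) (add_mem (hP x) (hP y)) (add_mem (hQ x) (hQ y))
      (by linear_combination hPQ x + hPQ y)]
    ring
  · intro x hx
    change P x - Q x * u = x
    rw [huniq x x 0 (Subfield.subset_closure hx) (zero_mem _) (by ring)]
    ring
  · change P u - Q u * u = -u
    rw [huniq u 0 1 (zero_mem _) (one_mem _) (by ring)]
    ring

lemma exists_rat_of_mem_closure_empty [CharZero L] {x : L}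
    (hx : x ∈ Subfield.closure (∅ : Set L)) : ∃ q : ℚ, (q : L) = x := by
  have : Subfield.closure (∅ : Set L) ≤ (algebraMap ℚ L).fieldRange := by
    rw [Subfield.closure_le]
    exact Set.empty_subset _
  obtain ⟨q, hq⟩ := this hx
  exact ⟨q, by simpa using hq⟩

end QuadraticClosure

section Multiquadratic

variable {L : Type*} [Field L] [CharZero L]

lemma ratCast_sq_mem_closure {S : Set L} {u : L} {A : ℚ} (hu : u ^ 2 = A) :
    u ^ 2 ∈ Subfield.closure S := by
  rw [hu]
  exact SubfieldClass.ratCast_mem _ _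

lemma isSquare_or_of_mem_closure_pair {u v w : L} {A B D : ℚ} (hu : u ^ 2 = A) (hv : v ^ 2 = B)
    (hw : w ^ 2 = D) (h : w ∈ Subfield.closure {u, v}) :
    (IsSquare D ∨ IsSquare (D * B)) ∨ IsSquare (D * A) ∨ IsSquare (D * A * B) := by
  have h2 : (2 : L) ≠ 0 := two_ne_zero
  have key : ∀ {z : L} {E : ℚ}, z ^ 2 = E → z ∈ Subfield.closure {v} →
      IsSquare E ∨ IsSquare (E * B) := by
    intro z E hz hmem
    have hrat : ∀ {y : L} {F : ℚ}, y ^ 2 = F → y ∈ Subfield.closure (∅ : Set L) → IsSquare F := by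
      intro y F hy hmem
      obtain ⟨q, rfl⟩ := exists_rat_of_mem_closure_empty hmem
      exact ⟨q, by rw [← sq]; exact_mod_cast hy.symm⟩
    rw [← insert_empty_eq v] at hmem
    rcases mem_or_mul_mem_of_mem_closure_insert h2 (ratCast_sq_mem_closure hv)
      (ratCast_sq_mem_closure hz) hmem with h | h
    · exact Or.inl (hrat hz h)
    · exact Or.inr (hrat (by rw [mul_pow, hz, hv, Rat.cast_mul]) h)
  rcases mem_or_mul_mem_of_mem_closure_insert h2 (ratCast_sq_mem_closure hu)
    (ratCast_sq_mem_closure hw) h with h | h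
  · exact Or.inl (key hw h)
  · exact Or.inr (key (by rw [mul_pow, hw, hu, Rat.cast_mul]) h)

lemma not_isSquare_rat_of_neg {q : ℚ} (h : q < 0) : ¬ IsSquare q := fun ⟨r, hr⟩ => by
  have := mul_self_nonneg r
  linarith

lemma not_isSquare_ratCast {n : ℕ} (h : Squarefree n) (h1 : n ≠ 1) : ¬ IsSquare (n : ℚ) := by
  rw [Rat.isSquare_natCast_iff]
  rintro ⟨r, rfl⟩
  have := h r dvd_rfl
  rw [Nat.isUnit_iff] at this
  exact h1 (by rw [this])

/-- The Galois group of `ℚ(s, t, i)`. -/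
lemma exists_multiquadratic_ringHoms {d : ℕ} (hd : Squarefree d) (hd1 : d ≠ 1)
    (h2d : Squarefree (2 * d)) {s t i : L} (s2 : s ^ 2 = 2) (t2 : t ^ 2 = d) (i2 : i ^ 2 = -1)
    (htop : Subfield.closure {s, t, i} = ⊤) :
    ∃ a b c : L →+* L, (a s = s ∧ a t = -t ∧ a i = i) ∧ (b s = s ∧ b t = t ∧ b i = -i) ∧
      (c s = -s ∧ c t = t ∧ c i = i) := by
  have s2' : s ^ 2 = ((2 : ℚ) : L) := by rw [s2]; norm_num
  have t2' : t ^ 2 = ((d : ℚ) : L) := by rw [t2]; norm_num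
  have i2' : i ^ 2 = ((-1 : ℚ) : L) := by rw [i2]; norm_num
  have hdpos : (0 : ℚ) < d := by exact_mod_cast Nat.pos_of_ne_zero hd.ne_zero
  have n2 : ¬ IsSquare (2 : ℚ) := by
    exact_mod_cast not_isSquare_ratCast (n := 2) Nat.prime_two.squarefree (by norm_num)
  have nd := not_isSquare_ratCast hd hd1
  have n2d : ¬ IsSquare (2 * d : ℚ) := by
    exact_mod_cast not_isSquare_ratCast h2d (by lia)
  have hneg : ∀ {q : ℚ}, q < 0 → ¬ IsSquare q := not_isSquare_rat_of_neg
  obtain ⟨a, ha, hat⟩ := exists_ringHom_neg (S := {s, i}) (u := t) (ratCast_sq_mem_closure t2')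
    (fun h => by
      rcases isSquare_or_of_mem_closure_pair s2' i2' t2' h with (h | h) | h | h
      · exact nd h
      · exact hneg (by linarith) h
      · exact n2d (by rwa [mul_comm])
      · exact hneg (by linarith) h) (by rw [Set.insert_comm, htop])
  obtain ⟨b, hb, hbi⟩ := exists_ringHom_neg (S := {s, t}) (u := i) (ratCast_sq_mem_closure i2')
    (fun h => by
      rcases isSquare_or_of_mem_closure_pair s2' t2' i2' h with (h | h) | h | h <;>
      exact hneg (by linarith) h) (by rw [Set.insert_comm, Set.pair_comm i, htop])
  obtain ⟨c, hc, hcs⟩ := exists_ringHom_neg (S := {t, i}) (u := s) (ratCast_sq_mem_closure s2')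
    (fun h => by
      rcases isSquare_or_of_mem_closure_pair t2' i2' s2' h with (h | h) | h | h
      · exact n2 h
      · exact hneg (by linarith) h
      · exact n2d h
      · exact hneg (by linarith) h) htop
  exact ⟨a, b, c, ⟨ha _ (by simp), hat, ha _ (by simp)⟩, ⟨hb _ (by simp), hb _ (by simp), hbi⟩,
    ⟨hcs, hc _ (by simp), hc _ (by simp)⟩⟩

lemma ringHom_ext_of_closure_eq_top {M : Type*} [Field M] {s t i : L}
    (htop : Subfield.closure {s, t, i} = ⊤) {f g : L →+* M} (hs : f s = g s) (ht : f t = g t)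
    (hi : f i = g i) (x : L) : f x = g x := by
  have : Set.EqOn f g (Subfield.closure {s, t, i}) := by
    refine RingHom.eqOn_field_closure fun y hy => ?_
    rcases hy with rfl | rfl | rfl <;> assumption
  exact this (htop ▸ Subfield.mem_top x)

end Multiquadratic

section RealUnits

/-- The real numbers `(X + Y√D) / 2` with `X² - DY² = ±4`. -/
def IsRealQuadUnit (D : ℕ) (ρ : ℝ) : Prop :=
  ∃ x y : ℤ, ρ = ((x : ℝ) + (y : ℝ) * Real.sqrt D) / 2 ∧
    (x ^ 2 - (D : ℤ) * y ^ 2 = 4 ∨ x ^ 2 - (D : ℤ) * y ^ 2 = -4)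

variable {D : ℕ} {ρ σ : ℝ}

lemma IsRealQuadUnit.neg (h : IsRealQuadUnit D ρ) : IsRealQuadUnit D (-ρ) := by
  obtain ⟨x, y, rfl, h⟩ := h
  exact ⟨-x, -y, by push_cast; ring, by simpa using h⟩

lemma IsRealQuadUnit.mul (h : IsRealQuadUnit D ρ) (h' : IsRealQuadUnit D σ) :
    IsRealQuadUnit D (ρ * σ) := by
  obtain ⟨x, y, rfl, h⟩ := h
  obtain ⟨z, w, rfl, h'⟩ := h'
  have par : ∀ {x y : ℤ}, (x ^ 2 - (D : ℤ) * y ^ 2 = 4 ∨ x ^ 2 - (D : ℤ) * y ^ 2 = -4) →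
      (Even x ↔ Even ((D : ℤ) * y)) := by
    intro x y h
    have h4 : Even (x ^ 2 - (D : ℤ) * y ^ 2) := by
      rcases h with h | h <;> rw [h] <;> decide
    simpa [Int.even_sub, Int.even_pow, Int.even_mul] using h4
  have p1 := par h
  have p2 := par h'
  obtain ⟨u, hu⟩ : Even (x * z + D * y * w) := by
    simp only [Int.even_add, Int.even_mul] at p1 p2 ⊢
    tauto
  obtain ⟨v, hv⟩ : Even (x * w + z * y) := by
    simp only [Int.even_add, Int.even_mul] at p1 p2 ⊢
    tauto
  have hD : Real.sqrt D ^ 2 = D := Real.sq_sqrt (Nat.cast_nonneg D)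
  have hu' : (x * z + D * y * w : ℝ) = u + u := by exact_mod_cast hu
  have hv' : (x * w + z * y : ℝ) = v + v := by exact_mod_cast hv
  refine ⟨u, v, ?_, ?_⟩
  · linear_combination y * w * hD / 4 + hu' / 4 + Real.sqrt D * hv' / 4
  · have key : 4 * (u ^ 2 - D * v ^ 2) = (x ^ 2 - D * y ^ 2) * (z ^ 2 - D * w ^ 2) := by
      linear_combination -(x * z + D * y * w + 2 * u) * hu + D * (x * w + z * y + 2 * v) * hv
    rcases h with h | h <;> rcases h' with h' | h' <;> rw [h, h'] at key <;> lia

lemma IsRealQuadUnit.ne_zero (h : IsRealQuadUnit D ρ) : ρ ≠ 0 := by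
  obtain ⟨x, y, rfl, h⟩ := h
  intro h0
  have hD : Real.sqrt D ^ 2 = D := Real.sq_sqrt (Nat.cast_nonneg D)
  have h1 : (x ^ 2 - D * y ^ 2 : ℝ) = 0 := by
    linear_combination 2 * (x - y * Real.sqrt D) * h0 + y ^ 2 * hD
  have h2 : x ^ 2 - (D : ℤ) * y ^ 2 = 0 := by exact_mod_cast h1
  lia

lemma IsRealQuadUnit.inv (h : IsRealQuadUnit D ρ) : IsRealQuadUnit D ρ⁻¹ := by
  have h0 := h.ne_zero
  obtain ⟨x, y, rfl, h⟩ := h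
  have hD : Real.sqrt D ^ 2 = D := Real.sq_sqrt (Nat.cast_nonneg D)
  rcases h with h | h
  · refine ⟨x, -y, ?_, Or.inl (by linear_combination h)⟩
    have h' : (x ^ 2 - D * y ^ 2 : ℝ) = 4 := by exact_mod_cast h
    refine inv_eq_of_mul_eq_one_right ?_
    push_cast
    linear_combination h' / 4 - y ^ 2 * hD / 4
  · refine ⟨-x, y, ?_, Or.inr (by linear_combination h)⟩
    have h' : (x ^ 2 - D * y ^ 2 : ℝ) = -4 := by exact_mod_cast h
    refine inv_eq_of_mul_eq_one_right ?_
    push_cast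
    linear_combination -h' / 4 + y ^ 2 * hD / 4

lemma IsRealQuadUnit.one : IsRealQuadUnit D 1 := ⟨2, 0, by norm_num, Or.inl (by norm_num)⟩

lemma IsRealQuadUnit.zpow (h : IsRealQuadUnit D ρ) (k : ℤ) : IsRealQuadUnit D (ρ ^ k) := by
  have hnat : ∀ n : ℕ, IsRealQuadUnit D (ρ ^ n) := fun n => by
    induction n with
    | zero => simpa using IsRealQuadUnit.one
    | succ n ih => rw [pow_succ]; exact ih.mul h
  obtain ⟨n, rfl | rfl⟩ := k.eq_nat_or_neg
  · simpa using hnat n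
  · simpa using (hnat n).inv

lemma IsFundUnit.exists_zpow {ε : ℝ} (hε : IsFundUnit D ε) (h : IsRealQuadUnit D ρ) :
    ∃ k : ℤ, ρ = ε ^ k ∨ ρ = -ε ^ k := by
  wlog hpos : 0 < ρ generalizing ρ
  · obtain ⟨k, hk⟩ := this h.neg (by
      have := h.ne_zero
      rw [not_lt] at hpos
      linarith [lt_of_le_of_ne hpos this])
    exact ⟨k, by rcases hk with hk | hk <;> [right; left] <;> linarith⟩
  obtain ⟨h1, hu, hmin⟩ := hε
  have h0 : 0 < ε := by linarith
  obtain ⟨k, hk1, hk2⟩ := exists_mem_Ico_zpow hpos h1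
  refine ⟨k, Or.inl ?_⟩
  have hu' : IsRealQuadUnit D ε := hu
  obtain ⟨x, y, hxy, hN⟩ := h.mul (hu'.zpow k).inv
  have hεk : 0 < ε ^ k := zpow_pos h0 k
  by_contra hne
  have hlt : ε ^ k < ρ := lt_of_le_of_ne hk1 (Ne.symm hne)
  have := hmin x y hN (by
    rw [← hxy, ← div_eq_mul_inv]
    exact (one_lt_div hεk).mpr hlt)
  rw [← hxy, ← div_eq_mul_inv, le_div_iff₀ hεk] at this
  rw [zpow_add_one₀ h0.ne'] at hk2
  linarith

end RealUnits

section QuadraticUnits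

variable {L : Type*} [Field L] [CharZero L]

lemma isIntegral_of_sq_eq {R : Type*} [CommRing R] {z : R} {a b : ℤ} (h : z ^ 2 = a * z + b) :
    IsIntegral ℤ z := by
  refine ⟨Polynomial.X ^ 2 - (Polynomial.C a * Polynomial.X + Polynomial.C b),
    Polynomial.monic_X_pow_sub (Polynomial.degree_linear_le.trans_lt (by norm_num)), ?_⟩
  rw [Polynomial.eval₂_sub, Polynomial.eval₂_add, Polynomial.eval₂_mul, Polynomial.eval₂_C,
    Polynomial.eval₂_C, Polynomial.eval₂_X_pow, Polynomial.eval₂_X]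
  simp [h]

lemma exists_intCast_eq_of_mul_sq {D : ℕ} (hD : Squarefree D) {q : ℚ} {z : ℤ}
    (h : D * q ^ 2 = z) : ∃ n : ℤ, (n : ℚ) = q := by
  have hden : (q.den : ℚ) ≠ 0 := by exact_mod_cast q.den_nz
  have h1 : (D : ℤ) * q.num ^ 2 = z * (q.den : ℤ) ^ 2 := by
    rw [← Rat.num_div_den q, div_pow, mul_div_assoc', div_eq_iff (pow_ne_zero 2 hden)] at h
    exact_mod_cast h
  have hcop : IsCoprime ((q.den : ℤ) ^ 2) (q.num ^ 2) := by
    apply IsCoprime.pow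
    rw [Int.isCoprime_iff_gcd_eq_one, Int.gcd_comm]
    simpa [Int.gcd] using q.reduced
  have h2 : (q.den : ℤ) ^ 2 ∣ D := hcop.dvd_of_dvd_mul_right ⟨z, by rw [h1, mul_comm]⟩
  have h3 : q.den * q.den ∣ D := by
    rw [← sq]
    exact_mod_cast h2
  have h4 := Nat.isUnit_iff.mp (hD _ h3)
  exact ⟨q.num, Rat.coe_int_num_of_den_eq_one h4⟩

variable {D : ℕ} {w : L} (hw : w ^ 2 = D) {ψ : L →+* ℂ} (hψ : ψ w = (Real.sqrt D : ℝ))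

include hw hψ in
lemma IsIntUnit.isRealQuadUnit (hD : Squarefree D) {τ : L →+* L} (hτ : τ w = -w) {x : L}
    (hx : IsIntUnit x) (hmem : x ∈ Subfield.closure {w}) :
    ∃ ρ : ℝ, IsRealQuadUnit D ρ ∧ ψ x = ρ := by
  rw [← insert_empty_eq w] at hmem
  obtain ⟨p, hp, q, hq, rfl⟩ := exists_eq_add_mul_of_mem_closure_insert
    (ratCast_sq_mem_closure (A := D) (by rw [hw]; norm_num)) hmem
  obtain ⟨p, rfl⟩ := exists_rat_of_mem_closure_empty hp
  obtain ⟨q, rfl⟩ := exists_rat_of_mem_closure_empty hq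
  have hconj : τ (p + q * w) = p - q * w := by
    rw [map_add, map_mul, map_ratCast, map_ratCast, hτ]
    ring
  have hx' := hx.map τ
  rw [hconj] at hx'
  obtain ⟨X, hX⟩ := exists_intCast_eq_of_isIntegral (L := L) (q := 2 * p) (by
    have := hx.2.1.add hx'.2.1
    rwa [show (p + q * w + (p - q * w) : L) = ((2 * p : ℚ) : L) by push_cast; ring] at this)
  have hN : p ^ 2 - D * q ^ 2 = 1 ∨ p ^ 2 - D * q ^ 2 = -1 := by
    have := hx.mul hx'
    rw [show ((p + q * w) * (p - q * w) : L) = ((p ^ 2 - D * q ^ 2 : ℚ) : L) by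
      push_cast
      linear_combination (-q ^ 2 : L) * hw] at this
    exact this.ratCast
  obtain ⟨N, hN', hN1⟩ : ∃ N : ℤ, p ^ 2 - D * q ^ 2 = N ∧ (N = 1 ∨ N = -1) := by
    rcases hN with h | h
    · exact ⟨1, by rw [h]; norm_num, Or.inl rfl⟩
    · exact ⟨-1, by rw [h]; norm_num, Or.inr rfl⟩
  obtain ⟨Y, hY⟩ := exists_intCast_eq_of_mul_sq hD (q := 2 * q) (z := X ^ 2 - 4 * N) (by
    push_cast
    rw [hX, ← hN']
    ring)
  refine ⟨((X : ℝ) + (Y : ℝ) * Real.sqrt D) / 2, ⟨X, Y, rfl, ?_⟩, ?_⟩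
  · have : X ^ 2 - (D : ℤ) * Y ^ 2 = 4 * N := by
      have : (X ^ 2 - D * Y ^ 2 : ℚ) = 4 * N := by
        rw [hX, hY, ← hN']
        ring
      exact_mod_cast this
    lia
  · rw [map_add, map_mul, map_ratCast, map_ratCast, hψ]
    have hX' : (X : ℂ) = 2 * p := by exact_mod_cast congrArg (Rat.cast (K := ℂ)) hX
    have hY' : (Y : ℂ) = 2 * q := by exact_mod_cast congrArg (Rat.cast (K := ℂ)) hY
    push_cast
    rw [hX', hY']
    ring

include hw hψ in
lemma IsFundUnit.exists_isIntUnit {ε : ℝ} (hε : IsFundUnit D ε) :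
    ∃ e : L, IsIntUnit e ∧ ψ e = ε ∧ e ∈ Subfield.closure {w} := by
  obtain ⟨-, ⟨x, y, rfl, h⟩, -⟩ := hε
  obtain ⟨N, hN, hN1⟩ : ∃ N : ℤ, x ^ 2 - (D : ℤ) * y ^ 2 = 4 * N ∧ N * N = 1 := by
    rcases h with h | h
    · exact ⟨1, by rw [h]; rfl, rfl⟩
    · exact ⟨-1, by rw [h]; rfl, rfl⟩
  have hN' : (x ^ 2 - D * y ^ 2 : L) = 4 * N := by exact_mod_cast congrArg (Int.cast (R := L)) hN
  have hN1' : (N * N : L) = 1 := by exact_mod_cast congrArg (Int.cast (R := L)) hN1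
  have hquad : ∀ v : L, v ^ 2 = D → IsIntegral ℤ ((x + y * v) / 2) := fun v hv =>
    isIntegral_of_sq_eq (a := x) (b := -N) (by
      push_cast
      linear_combination (y ^ 2 / 4 : L) * hv - hN' / 4)
  refine ⟨(x + y * w) / 2, .of_mul_eq_one (hquad w hw)
    (y := N * ((x + y * -w) / 2)) ((isIntegral_intCast N).mul (hquad (-w) (by rw [neg_sq, hw]))) ?_,
    ?_, ?_⟩
  · linear_combination (N / 4 : L) * hN' - (N * y ^ 2 / 4 : L) * hw + hN1'
  · rw [map_div₀, map_add, map_mul, map_intCast, map_intCast, hψ, map_ofNat]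
    push_cast
    rfl
  · have hwm : w ∈ Subfield.closure {w} := Subfield.subset_closure rfl
    exact div_mem (add_mem (intCast_mem _ x) (mul_mem (intCast_mem _ y) hwm)) (ofNat_mem _ 2)

include hw hψ in
lemma IsFundUnit.exists_zpow_of_isIntUnit (hD : Squarefree D) {ε : ℝ} (hε : IsFundUnit D ε) {e : L}
    (he : ψ e = ε) {τ : L →+* L} (hτ : τ w = -w) {x : L} (hx : IsIntUnit x)
    (hmem : x ∈ Subfield.closure {w}) : ∃ k : ℤ, x = e ^ k ∨ x = -e ^ k := by
  obtain ⟨ρ, hρ, hxρ⟩ := hx.isRealQuadUnit hw hψ hD hτ hmem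
  obtain ⟨k, hk⟩ := hε.exists_zpow hρ
  refine ⟨k, ?_⟩
  rcases hk with rfl | rfl
  · left
    apply ψ.injective
    rw [hxρ, map_zpow₀, he, Complex.ofReal_zpow]
  · right
    apply ψ.injective
    rw [hxρ, map_neg, map_zpow₀, he, Complex.ofReal_neg, Complex.ofReal_zpow]

end QuadraticUnits

lemma squarefree_mul_of_prime {p q : ℕ} (hp : p.Prime) (hq : q.Prime) (h : p ≠ q) :
    Squarefree (p * q) :=
  (Nat.squarefree_mul ((Nat.coprime_primes hp hq).mpr h)).mpr ⟨hp.squarefree, hq.squarefree⟩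

lemma exists_octic {L : Type*} [Field L] {p₁ p₂ : ℕ} (hp₁ : p₁.Prime) (hp₂ : p₂.Prime)
    (hne : p₁ ≠ p₂) (hm₁ : p₁ % 8 = 5) (hm₂ : p₂ % 8 = 5) {s t i : L}
    (htop : Subfield.closure {s, t, i} = ⊤) (φ : L →+* ℂ) (hs : φ s = (Real.sqrt 2 : ℝ))
    (ht : φ t = (Real.sqrt ((p₁ : ℝ) * p₂) : ℝ)) (hi : φ i = Complex.I) {ε₂ εp εd : ℝ}
    (hε₂ : IsFundUnit 2 ε₂) (hεp : IsFundUnit (p₁ * p₂) εp) (hεd : IsFundUnit (2 * p₁ * p₂) εd)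
    {η : L} {y : ℝ} (hη : φ η = y) (hy : y ^ 2 = ε₂ * εp * εd) :
    ∃ C : Octic p₁ p₂ L, (∀ x, C.b x = x ∧ C.c x = x ↔ x ∈ Subfield.closure {t}) ∧
      ∀ x, C.a (C.b x) = x ∧ C.c x = x ↔ x ∈ Subfield.closure {t * i} := by
  have : CharZero L := φ.charZero
  have hnn : (0 : ℝ) ≤ p₁ * p₂ := by positivity
  have s2 : s ^ 2 = 2 := by
    apply φ.injective
    rw [map_pow, hs, ← Complex.ofReal_pow, Real.sq_sqrt (by norm_num), map_ofNat]
    norm_num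
  have t2 : t ^ 2 = p₁ * p₂ := by
    apply φ.injective
    rw [map_pow, ht, ← Complex.ofReal_pow, Real.sq_sqrt hnn]
    simp
  have i2 : i ^ 2 = -1 := by
    apply φ.injective
    rw [map_pow, hi, Complex.I_sq, map_neg, map_one]
  have hs0 : s ≠ 0 := by
    rintro rfl
    norm_num at s2
  have ht0 : t ≠ 0 := by
    rintro rfl
    have : (0 : L) = p₁ * p₂ := by rw [← t2]; ring
    simp [hp₁.ne_zero, hp₂.ne_zero] at this
  have hi0 : i ≠ 0 := by
    rintro rfl
    norm_num at i2
  have hsqf := squarefree_mul_of_prime hp₁ hp₂ hne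
  have hsqf2 : Squarefree (2 * p₁ * p₂) := by
    rw [mul_assoc]
    refine (Nat.squarefree_mul (Nat.Coprime.mul_right ?_ ?_)).mpr
      ⟨Nat.prime_two.squarefree, hsqf⟩
    · exact (Nat.coprime_primes Nat.prime_two hp₁).mpr (by lia)
    · exact (Nat.coprime_primes Nat.prime_two hp₂).mpr (by lia)
  have hd1 : p₁ * p₂ ≠ 1 := fun h => hp₁.one_lt.ne' (Nat.eq_one_of_mul_eq_one_right h)
  obtain ⟨a, b, c, ⟨as, at', ai⟩, ⟨bs, bt, bi⟩, ⟨cs, ct, ci⟩⟩ :=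
    exists_multiquadratic_ringHoms hsqf hd1 (by rwa [← mul_assoc]) s2 (t2.trans (by push_cast; rfl))
      i2 htop
  have ext : ∀ f g : L →+* L, f s = g s → f t = g t → f i = g i → ∀ x, f x = g x :=
    fun f g h1 h2 h3 => ringHom_ext_of_closure_eq_top htop h1 h2 h3
  have h2 : (2 : L) ≠ 0 := two_ne_zero
  have s2' : s ^ 2 = ((2 : ℚ) : L) := by rw [s2]; norm_num
  have t2' : t ^ 2 = ((p₁ * p₂ : ℚ) : L) := by rw [t2]; norm_num
  have i2' : i ^ 2 = ((-1 : ℚ) : L) := by rw [i2]; norm_num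
  have st2 : (s * t) ^ 2 = ((2 * p₁ * p₂ : ℕ) : L) := by
    rw [mul_pow, s2, t2]
    push_cast
    ring
  have ti2 : (t * i) ^ 2 = ((-(p₁ * p₂) : ℚ) : L) := by
    rw [mul_pow, i2, t2]
    push_cast
    ring
  have fixed : ∀ {S : Set L} {τ : L →+* L} {x : L}, (∀ y ∈ S, τ y = y) →
      x ∈ Subfield.closure S → τ x = x := fun {S τ x} h hx =>
    RingHom.eqOn_field_closure (f := τ) (g := RingHom.id L) h hx
  have mem_of_mul : ∀ {S : Subfield L} {u v : L}, u ≠ 0 → u ∈ S → u * v ∈ S → v ∈ S :=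
    fun {S u v} h0 hu huv => by
      rw [← inv_mul_cancel_left₀ h0 v]
      exact mul_mem (inv_mem hu) huv
  have mem_st : ∀ x, b x = x → x ∈ Subfield.closure {s, t} := fun x hx =>
    mem_closure_of_fixed h2 (ratCast_sq_mem_closure i2') hi0
      (by rintro y (rfl | rfl) <;> assumption) bi
      (by rw [Set.insert_comm, Set.pair_comm i, htop]; trivial) hx
  have mem_ti : ∀ x, c x = x → x ∈ Subfield.closure {t, i} := fun x hx =>
    mem_closure_of_fixed h2 (ratCast_sq_mem_closure s2') hs0
      (by rintro y (rfl | rfl) <;> assumption) cs (by rw [htop]; trivial) hx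
  have mem_s : ∀ x, a x = x → b x = x → x ∈ Subfield.closure {s} := fun x ha hb =>
    mem_closure_of_fixed h2 (ratCast_sq_mem_closure t2') ht0 (by rintro y rfl; exact as) at'
      (by rw [Set.pair_comm]; exact mem_st x hb) ha
  have mem_t : ∀ x, b x = x → c x = x → x ∈ Subfield.closure {t} := fun x hb hc =>
    mem_closure_of_fixed h2 (ratCast_sq_mem_closure s2') hs0 (by rintro y rfl; exact ct) cs
      (mem_st x hb) hc
  have mem_mul : ∀ x, b x = x → c x = a x → x ∈ Subfield.closure {s * t} := by
    intro x hb hc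
    refine mem_closure_of_fixed h2 (ratCast_sq_mem_closure s2') hs0 (τ := a.comp c) ?_
      (by rw [RingHom.comp_apply, cs, map_neg, as]) (x := x) ?_ ?_
    · rintro y rfl
      rw [RingHom.comp_apply, map_mul, map_mul, cs, ct, map_neg, as, at']
      ring
    · refine Subfield.closure_le.mpr ?_ (mem_st x hb)
      have hsm : s ∈ Subfield.closure {s, s * t} := Subfield.subset_closure (by simp)
      rintro y (rfl | rfl)
      · exact hsm
      · exact mem_of_mul hs0 hsm (Subfield.subset_closure (by simp))
    · rw [RingHom.comp_apply, hc]
      refine ext (a.comp a) (RingHom.id L) ?_ ?_ ?_ x <;>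
        simp only [RingHom.comp_apply, RingHom.id_apply, as, at', ai, map_neg, neg_neg]
  have abti : a.comp b (t * i) = t * i := by
    rw [RingHom.comp_apply, map_mul, map_mul, bt, bi, map_neg, ai, at']
    ring
  have cti : c (t * i) = t * i := by rw [map_mul, ct, ci]
  have mem_neg : ∀ x, a (b x) = x → c x = x → x ∈ Subfield.closure {t * i} := by
    intro x hab hc
    refine mem_closure_of_fixed h2 (ratCast_sq_mem_closure t2') ht0 (τ := a.comp b) ?_
      (by rw [RingHom.comp_apply, bt, at']) (x := x) ?_ hab
    · rintro y rfl
      exact abti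
    · refine Subfield.closure_le.mpr ?_ (mem_ti x hc)
      have htm : t ∈ Subfield.closure {t, t * i} := Subfield.subset_closure (by simp)
      rintro y (rfl | rfl)
      · exact htm
      · exact mem_of_mul ht0 htm (Subfield.subset_closure (by simp))
  have hs' : φ s = (Real.sqrt (2 : ℕ) : ℝ) := by simpa using hs
  have ht' : φ t = (Real.sqrt (p₁ * p₂ : ℕ) : ℝ) := by simpa using ht
  have hst' : φ (s * t) = (Real.sqrt (2 * p₁ * p₂ : ℕ) : ℝ) := by
    rw [map_mul, hs, ht, ← Complex.ofReal_mul, ← Real.sqrt_mul (by norm_num)]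
    push_cast
    rw [mul_assoc]
  have s2n : s ^ 2 = (2 : ℕ) := by rw [s2]; norm_num
  have t2n : t ^ 2 = (p₁ * p₂ : ℕ) := by rw [t2]; norm_num
  obtain ⟨e₂, hu₂, he₂, hmem₂⟩ := hε₂.exists_isIntUnit s2n hs'
  obtain ⟨eₚ, huₚ, heₚ, hmemₚ⟩ := hεp.exists_isIntUnit t2n ht'
  obtain ⟨eₜ, huₜ, heₜ, hmemₜ⟩ := hεd.exists_isIntUnit st2 hst'
  have cst : c (s * t) = -(s * t) := by rw [map_mul, cs, ct, neg_mul]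
  have φb : ∀ x, φ (b x) = (starRingEnd ℂ) (φ x) := by
    refine ringHom_ext_of_closure_eq_top htop (f := φ.comp b) (g := (starRingEnd ℂ).comp φ) ?_ ?_ ?_
    · simp only [RingHom.comp_apply, bs, hs, Complex.conj_ofReal]
    · simp only [RingHom.comp_apply, bt, ht, Complex.conj_ofReal]
    · simp only [RingHom.comp_apply, bi, hi, Complex.conj_I, map_neg]
  have pos : ∀ {D : ℕ} {ε : ℝ} {e : L}, IsFundUnit D ε → φ e = ε → 0 < (φ e).re := by
    intro D ε e hε he
    rw [he, Complex.ofReal_re]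
    exact zero_lt_one.trans hε.1
  refine ⟨⟨a, b, c, s, t, i, hp₁, hp₂, hne, hm₁, hm₂, ?_, ?_, ?_, ?_, ?_, ?_, s2, t2, i2, as, at', ai,
    bs, bt, bi, cs, ct, ci, ?_, φ, φb, e₂, eₚ, eₜ, η, hu₂, huₚ, huₜ, ?_, ?_, ?_, ?_, ?_, ?_,
    pos hε₂ he₂, pos hεp heₚ, pos hεd heₜ, ?_, ?_, ?_, ?_, ?_⟩, ?_, ?_⟩
  · refine ext (a.comp a) (RingHom.id L) ?_ ?_ ?_ <;>
      simp only [RingHom.comp_apply, RingHom.id_apply, as, at', ai, map_neg, neg_neg]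
  · refine ext (b.comp b) (RingHom.id L) ?_ ?_ ?_ <;>
      simp only [RingHom.comp_apply, RingHom.id_apply, bs, bt, bi, map_neg, neg_neg]
  · refine ext (c.comp c) (RingHom.id L) ?_ ?_ ?_ <;>
      simp only [RingHom.comp_apply, RingHom.id_apply, cs, ct, ci, map_neg, neg_neg]
  · refine ext (a.comp b) (b.comp a) ?_ ?_ ?_ <;>
      simp only [RingHom.comp_apply, as, at', ai, bs, bt, bi, map_neg]
  · refine ext (a.comp c) (c.comp a) ?_ ?_ ?_ <;>
      simp only [RingHom.comp_apply, as, at', ai, cs, ct, ci, map_neg]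
  · refine ext (b.comp c) (c.comp b) ?_ ?_ ?_ <;>
      simp only [RingHom.comp_apply, bs, bt, bi, cs, ct, ci, map_neg]
  · intro x ha hb hc
    refine exists_rat_of_mem_closure_empty (mem_closure_of_fixed h2 (ratCast_sq_mem_closure s2') hs0
      (fun y hy => hy.elim) cs ?_ hc)
    rw [insert_empty_eq]
    exact mem_s x ha hb
  · exact fixed (by rintro y rfl; exact as) hmem₂
  · exact fixed (by rintro y rfl; exact bs) hmem₂
  · exact fixed (by rintro y rfl; exact bt) hmemₚ
  · exact fixed (by rintro y rfl; exact ct) hmemₚ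
  · exact fixed (by rintro y rfl; rw [map_mul, bs, bt]) hmemₜ
  · exact RingHom.eqOn_field_closure (f := c) (g := a)
      (by rintro y rfl; rw [cst, map_mul, as, at', mul_neg]) hmemₜ
  · exact fun x hx ha hb => hε₂.exists_zpow_of_isIntUnit s2n hs' Nat.prime_two.squarefree he₂ cs hx
      (mem_s x ha hb)
  · exact fun x hx hb hc => hεp.exists_zpow_of_isIntUnit t2n ht' hsqf heₚ at' hx (mem_t x hb hc)
  · exact fun x hx hb hc => hεd.exists_zpow_of_isIntUnit st2 hst' hsqf2 heₜ cst hx (mem_mul x hb hc)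
  · apply φ.injective
    rw [φb, hη, Complex.conj_ofReal]
  · apply φ.injective
    rw [map_pow, map_mul, map_mul, he₂, heₚ, heₜ, hη]
    exact_mod_cast congrArg Complex.ofReal hy
  · exact fun x => ⟨fun h => mem_t x h.1 h.2, fun h => ⟨fixed (by rintro y rfl; exact bt) h,
      fixed (by rintro y rfl; exact ct) h⟩⟩
  · refine fun x => ⟨fun h => mem_neg x h.1 h.2, fun h =>
      ⟨fixed (τ := a.comp b) ?_ h, fixed ?_ h⟩⟩
    · rintro y rfl
      exact abti
    · rintro y rfl
      exact cti

lemma mem_adjoin_rat_iff {E : Type*} [Field E] [CharZero E] {S : Set E} {x : E} :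
    x ∈ IntermediateField.adjoin ℚ S ↔ x ∈ Subfield.closure S := by
  refine ⟨fun h => ?_, fun h => ?_⟩
  · refine Subfield.closure_le.mpr ?_ h
    rintro y (⟨q, rfl⟩ | hy)
    · exact SubfieldClass.ratCast_mem _ q
    · exact Subfield.subset_closure hy
  · exact (Subfield.closure_le (t := (IntermediateField.adjoin ℚ S).toSubfield)).mpr
      (IntermediateField.subset_adjoin ℚ S) h

lemma mem_range_inclusion_iff {E : Type*} [Field E] [CharZero E] {F K : IntermediateField ℚ E}
    (hFK : F ≤ K) {w : K} (hF : F = ℚ⟮(w : E)⟯) (x : K) :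
    x ∈ (IntermediateField.inclusion hFK : F →+* K).range ↔ x ∈ Subfield.closure {w} := by
  have h1 : x ∈ (IntermediateField.inclusion hFK : F →+* K).range ↔ (x : E) ∈ F :=
    ⟨by rintro ⟨y, rfl⟩; exact y.2, fun h => ⟨⟨x, h⟩, rfl⟩⟩
  have h2 : Subfield.closure {(w : E)} = (Subfield.closure {w}).map (algebraMap K E) := by
    rw [RingHom.map_field_closure, Set.image_singleton]
    rfl
  rw [h1, hF, mem_adjoin_rat_iff, h2]
  exact ⟨fun ⟨y, hy, hyx⟩ => (algebraMap K E).injective hyx ▸ hy, fun h => ⟨x, h, rfl⟩⟩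

lemma closure_eq_top_of_adjoin {E : Type*} [Field E] [CharZero E] {K : IntermediateField ℚ E}
    {S : Set K} (hK : K = IntermediateField.adjoin ℚ (algebraMap K E '' S)) :
    Subfield.closure S = ⊤ := by
  refine eq_top_iff.mpr fun x _ => ?_
  have hx : (x : E) ∈ Subfield.closure (algebraMap K E '' S) := by
    rw [← mem_adjoin_rat_iff, ← hK]
    exact x.2
  rw [← RingHom.map_field_closure] at hx
  obtain ⟨y, hy, hyx⟩ := hx
  exact (algebraMap K E).injective hyx ▸ hy

/-- With `2ⁿ = h₂(p₁p₂)`, `2^{m+1} = h₂(-p₁p₂)` (`n ≥ 1`, `m ≥ 2`): if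
`ε₂·ε_{p₁p₂}·ε_{2p₁p₂}` is a square in `K₃⁺ = ℚ(√2, √(p₁p₂))`, then
`Cl₂(K₃) ≃ ℤ/2^{min(m,n+1)} ℤ × ℤ/2^{max(m+1,n+2)} ℤ` where `K₃ = ℚ(√2, √(p₁p₂), i)`. -/
theorem stmt_5 (p₁ p₂ : ℕ) (hp₁ : p₁.Prime) (hp₂ : p₂.Prime) (hne : p₁ ≠ p₂)
    (hm₁ : p₁ % 8 = 5) (hm₂ : p₂ % 8 = 5)
    (n m : ℕ) (hn : 1 ≤ n) (hm : 2 ≤ m)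
    (Fp Fm K₃ : IntermediateField ℚ ℂ)
    (hFp : Fp = ℚ⟮((Real.sqrt ((p₁ : ℝ) * p₂) : ℝ) : ℂ)⟯)
    (hFm : Fm = ℚ⟮((Real.sqrt ((p₁ : ℝ) * p₂) : ℝ) : ℂ) * Complex.I⟯)
    (hK₃ : K₃ = ℚ⟮((Real.sqrt 2 : ℝ) : ℂ), ((Real.sqrt ((p₁ : ℝ) * p₂) : ℝ) : ℂ), Complex.I⟯)
    [NumberField Fp] [NumberField Fm] [NumberField K₃]
    (hhp : ∀ P : Sylow 2 (ClassGroup (RingOfIntegers Fp)), Nat.card P = 2 ^ n)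
    (hhm : ∀ P : Sylow 2 (ClassGroup (RingOfIntegers Fm)), Nat.card P = 2 ^ (m + 1))
    (ε₂ εp εd : ℝ)
    (hε₂ : IsFundUnit 2 ε₂) (hεp : IsFundUnit (p₁ * p₂) εp) (hεd : IsFundUnit (2 * p₁ * p₂) εd)
    (hsq : ∃ t : ℝ, t ∈ ℚ⟮Real.sqrt 2, Real.sqrt ((p₁ : ℝ) * p₂)⟯ ∧ t ^ 2 = ε₂ * εp * εd) :
    ∀ P : Sylow 2 (ClassGroup (RingOfIntegers K₃)),
      Nonempty (Additive P ≃+ (ZMod (2 ^ min m (n + 1)) × ZMod (2 ^ max (m + 1) (n + 2)))) := by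
  have hS : {((Real.sqrt 2 : ℝ) : ℂ), ((Real.sqrt ((p₁ : ℝ) * p₂) : ℝ) : ℂ), Complex.I} ⊆
      (K₃ : Set ℂ) := by
    rw [hK₃]
    exact IntermediateField.subset_adjoin _ _
  obtain ⟨s, hs⟩ : ∃ s : K₃, (s : ℂ) = (Real.sqrt 2 : ℝ) :=
    ⟨⟨_, hS (Or.inl rfl)⟩, rfl⟩
  obtain ⟨t, ht⟩ : ∃ t : K₃, (t : ℂ) = (Real.sqrt ((p₁ : ℝ) * p₂) : ℝ) :=
    ⟨⟨_, hS (Or.inr (Or.inl rfl))⟩, rfl⟩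
  obtain ⟨i, hi⟩ : ∃ i : K₃, (i : ℂ) = Complex.I :=
    ⟨⟨_, hS (Or.inr (Or.inr rfl))⟩, rfl⟩
  obtain ⟨y, hy, hy2⟩ := hsq
  obtain ⟨η, hη⟩ : ∃ η : K₃, (η : ℂ) = y := by
    refine ⟨⟨y, ?_⟩, rfl⟩
    have : ((y : ℝ) : ℂ) ∈ (Subfield.closure {Real.sqrt 2, Real.sqrt ((p₁ : ℝ) * p₂)}).map
        Complex.ofRealHom := ⟨y, mem_adjoin_rat_iff.mp hy, rfl⟩
    rw [RingHom.map_field_closure] at this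
    refine (Subfield.closure_le (t := K₃.toSubfield)).mpr ?_ this
    rintro _ ⟨z, rfl | rfl, rfl⟩
    · exact hS (Or.inl rfl)
    · exact hS (Or.inr (Or.inl rfl))
  have htop : Subfield.closure {s, t, i} = ⊤ := closure_eq_top_of_adjoin (by
    rw [Set.image_insert_eq, Set.image_pair]
    change K₃ = IntermediateField.adjoin ℚ {(s : ℂ), (t : ℂ), (i : ℂ)}
    rw [hs, ht, hi, hK₃])
  obtain ⟨C, hCp, hCm⟩ := exists_octic hp₁ hp₂ hne hm₁ hm₂ htop (algebraMap K₃ ℂ) hs ht hi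
    hε₂ hεp hεd hη hy2
  have hle : ∀ w : K₃, ∀ F : IntermediateField ℚ ℂ, F = ℚ⟮(w : ℂ)⟯ → F ≤ K₃ := by
    rintro w F rfl
    exact IntermediateField.adjoin_le_iff.mpr (by rintro _ rfl; exact w.2)
  rw [← ht] at hFp
  have hFm' : Fm = ℚ⟮((t * i : K₃) : ℂ)⟯ := by
    rw [hFm, ← ht, ← hi]
    rfl
  have hp := mem_range_inclusion_iff (hle _ _ hFp) hFp
  have hm' := mem_range_inclusion_iff (hle _ _ hFm') hFm'
  obtain ⟨e⟩ := C.nonempty_addEquiv (fun x => (hp x).trans (hCp x).symm)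
    (fun x => (hm' x).trans (hCm x).symm) (card_twoPart_eq hhp) (card_twoPart_eq hhm) hm
  intro P
  have hP := sylow_two_eq_twoPart P
  have : Nonempty (Additive (P : Subgroup (ClassGroup (𝓞 K₃))) ≃+
      ZMod (2 ^ min m (n + 1)) × ZMod (2 ^ max (m + 1) (n + 2))) := by
    rw [hP]
    exact ⟨e⟩
  exact this
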